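/- Substitution property of the self-translation, stoup into stoup: if Γ | x:A̲ ⊢ t : B̲ and Γ | z:D̲ ⊢ u : A̲ are derivable in EEC, then Γᶜ | k_z:B̲ᶜ ⊢ (t[u/x])ᶜ = uᶜ[(tᶜ[k_z/k_x]) / k_z] : D̲ᶜ in the equational theory of EEC. -/

import Mathlib

set_option autoImplicit false

namespace EEC

/-! # The enriched effect calculus (EEC)

A deep embedding of the enriched effect calculus of Egger, Møgelberg and
Simpson: value types and computation types, raw terms (de Bruijn indices for
value variables, together with a designated stoup variable `svar`), typing
derivations with an (at most singleton) stoup, the βη-equational theory, the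
simply-typed λ-calculus together with βη-equality and Moggi's computational
λ-calculus equality, the standard cbv/cbn translations of typed λ-calculus
into EEC, Hasegawa's linear-use CPS translations, and the generic linear-use
CPS self-translation of EEC. -/

mutual
  /-- Value types of EEC. -/
  inductive VType : Type
    | base : ℕ → VType                 -- value type constants α
    | unit : VType                     -- 1
    | prod : VType → VType → VType     -- A × B
    | arr : VType → VType → VType      -- A → B
    | comp : CType → VType             -- every computation type is a value type
    | lin : CType → CType → VType      -- A̲ ⊸ B̲
  /-- Computation types of EEC. -/
  inductive CType : Type
    | base : ℕ → CType                 -- computation type constants α̲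
    | cunit : CType                    -- 1̲
    | cand : CType → CType → CType     -- A̲ & B̲
    | carr : VType → CType → CType     -- A ⇒ B̲
    | iunit : CType                    -- I̲
    | bang : VType → CType             -- !A
    | copow : VType → CType → CType    -- !A ⊗ B̲
    | czero : CType                    -- 0̲
    | csum : CType → CType → CType     -- A̲ ⊕ B̲
end

/-- Raw terms of EEC.  Value variables are de Bruijn indices (`var n`, with
`var 0` the innermost bound variable); the unique stoup variable is `svar`
(the constructs `llam`, `copowlet` (in its body) and `ccase` (in its
branches) bind the stoup variable). -/
inductive Tm : Type
  | var : ℕ → Tm                -- value variable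
  | svar : Tm                   -- the stoup variable
  | unit : Tm                   -- * : 1
  | vpair : Tm → Tm → Tm        -- ⟨t,u⟩
  | vfst : Tm → Tm
  | vsnd : Tm → Tm
  | vlam : VType → Tm → Tm      -- λx:A. t
  | vapp : Tm → Tm → Tm
  | cunit : Tm                  -- ⋆ : 1̲
  | cpair : Tm → Tm → Tm        -- ⟨t,u⟩ : A̲ & B̲
  | cfst : Tm → Tm
  | csnd : Tm → Tm
  | clam : VType → Tm → Tm      -- λx:A ⇒ t
  | capp : Tm → Tm → Tm         -- s ⋅ t
  | top : Tm                    -- ⊤ : I̲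
  | ilet : Tm → Tm → Tm         -- t to ⊤. u
  | bang : Tm → Tm              -- !t
  | banglet : Tm → Tm → Tm      -- let !x = t in u   (binds a value variable in u)
  | copow : Tm → Tm → Tm        -- !t ⊗ u
  | copowlet : Tm → Tm → Tm     -- let !x⊗y = s in t (binds a value variable and the stoup variable in t)
  | cimage : CType → Tm → Tm    -- image_{A̲}(t)
  | cinl : Tm → Tm
  | cinr : Tm → Tm
  | ccase : Tm → Tm → Tm → Tm   -- case s of (x. t | y. u)  (branches bind the stoup variable)
  | llam : CType → Tm → Tm      -- λ°z:A̲. t (binds the stoup variable)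
  | lapp : Tm → Tm → Tm         -- s[t]

namespace Tm

/-- Lift a renaming of value variables under a binder. -/
def liftN (f : ℕ → ℕ) : ℕ → ℕ
  | 0 => 0
  | n + 1 => f n + 1

/-- Renaming of value variables. -/
def rename (f : ℕ → ℕ) : Tm → Tm
  | .var n => .var (f n)
  | .svar => .svar
  | .unit => .unit
  | .vpair t u => .vpair (rename f t) (rename f u)
  | .vfst t => .vfst (rename f t)
  | .vsnd t => .vsnd (rename f t)
  | .vlam A t => .vlam A (rename (liftN f) t)
  | .vapp s t => .vapp (rename f s) (rename f t)
  | .cunit => .cunit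
  | .cpair t u => .cpair (rename f t) (rename f u)
  | .cfst t => .cfst (rename f t)
  | .csnd t => .csnd (rename f t)
  | .clam A t => .clam A (rename (liftN f) t)
  | .capp s t => .capp (rename f s) (rename f t)
  | .top => .top
  | .ilet t u => .ilet (rename f t) (rename f u)
  | .bang t => .bang (rename f t)
  | .banglet t u => .banglet (rename f t) (rename (liftN f) u)
  | .copow t u => .copow (rename f t) (rename f u)
  | .copowlet s t => .copowlet (rename f s) (rename (liftN f) t)
  | .cimage A t => .cimage A (rename f t)
  | .cinl t => .cinl (rename f t)
  | .cinr t => .cinr (rename f t)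
  | .ccase s t u => .ccase (rename f s) (rename f t) (rename f u)
  | .llam A t => .llam A (rename f t)
  | .lapp s t => .lapp (rename f s) (rename f t)

/-- Weakening of value variables. -/
def shift (t : Tm) : Tm := rename Nat.succ t

/-- Lift a parallel substitution of value variables under a binder. -/
def liftS (σ : ℕ → Tm) : ℕ → Tm
  | 0 => .var 0
  | n + 1 => shift (σ n)

/-- Parallel (capture-avoiding) substitution for value variables. -/
def psubst (σ : ℕ → Tm) : Tm → Tm
  | .var n => σ n
  | .svar => .svar
  | .unit => .unit
  | .vpair t u => .vpair (psubst σ t) (psubst σ u)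
  | .vfst t => .vfst (psubst σ t)
  | .vsnd t => .vsnd (psubst σ t)
  | .vlam A t => .vlam A (psubst (liftS σ) t)
  | .vapp s t => .vapp (psubst σ s) (psubst σ t)
  | .cunit => .cunit
  | .cpair t u => .cpair (psubst σ t) (psubst σ u)
  | .cfst t => .cfst (psubst σ t)
  | .csnd t => .csnd (psubst σ t)
  | .clam A t => .clam A (psubst (liftS σ) t)
  | .capp s t => .capp (psubst σ s) (psubst σ t)
  | .top => .top
  | .ilet t u => .ilet (psubst σ t) (psubst σ u)
  | .bang t => .bang (psubst σ t)
  | .banglet t u => .banglet (psubst σ t) (psubst (liftS σ) u)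
  | .copow t u => .copow (psubst σ t) (psubst σ u)
  | .copowlet s t => .copowlet (psubst σ s) (psubst (liftS σ) t)
  | .cimage A t => .cimage A (psubst σ t)
  | .cinl t => .cinl (psubst σ t)
  | .cinr t => .cinr (psubst σ t)
  | .ccase s t u => .ccase (psubst σ s) (psubst σ t) (psubst σ u)
  | .llam A t => .llam A (psubst σ t)
  | .lapp s t => .lapp (psubst σ s) (psubst σ t)

/-- Capture-avoiding substitution `t[u/x]` of a term `u` for the innermost
value variable of `t`. -/
def subst0 (u : Tm) (t : Tm) : Tm :=
  psubst (fun n => match n with | 0 => u | m + 1 => .var m) t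

/-- Capture-avoiding substitution `t[u/z]` of a term `u` for the stoup
variable of `t`.  The substitution stops at the stoup-variable binders
(`llam`-bodies, `copowlet`-bodies and `ccase`-branches). -/
def ssubst (u : Tm) : Tm → Tm
  | .var n => .var n
  | .svar => u
  | .unit => .unit
  | .vpair t t' => .vpair (ssubst u t) (ssubst u t')
  | .vfst t => .vfst (ssubst u t)
  | .vsnd t => .vsnd (ssubst u t)
  | .vlam A t => .vlam A (ssubst (shift u) t)
  | .vapp s t => .vapp (ssubst u s) (ssubst u t)
  | .cunit => .cunit
  | .cpair t t' => .cpair (ssubst u t) (ssubst u t')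
  | .cfst t => .cfst (ssubst u t)
  | .csnd t => .csnd (ssubst u t)
  | .clam A t => .clam A (ssubst (shift u) t)
  | .capp s t => .capp (ssubst u s) (ssubst u t)
  | .top => .top
  | .ilet t t' => .ilet (ssubst u t) (ssubst u t')
  | .bang t => .bang (ssubst u t)
  | .banglet t t' => .banglet (ssubst u t) (ssubst (shift u) t')
  | .copow t t' => .copow (ssubst u t) (ssubst u t')
  | .copowlet s t => .copowlet (ssubst u s) t
  | .cimage A t => .cimage A (ssubst u t)
  | .cinl t => .cinl (ssubst u t)
  | .cinr t => .cinr (ssubst u t)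
  | .ccase s t t' => .ccase (ssubst u s) t t'
  | .llam A t => .llam A t
  | .lapp s t => .lapp (ssubst u s) (ssubst u t)

end Tm

/-- Typing derivations of EEC (Figure 1 of the paper).  `Deriv Γ none t A`
is the judgement `Γ ⊢ t : A` (empty stoup); `Deriv Γ (some A̲) t (.comp B̲)`
is the judgement `Γ | z:A̲ ⊢ t : B̲`.  In the rules below `Δ` ranges over an
arbitrary (possibly empty) stoup. -/
inductive Deriv : List VType → Option CType → Tm → VType → Type
  | var (Γ : List VType) (n : ℕ) (A : VType) :
      Γ[n]? = some A → Deriv Γ none (.var n) A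
  | svar (Γ : List VType) (A : CType) : Deriv Γ (some A) .svar (.comp A)
  | unit (Γ : List VType) : Deriv Γ none .unit .unit
  | vpair (Γ : List VType) (t u : Tm) (A B : VType) :
      Deriv Γ none t A → Deriv Γ none u B → Deriv Γ none (.vpair t u) (.prod A B)
  | vfst (Γ : List VType) (t : Tm) (A B : VType) :
      Deriv Γ none t (.prod A B) → Deriv Γ none (.vfst t) A
  | vsnd (Γ : List VType) (t : Tm) (A B : VType) :
      Deriv Γ none t (.prod A B) → Deriv Γ none (.vsnd t) B
  | vlam (Γ : List VType) (t : Tm) (A B : VType) :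
      Deriv (A :: Γ) none t B → Deriv Γ none (.vlam A t) (.arr A B)
  | vapp (Γ : List VType) (s t : Tm) (A B : VType) :
      Deriv Γ none s (.arr A B) → Deriv Γ none t A → Deriv Γ none (.vapp s t) B
  | cunit (Γ : List VType) (Δ : Option CType) : Deriv Γ Δ .cunit (.comp .cunit)
  | cpair (Γ : List VType) (Δ : Option CType) (t u : Tm) (A B : CType) :
      Deriv Γ Δ t (.comp A) → Deriv Γ Δ u (.comp B) →
      Deriv Γ Δ (.cpair t u) (.comp (.cand A B))
  | cfst (Γ : List VType) (Δ : Option CType) (t : Tm) (A B : CType) :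
      Deriv Γ Δ t (.comp (.cand A B)) → Deriv Γ Δ (.cfst t) (.comp A)
  | csnd (Γ : List VType) (Δ : Option CType) (t : Tm) (A B : CType) :
      Deriv Γ Δ t (.comp (.cand A B)) → Deriv Γ Δ (.csnd t) (.comp B)
  | clam (Γ : List VType) (Δ : Option CType) (t : Tm) (A : VType) (B : CType) :
      Deriv (A :: Γ) Δ t (.comp B) → Deriv Γ Δ (.clam A t) (.comp (.carr A B))
  | capp (Γ : List VType) (Δ : Option CType) (s t : Tm) (A : VType) (B : CType) :
      Deriv Γ Δ s (.comp (.carr A B)) → Deriv Γ none t A →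
      Deriv Γ Δ (.capp s t) (.comp B)
  | top (Γ : List VType) : Deriv Γ none .top (.comp .iunit)
  | ilet (Γ : List VType) (Δ : Option CType) (t u : Tm) (A : CType) :
      Deriv Γ Δ t (.comp .iunit) → Deriv Γ none u (.comp A) →
      Deriv Γ Δ (.ilet t u) (.comp A)
  | bang (Γ : List VType) (t : Tm) (A : VType) :
      Deriv Γ none t A → Deriv Γ none (.bang t) (.comp (.bang A))
  | banglet (Γ : List VType) (Δ : Option CType) (t u : Tm) (A : VType) (B : CType) :
      Deriv Γ Δ t (.comp (.bang A)) → Deriv (A :: Γ) none u (.comp B) →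
      Deriv Γ Δ (.banglet t u) (.comp B)
  | copow (Γ : List VType) (Δ : Option CType) (t u : Tm) (A : VType) (B : CType) :
      Deriv Γ none t A → Deriv Γ Δ u (.comp B) →
      Deriv Γ Δ (.copow t u) (.comp (.copow A B))
  | copowlet (Γ : List VType) (Δ : Option CType) (s t : Tm) (A : VType) (B C : CType) :
      Deriv Γ Δ s (.comp (.copow A B)) → Deriv (A :: Γ) (some B) t (.comp C) →
      Deriv Γ Δ (.copowlet s t) (.comp C)
  | cimage (Γ : List VType) (Δ : Option CType) (t : Tm) (A : CType) :
      Deriv Γ Δ t (.comp .czero) → Deriv Γ Δ (.cimage A t) (.comp A)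
  | cinl (Γ : List VType) (Δ : Option CType) (t : Tm) (A B : CType) :
      Deriv Γ Δ t (.comp A) → Deriv Γ Δ (.cinl t) (.comp (.csum A B))
  | cinr (Γ : List VType) (Δ : Option CType) (t : Tm) (A B : CType) :
      Deriv Γ Δ t (.comp B) → Deriv Γ Δ (.cinr t) (.comp (.csum A B))
  | ccase (Γ : List VType) (Δ : Option CType) (s t u : Tm) (A B C : CType) :
      Deriv Γ Δ s (.comp (.csum A B)) → Deriv Γ (some A) t (.comp C) →
      Deriv Γ (some B) u (.comp C) → Deriv Γ Δ (.ccase s t u) (.comp C)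
  | llam (Γ : List VType) (t : Tm) (A B : CType) :
      Deriv Γ (some A) t (.comp B) → Deriv Γ none (.llam A t) (.lin A B)
  | lapp (Γ : List VType) (Δ : Option CType) (s t : Tm) (A B : CType) :
      Deriv Γ none s (.lin A B) → Deriv Γ Δ t (.comp A) →
      Deriv Γ Δ (.lapp s t) (.comp B)

/-- The equational theory of EEC: the smallest type-respecting congruence
containing the βη-equalities of Figure 2 of the paper. -/
inductive EEq : List VType → Option CType → Tm → Tm → VType → Prop
  -- equivalence
  | refl {Γ Δ t A} : Deriv Γ Δ t A → EEq Γ Δ t t A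
  | symm {Γ Δ t u A} : EEq Γ Δ t u A → EEq Γ Δ u t A
  | trans {Γ Δ t u v A} : EEq Γ Δ t u A → EEq Γ Δ u v A → EEq Γ Δ t v A
  -- congruence rules
  | vpair_cong {Γ t t' u u' A B} : EEq Γ none t t' A → EEq Γ none u u' B →
      EEq Γ none (.vpair t u) (.vpair t' u') (.prod A B)
  | vfst_cong {Γ t t' A B} : EEq Γ none t t' (.prod A B) →
      EEq Γ none (.vfst t) (.vfst t') A
  | vsnd_cong {Γ t t' A B} : EEq Γ none t t' (.prod A B) →
      EEq Γ none (.vsnd t) (.vsnd t') B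
  | vlam_cong {Γ t t' A B} : EEq (A :: Γ) none t t' B →
      EEq Γ none (.vlam A t) (.vlam A t') (.arr A B)
  | vapp_cong {Γ s s' t t' A B} : EEq Γ none s s' (.arr A B) → EEq Γ none t t' A →
      EEq Γ none (.vapp s t) (.vapp s' t') B
  | cpair_cong {Γ Δ t t' u u' A B} : EEq Γ Δ t t' (.comp A) → EEq Γ Δ u u' (.comp B) →
      EEq Γ Δ (.cpair t u) (.cpair t' u') (.comp (.cand A B))
  | cfst_cong {Γ Δ t t' A B} : EEq Γ Δ t t' (.comp (.cand A B)) →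
      EEq Γ Δ (.cfst t) (.cfst t') (.comp A)
  | csnd_cong {Γ Δ t t' A B} : EEq Γ Δ t t' (.comp (.cand A B)) →
      EEq Γ Δ (.csnd t) (.csnd t') (.comp B)
  | clam_cong {Γ Δ t t' A B} : EEq (A :: Γ) Δ t t' (.comp B) →
      EEq Γ Δ (.clam A t) (.clam A t') (.comp (.carr A B))
  | capp_cong {Γ Δ s s' t t' A B} : EEq Γ Δ s s' (.comp (.carr A B)) → EEq Γ none t t' A →
      EEq Γ Δ (.capp s t) (.capp s' t') (.comp B)
  | ilet_cong {Γ Δ t t' u u' A} : EEq Γ Δ t t' (.comp .iunit) → EEq Γ none u u' (.comp A) →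
      EEq Γ Δ (.ilet t u) (.ilet t' u') (.comp A)
  | bang_cong {Γ t t' A} : EEq Γ none t t' A →
      EEq Γ none (.bang t) (.bang t') (.comp (.bang A))
  | banglet_cong {Γ Δ t t' u u' A B} : EEq Γ Δ t t' (.comp (.bang A)) →
      EEq (A :: Γ) none u u' (.comp B) →
      EEq Γ Δ (.banglet t u) (.banglet t' u') (.comp B)
  | copow_cong {Γ Δ t t' u u' A B} : EEq Γ none t t' A → EEq Γ Δ u u' (.comp B) →
      EEq Γ Δ (.copow t u) (.copow t' u') (.comp (.copow A B))
  | copowlet_cong {Γ Δ s s' t t' A B C} : EEq Γ Δ s s' (.comp (.copow A B)) →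
      EEq (A :: Γ) (some B) t t' (.comp C) →
      EEq Γ Δ (.copowlet s t) (.copowlet s' t') (.comp C)
  | cimage_cong {Γ Δ t t' A} : EEq Γ Δ t t' (.comp .czero) →
      EEq Γ Δ (.cimage A t) (.cimage A t') (.comp A)
  | cinl_cong {Γ Δ t t' A B} : EEq Γ Δ t t' (.comp A) →
      EEq Γ Δ (.cinl t) (.cinl t') (.comp (.csum A B))
  | cinr_cong {Γ Δ t t' A B} : EEq Γ Δ t t' (.comp B) →
      EEq Γ Δ (.cinr t) (.cinr t') (.comp (.csum A B))
  | ccase_cong {Γ Δ s s' t t' u u' A B C} : EEq Γ Δ s s' (.comp (.csum A B)) →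
      EEq Γ (some A) t t' (.comp C) → EEq Γ (some B) u u' (.comp C) →
      EEq Γ Δ (.ccase s t u) (.ccase s' t' u') (.comp C)
  | llam_cong {Γ t t' A B} : EEq Γ (some A) t t' (.comp B) →
      EEq Γ none (.llam A t) (.llam A t') (.lin A B)
  | lapp_cong {Γ Δ s s' t t' A B} : EEq Γ none s s' (.lin A B) → EEq Γ Δ t t' (.comp A) →
      EEq Γ Δ (.lapp s t) (.lapp s' t') (.comp B)
  -- the equalities of Figure 2
  | unit_eta {Γ t} : Deriv Γ none t .unit → EEq Γ none t .unit .unit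
  | vfst_beta {Γ t u A B} : Deriv Γ none t A → Deriv Γ none u B →
      EEq Γ none (.vfst (.vpair t u)) t A
  | vsnd_beta {Γ t u A B} : Deriv Γ none t A → Deriv Γ none u B →
      EEq Γ none (.vsnd (.vpair t u)) u B
  | vpair_eta {Γ t A B} : Deriv Γ none t (.prod A B) →
      EEq Γ none (.vpair (.vfst t) (.vsnd t)) t (.prod A B)
  | vlam_beta {Γ t u A B} : Deriv (A :: Γ) none t B → Deriv Γ none u A →
      EEq Γ none (.vapp (.vlam A t) u) (Tm.subst0 u t) B
  | vlam_eta {Γ t A B} : Deriv Γ none t (.arr A B) →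
      EEq Γ none (.vlam A (.vapp (Tm.shift t) (.var 0))) t (.arr A B)
  | cunit_eta {Γ Δ t} : Deriv Γ Δ t (.comp .cunit) → EEq Γ Δ t .cunit (.comp .cunit)
  | cfst_beta {Γ Δ t u A B} : Deriv Γ Δ t (.comp A) → Deriv Γ Δ u (.comp B) →
      EEq Γ Δ (.cfst (.cpair t u)) t (.comp A)
  | csnd_beta {Γ Δ t u A B} : Deriv Γ Δ t (.comp A) → Deriv Γ Δ u (.comp B) →
      EEq Γ Δ (.csnd (.cpair t u)) u (.comp B)
  | cpair_eta {Γ Δ t A B} : Deriv Γ Δ t (.comp (.cand A B)) →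
      EEq Γ Δ (.cpair (.cfst t) (.csnd t)) t (.comp (.cand A B))
  | clam_beta {Γ Δ t u A B} : Deriv (A :: Γ) Δ t (.comp B) → Deriv Γ none u A →
      EEq Γ Δ (.capp (.clam A t) u) (Tm.subst0 u t) (.comp B)
  | clam_eta {Γ Δ t A B} : Deriv Γ Δ t (.comp (.carr A B)) →
      EEq Γ Δ (.clam A (.capp (Tm.shift t) (.var 0))) t (.comp (.carr A B))
  | ilet_beta {Γ t A} : Deriv Γ none t (.comp A) →
      EEq Γ none (.ilet .top t) t (.comp A)
  | ilet_eta {Γ Δ t u A} : Deriv Γ Δ t (.comp .iunit) → Deriv Γ (some .iunit) u (.comp A) →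
      EEq Γ Δ (.ilet t (Tm.ssubst .top u)) (Tm.ssubst t u) (.comp A)
  | bang_beta {Γ t u A B} : Deriv Γ none t A → Deriv (A :: Γ) none u (.comp B) →
      EEq Γ none (.banglet (.bang t) u) (Tm.subst0 t u) (.comp B)
  | bang_eta {Γ Δ t u A B} : Deriv Γ Δ t (.comp (.bang A)) →
      Deriv Γ (some (.bang A)) u (.comp B) →
      EEq Γ Δ (.banglet t (Tm.ssubst (.bang (.var 0)) (Tm.shift u))) (Tm.ssubst t u) (.comp B)
  | copow_beta {Γ Δ t s u A B C} : Deriv Γ none t A → Deriv Γ Δ s (.comp B) →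
      Deriv (A :: Γ) (some B) u (.comp C) →
      EEq Γ Δ (.copowlet (.copow t s) u) (Tm.ssubst s (Tm.subst0 t u)) (.comp C)
  | copow_eta {Γ Δ t u A B C} : Deriv Γ Δ t (.comp (.copow A B)) →
      Deriv Γ (some (.copow A B)) u (.comp C) →
      EEq Γ Δ (.copowlet t (Tm.ssubst (.copow (.var 0) .svar) (Tm.shift u))) (Tm.ssubst t u) (.comp C)
  | czero_eta {Γ Δ t u A} : Deriv Γ Δ t (.comp .czero) → Deriv Γ (some .czero) u (.comp A) →
      EEq Γ Δ (.cimage A t) (Tm.ssubst t u) (.comp A)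
  | csum_beta_inl {Γ Δ t u u' A B C} : Deriv Γ (some A) u (.comp C) →
      Deriv Γ (some B) u' (.comp C) → Deriv Γ Δ t (.comp A) →
      EEq Γ Δ (.ccase (.cinl t) u u') (Tm.ssubst t u) (.comp C)
  | csum_beta_inr {Γ Δ t u u' A B C} : Deriv Γ (some A) u (.comp C) →
      Deriv Γ (some B) u' (.comp C) → Deriv Γ Δ t (.comp B) →
      EEq Γ Δ (.ccase (.cinr t) u u') (Tm.ssubst t u') (.comp C)
  | csum_eta {Γ Δ t u A B C} : Deriv Γ Δ t (.comp (.csum A B)) →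
      Deriv Γ (some (.csum A B)) u (.comp C) →
      EEq Γ Δ (.ccase t (Tm.ssubst (.cinl .svar) u) (Tm.ssubst (.cinr .svar) u)) (Tm.ssubst t u) (.comp C)
  | llam_beta {Γ Δ t u A B} : Deriv Γ (some A) t (.comp B) → Deriv Γ Δ u (.comp A) →
      EEq Γ Δ (.lapp (.llam A t) u) (Tm.ssubst u t) (.comp B)
  | llam_eta {Γ t A B} : Deriv Γ none t (.lin A B) →
      EEq Γ none (.llam A (.lapp t .svar)) t (.lin A B)

end EEC

namespace EEC

/-! ## The generic linear-use CPS self-translation of EEC (Figures 4–6) -/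

mutual
  /-- CPS translation `Aᶜ` of value types, relative to the result type `R̲`. -/
  def cpsV (R : CType) : VType → VType
    | .base a => .base a
    | .unit => .unit
    | .prod A B => .prod (cpsV R A) (cpsV R B)
    | .arr A B => .arr (cpsV R A) (cpsV R B)
    | .comp A => .lin (cpsC R A) R
    | .lin A B => .lin (cpsC R B) (cpsC R A)
  /-- CPS translation `A̲ᶜ` of computation types, relative to the result type
  `R̲` (a computation-type constant equal to `R̲` is translated to `I̲`). -/
  def cpsC (R : CType) : CType → CType
    | .base a =>
        match R with
        | .base b => if b = a then .iunit else .base a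
        | _ => .base a
    | .cunit => .czero
    | .cand A B => .csum (cpsC R A) (cpsC R B)
    | .carr A B => .copow (cpsV R A) (cpsC R B)
    | .iunit => R
    | .bang A => .carr (cpsV R A) R
    | .copow A B => .carr (cpsV R A) (cpsC R B)
    | .czero => .cunit
    | .csum A B => .cand (cpsC R A) (cpsC R B)
end

/-- Pointwise CPS translation `Γᶜ` of a context. -/
def cpsCtx (R : CType) (Γ : List VType) : List VType := Γ.map (cpsV R)

/-- The generic linear-use CPS self-translation on terms (Figures 5 and 6 of
the paper), defined by recursion on typing derivations.  A value judgement
`Γ ⊢ t : A` is sent to a term `tᶜ` with `Γᶜ ⊢ tᶜ : Aᶜ`, and a stoup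
judgement `Γ | z:A̲ ⊢ t : B̲` is sent (contravariantly) to a term `tᶜ` with
`Γᶜ | k_z:B̲ᶜ ⊢ tᶜ : A̲ᶜ`. -/
def cps (R : CType) : {Γ : List VType} → {Δ : Option CType} → {t : Tm} → {A : VType} →
    Deriv Γ Δ t A → Tm
  | _, _, _, _, .var _ n _ _ => .var n
  | _, _, _, _, .svar _ _ => .svar
  | _, _, _, _, .unit _ => .unit
  | _, _, _, _, .vpair _ _ _ _ _ d1 d2 => .vpair (cps R d1) (cps R d2)
  | _, _, _, _, .vfst _ _ _ _ d => .vfst (cps R d)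
  | _, _, _, _, .vsnd _ _ _ _ d => .vsnd (cps R d)
  | _, _, _, _, .vlam _ _ A _ d => .vlam (cpsV R A) (cps R d)
  | _, _, _, _, .vapp _ _ _ _ _ d1 d2 => .vapp (cps R d1) (cps R d2)
  | _, _, _, _, .cunit _ none => .llam .czero (.cimage R .svar)
  | _, _, _, _, .cunit _ (some D) => .cimage (cpsC R D) .svar
  | _, _, _, _, .cpair _ none _ _ A B d1 d2 =>
      .llam (.csum (cpsC R A) (cpsC R B))
        (.ccase .svar (.lapp (cps R d1) .svar) (.lapp (cps R d2) .svar))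
  | _, _, _, _, .cpair _ (some _) _ _ _ _ d1 d2 => .ccase .svar (cps R d1) (cps R d2)
  | _, _, _, _, .cfst _ none _ A _ d => .llam (cpsC R A) (.lapp (cps R d) (.cinl .svar))
  | _, _, _, _, .cfst _ (some _) _ _ _ d => Tm.ssubst (.cinl .svar) (cps R d)
  | _, _, _, _, .csnd _ none _ _ B d => .llam (cpsC R B) (.lapp (cps R d) (.cinr .svar))
  | _, _, _, _, .csnd _ (some _) _ _ _ d => Tm.ssubst (.cinr .svar) (cps R d)
  | _, _, _, _, .clam _ none _ A B d =>
      .llam (.copow (cpsV R A) (cpsC R B)) (.copowlet .svar (.lapp (cps R d) .svar))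
  | _, _, _, _, .clam _ (some _) _ _ _ d => .copowlet .svar (cps R d)
  | _, _, _, _, .capp _ none _ _ _ B d1 d2 =>
      .llam (cpsC R B) (.lapp (cps R d1) (.copow (cps R d2) .svar))
  | _, _, _, _, .capp _ (some _) _ _ _ _ d1 d2 =>
      Tm.ssubst (.copow (cps R d2) .svar) (cps R d1)
  | _, _, _, _, .top _ => .llam R .svar
  | _, _, _, _, .ilet _ none _ _ A d1 d2 =>
      .llam (cpsC R A) (.lapp (cps R d1) (.lapp (cps R d2) .svar))
  | _, _, _, _, .ilet _ (some _) _ _ _ d1 d2 =>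
      Tm.ssubst (.lapp (cps R d2) .svar) (cps R d1)
  | _, _, _, _, .bang _ _ A d => .llam (.carr (cpsV R A) R) (.capp .svar (cps R d))
  | _, _, _, _, .banglet _ none _ _ A B d1 d2 =>
      .llam (cpsC R B) (.lapp (cps R d1) (.clam (cpsV R A) (.lapp (cps R d2) .svar)))
  | _, _, _, _, .banglet _ (some _) _ _ A _ d1 d2 =>
      Tm.ssubst (.clam (cpsV R A) (.lapp (cps R d2) .svar)) (cps R d1)
  | _, _, _, _, .copow _ none _ _ A B d1 d2 =>
      .llam (.carr (cpsV R A) (cpsC R B)) (.lapp (cps R d2) (.capp .svar (cps R d1)))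
  | _, _, _, _, .copow _ (some _) _ _ _ _ d1 d2 =>
      Tm.ssubst (.capp .svar (cps R d1)) (cps R d2)
  | _, _, _, _, .copowlet _ none _ _ A _ C d1 d2 =>
      .llam (cpsC R C) (.lapp (cps R d1) (.clam (cpsV R A) (cps R d2)))
  | _, _, _, _, .copowlet _ (some _) _ _ A _ _ d1 d2 =>
      Tm.ssubst (.clam (cpsV R A) (cps R d2)) (cps R d1)
  | _, _, _, _, .cimage _ none _ A d => .llam (cpsC R A) (.lapp (cps R d) .cunit)
  | _, _, _, _, .cimage _ (some _) _ _ d => Tm.ssubst .cunit (cps R d)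
  | _, _, _, _, .cinl _ none _ A B d =>
      .llam (.cand (cpsC R A) (cpsC R B)) (.lapp (cps R d) (.cfst .svar))
  | _, _, _, _, .cinl _ (some _) _ _ _ d => Tm.ssubst (.cfst .svar) (cps R d)
  | _, _, _, _, .cinr _ none _ A B d =>
      .llam (.cand (cpsC R A) (cpsC R B)) (.lapp (cps R d) (.csnd .svar))
  | _, _, _, _, .cinr _ (some _) _ _ _ d => Tm.ssubst (.csnd .svar) (cps R d)
  | _, _, _, _, .ccase _ none _ _ _ _ _ C d1 d2 d3 =>
      .llam (cpsC R C) (.lapp (cps R d1) (.cpair (cps R d2) (cps R d3)))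
  | _, _, _, _, .ccase _ (some _) _ _ _ _ _ _ d1 d2 d3 =>
      Tm.ssubst (.cpair (cps R d2) (cps R d3)) (cps R d1)
  | _, _, _, _, .llam _ _ _ B d => .llam (cpsC R B) (cps R d)
  | _, _, _, _, .lapp _ none _ _ _ B d1 d2 =>
      .llam (cpsC R B) (.lapp (cps R d2) (.lapp (cps R d1) .svar))
  | _, _, _, _, .lapp _ (some _) _ _ _ _ d1 d2 =>
      Tm.ssubst (.lapp (cps R d1) .svar) (cps R d2)

end EEC

namespace EEC

/-! ## The type isomorphisms `ι` of Figure 7, with explicit inverses -/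

mutual
  /-- The closed term `ι_A : (Aᶜ)ᶜ → A` (Figure 7). -/
  def iotaV (R : CType) : VType → Tm
    | .base a => .vlam (.base a) (.var 0)
    | .unit => .vlam .unit .unit
    | .prod A B => .vlam (cpsV R (cpsV R (.prod A B)))
        (.vpair (.vapp (iotaV R A) (.vfst (.var 0))) (.vapp (iotaV R B) (.vsnd (.var 0))))
    | .arr A B => .vlam (cpsV R (cpsV R (.arr A B)))
        (.vlam A (.vapp (iotaV R B) (.vapp (.var 1) (.vapp (iotaVinv R A) (.var 0)))))
    | .comp A => .vlam (cpsV R (cpsV R (.comp A)))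
        (.lapp (iotaC R A) (.lapp (.var 0) .top))
    | .lin A B => .vlam (cpsV R (cpsV R (.lin A B)))
        (.llam A (.lapp (iotaC R B) (.lapp (.var 0) (.lapp (iotaCinv R A) .svar))))
  /-- The closed term `ι_A⁻¹ : A → (Aᶜ)ᶜ`. -/
  def iotaVinv (R : CType) : VType → Tm
    | .base a => .vlam (.base a) (.var 0)
    | .unit => .vlam .unit .unit
    | .prod A B => .vlam (.prod A B)
        (.vpair (.vapp (iotaVinv R A) (.vfst (.var 0))) (.vapp (iotaVinv R B) (.vsnd (.var 0))))
    | .arr A B => .vlam (.arr A B)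
        (.vlam (cpsV R (cpsV R A)) (.vapp (iotaVinv R B) (.vapp (.var 1) (.vapp (iotaV R A) (.var 0)))))
    | .comp A => .vlam (.comp A)
        (.llam .iunit (.ilet .svar (.lapp (iotaCinv R A) (.var 0))))
    | .lin A B => .vlam (.lin A B)
        (.llam (cpsC R (cpsC R A)) (.lapp (iotaCinv R B) (.lapp (.var 0) (.lapp (iotaC R A) .svar))))
  /-- The closed term `ι_A̲ : (A̲ᶜ)ᶜ ⊸ A̲` (Figure 7). -/
  def iotaC (R : CType) : CType → Tm
    | .base a => .llam (cpsC R (cpsC R (.base a))) .svar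
    | .cunit => .llam (cpsC R (cpsC R .cunit)) .cunit
    | .cand A B => .llam (cpsC R (cpsC R (.cand A B)))
        (.cpair (.lapp (iotaC R A) (.cfst .svar)) (.lapp (iotaC R B) (.csnd .svar)))
    | .carr A B => .llam (cpsC R (cpsC R (.carr A B)))
        (.clam A (.lapp (iotaC R B) (.capp .svar (.vapp (iotaVinv R A) (.var 0)))))
    | .iunit => .llam (cpsC R (cpsC R .iunit)) .svar
    | .bang A => .llam (cpsC R (cpsC R (.bang A)))
        (.copowlet .svar (.ilet .svar (.bang (.vapp (iotaV R A) (.var 0)))))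
    | .copow A B => .llam (cpsC R (cpsC R (.copow A B)))
        (.copowlet .svar (.copow (.vapp (iotaV R A) (.var 0)) (.lapp (iotaC R B) .svar)))
    | .czero => .llam (cpsC R (cpsC R .czero)) .svar
    | .csum A B => .llam (cpsC R (cpsC R (.csum A B)))
        (.ccase .svar (.cinl (.lapp (iotaC R A) .svar)) (.cinr (.lapp (iotaC R B) .svar)))
  /-- The closed term `ι_A̲⁻¹ : A̲ ⊸ (A̲ᶜ)ᶜ`. -/
  def iotaCinv (R : CType) : CType → Tm
    | .base a => .llam (.base a) .svar
    | .cunit => .llam .cunit .cunit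
    | .cand A B => .llam (.cand A B)
        (.cpair (.lapp (iotaCinv R A) (.cfst .svar)) (.lapp (iotaCinv R B) (.csnd .svar)))
    | .carr A B => .llam (.carr A B)
        (.clam (cpsV R (cpsV R A)) (.lapp (iotaCinv R B) (.capp .svar (.vapp (iotaV R A) (.var 0)))))
    | .iunit => .llam .iunit .svar
    | .bang A => .llam (.bang A)
        (.banglet .svar (.copow (.vapp (iotaVinv R A) (.var 0)) .top))
    | .copow A B => .llam (.copow A B)
        (.copowlet .svar (.copow (.vapp (iotaVinv R A) (.var 0)) (.lapp (iotaCinv R B) .svar)))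
    | .czero => .llam .czero .svar
    | .csum A B => .llam (.csum A B)
        (.ccase .svar (.cinl (.lapp (iotaCinv R A) .svar)) (.cinr (.lapp (iotaCinv R B) .svar)))
end

/-- The substitution `[ι⁻¹(Γ)]`, replacing each variable `xᵢ : Cᵢ` of `Γ` by
`ι_{Cᵢ}⁻¹(xᵢ)`. -/
def iotaSubst (R : CType) (Γ : List VType) (t : Tm) : Tm :=
  Tm.psubst (fun n =>
    match Γ[n]? with
    | some C => .vapp (iotaVinv R C) (.var n)
    | none => .var n) t

/-! ## The simply-typed λ-calculus -/

/-- Simple types. -/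
inductive STy : Type
  | base : ℕ → STy
  | unit : STy
  | prod : STy → STy → STy
  | arr : STy → STy → STy

/-- Raw simply-typed λ-terms (de Bruijn indices). -/
inductive LTm : Type
  | var : ℕ → LTm
  | unit : LTm
  | pair : LTm → LTm → LTm
  | fst : LTm → LTm
  | snd : LTm → LTm
  | lam : STy → LTm → LTm
  | app : LTm → LTm → LTm

namespace LTm

/-- Renaming of variables. -/
def rename (f : ℕ → ℕ) : LTm → LTm
  | .var n => .var (f n)
  | .unit => .unit
  | .pair M N => .pair (rename f M) (rename f N)
  | .fst M => .fst (rename f M)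
  | .snd M => .snd (rename f M)
  | .lam σ M => .lam σ (rename (Tm.liftN f) M)
  | .app M N => .app (rename f M) (rename f N)

/-- Weakening. -/
def shift (M : LTm) : LTm := rename Nat.succ M

/-- Parallel capture-avoiding substitution. -/
def psubst (σ : ℕ → LTm) : LTm → LTm
  | .var n => σ n
  | .unit => .unit
  | .pair M N => .pair (psubst σ M) (psubst σ N)
  | .fst M => .fst (psubst σ M)
  | .snd M => .snd (psubst σ M)
  | .lam τ M => .lam τ (psubst (fun n => match n with | 0 => .var 0 | m + 1 => shift (σ m)) M)
  | .app M N => .app (psubst σ M) (psubst σ N)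

/-- Capture-avoiding substitution `M[N/x]` for the innermost variable. -/
def subst0 (N : LTm) (M : LTm) : LTm :=
  psubst (fun n => match n with | 0 => N | m + 1 => .var m) M

end LTm

/-- Typing derivations of the simply-typed λ-calculus (Figure 3). -/
inductive LDeriv : List STy → LTm → STy → Type
  | var (Θ : List STy) (n : ℕ) (σ : STy) : Θ[n]? = some σ → LDeriv Θ (.var n) σ
  | unit (Θ : List STy) : LDeriv Θ .unit .unit
  | pair (Θ : List STy) (M N : LTm) (σ τ : STy) :
      LDeriv Θ M σ → LDeriv Θ N τ → LDeriv Θ (.pair M N) (.prod σ τ)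
  | fst (Θ : List STy) (M : LTm) (σ τ : STy) :
      LDeriv Θ M (.prod σ τ) → LDeriv Θ (.fst M) σ
  | snd (Θ : List STy) (M : LTm) (σ τ : STy) :
      LDeriv Θ M (.prod σ τ) → LDeriv Θ (.snd M) τ
  | lam (Θ : List STy) (M : LTm) (σ τ : STy) :
      LDeriv (σ :: Θ) M τ → LDeriv Θ (.lam σ M) (.arr σ τ)
  | app (Θ : List STy) (M N : LTm) (σ τ : STy) :
      LDeriv Θ M (.arr σ τ) → LDeriv Θ N σ → LDeriv Θ (.app M N) τ

/-- Values of the (call-by-value) λ-calculus. -/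
inductive LVal : LTm → Prop
  | var (n : ℕ) : LVal (.var n)
  | unit : LVal .unit
  | lam (σ : STy) (M : LTm) : LVal (.lam σ M)
  | pair {M N : LTm} : LVal M → LVal N → LVal (.pair M N)

/-- βη-equality of the simply-typed λ-calculus. -/
inductive LBetaEta : List STy → LTm → LTm → STy → Prop
  | refl {Θ M σ} : LDeriv Θ M σ → LBetaEta Θ M M σ
  | symm {Θ M N σ} : LBetaEta Θ M N σ → LBetaEta Θ N M σ
  | trans {Θ M N P σ} : LBetaEta Θ M N σ → LBetaEta Θ N P σ → LBetaEta Θ M P σ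
  | pair_cong {Θ M M' N N' σ τ} : LBetaEta Θ M M' σ → LBetaEta Θ N N' τ →
      LBetaEta Θ (.pair M N) (.pair M' N') (.prod σ τ)
  | fst_cong {Θ M M' σ τ} : LBetaEta Θ M M' (.prod σ τ) → LBetaEta Θ (.fst M) (.fst M') σ
  | snd_cong {Θ M M' σ τ} : LBetaEta Θ M M' (.prod σ τ) → LBetaEta Θ (.snd M) (.snd M') τ
  | lam_cong {Θ M M' σ τ} : LBetaEta (σ :: Θ) M M' τ →
      LBetaEta Θ (.lam σ M) (.lam σ M') (.arr σ τ)
  | app_cong {Θ M M' N N' σ τ} : LBetaEta Θ M M' (.arr σ τ) → LBetaEta Θ N N' σ →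
      LBetaEta Θ (.app M N) (.app M' N') τ
  | beta {Θ M N σ τ} : LDeriv (σ :: Θ) M τ → LDeriv Θ N σ →
      LBetaEta Θ (.app (.lam σ M) N) (LTm.subst0 N M) τ
  | eta {Θ M σ τ} : LDeriv Θ M (.arr σ τ) →
      LBetaEta Θ (.lam σ (.app (LTm.shift M) (.var 0))) M (.arr σ τ)
  | fst_beta {Θ M N σ τ} : LDeriv Θ M σ → LDeriv Θ N τ →
      LBetaEta Θ (.fst (.pair M N)) M σ
  | snd_beta {Θ M N σ τ} : LDeriv Θ M σ → LDeriv Θ N τ →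
      LBetaEta Θ (.snd (.pair M N)) N τ
  | pair_eta {Θ M σ τ} : LDeriv Θ M (.prod σ τ) →
      LBetaEta Θ (.pair (.fst M) (.snd M)) M (.prod σ τ)
  | unit_eta {Θ M} : LDeriv Θ M .unit → LBetaEta Θ M .unit .unit

/-- Equality in Moggi's computational λ-calculus `λc` (call-by-value
βη-equalities restricted to values, together with the `let`-laws, expressed
via the standard encoding `let x = M in N := (λx.N) M`). -/
inductive LamC : List STy → LTm → LTm → STy → Prop
  | refl {Θ M σ} : LDeriv Θ M σ → LamC Θ M M σ
  | symm {Θ M N σ} : LamC Θ M N σ → LamC Θ N M σ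
  | trans {Θ M N P σ} : LamC Θ M N σ → LamC Θ N P σ → LamC Θ M P σ
  | pair_cong {Θ M M' N N' σ τ} : LamC Θ M M' σ → LamC Θ N N' τ →
      LamC Θ (.pair M N) (.pair M' N') (.prod σ τ)
  | fst_cong {Θ M M' σ τ} : LamC Θ M M' (.prod σ τ) → LamC Θ (.fst M) (.fst M') σ
  | snd_cong {Θ M M' σ τ} : LamC Θ M M' (.prod σ τ) → LamC Θ (.snd M) (.snd M') τ
  | lam_cong {Θ M M' σ τ} : LamC (σ :: Θ) M M' τ →
      LamC Θ (.lam σ M) (.lam σ M') (.arr σ τ)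
  | app_cong {Θ M M' N N' σ τ} : LamC Θ M M' (.arr σ τ) → LamC Θ N N' σ →
      LamC Θ (.app M N) (.app M' N') τ
  | beta_v {Θ M V σ τ} : LDeriv (σ :: Θ) M τ → LDeriv Θ V σ → LVal V →
      LamC Θ (.app (.lam σ M) V) (LTm.subst0 V M) τ
  | eta_v {Θ V σ τ} : LVal V → LDeriv Θ V (.arr σ τ) →
      LamC Θ (.lam σ (.app (LTm.shift V) (.var 0))) V (.arr σ τ)
  | fst_beta_v {Θ V W σ τ} : LVal V → LVal W → LDeriv Θ V σ → LDeriv Θ W τ →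
      LamC Θ (.fst (.pair V W)) V σ
  | snd_beta_v {Θ V W σ τ} : LVal V → LVal W → LDeriv Θ V σ → LDeriv Θ W τ →
      LamC Θ (.snd (.pair V W)) W τ
  | pair_eta_v {Θ V σ τ} : LVal V → LDeriv Θ V (.prod σ τ) →
      LamC Θ (.pair (.fst V) (.snd V)) V (.prod σ τ)
  | unit_eta_v {Θ V} : LVal V → LDeriv Θ V .unit → LamC Θ V .unit .unit
  | let_eta {Θ M σ} : LDeriv Θ M σ → LamC Θ (.app (.lam σ (.var 0)) M) M σ
  | let_assoc {Θ M N L σ ρ τ} : LDeriv (σ :: Θ) M τ → LDeriv (ρ :: Θ) N σ →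
      LDeriv Θ L ρ →
      LamC Θ (.app (.lam σ M) (.app (.lam ρ N) L))
        (.app (.lam ρ (.app (.lam σ (LTm.rename (Tm.liftN Nat.succ) M)) N)) L) τ
  | app_left {Θ M N σ τ} : LDeriv Θ M (.arr σ τ) → LDeriv Θ N σ →
      LamC Θ (.app M N) (.app (.lam (.arr σ τ) (.app (.var 0) (LTm.shift N))) M) τ
  | app_right {Θ V N σ τ} : LVal V → LDeriv Θ V (.arr σ τ) → LDeriv Θ N σ →
      LamC Θ (.app V N) (.app (.lam σ (.app (LTm.shift V) (.var 0))) N) τ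
  | pair_left {Θ M N σ τ} : LDeriv Θ M σ → LDeriv Θ N τ →
      LamC Θ (.pair M N) (.app (.lam σ (.pair (.var 0) (LTm.shift N))) M) (.prod σ τ)
  | pair_right {Θ V N σ τ} : LVal V → LDeriv Θ V σ → LDeriv Θ N τ →
      LamC Θ (.pair V N) (.app (.lam τ (.pair (LTm.shift V) (.var 0))) N) (.prod σ τ)
  | fst_cc {Θ M σ τ} : LDeriv Θ M (.prod σ τ) →
      LamC Θ (.fst M) (.app (.lam (.prod σ τ) (.fst (.var 0))) M) σ
  | snd_cc {Θ M σ τ} : LDeriv Θ M (.prod σ τ) →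
      LamC Θ (.snd M) (.app (.lam (.prod σ τ) (.snd (.var 0))) M) τ

end EEC

namespace EEC

/-! ## The standard cbv and cbn translations of typed λ-calculus into EEC -/

/-- The computation-type constant `α̲` associated with a simply-typed
λ-calculus type constant `α` (the association is injective but not
surjective, so that some computation-type constants of EEC are different
from `α̲` for every λ-calculus type constant `α`). -/
def assocC (a : ℕ) : CType := .base (a + 1)

/-- The call-by-value translation `σᵛ` on types. -/
def cbvT : STy → VType
  | .base a => .base a
  | .unit => .unit
  | .prod σ τ => .prod (cbvT σ) (cbvT τ)
  | .arr σ τ => .arr (cbvT σ) (.comp (.bang (cbvT τ)))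

/-- The call-by-value translation `Θᵛ` on contexts. -/
def cbvCtx (Θ : List STy) : List VType := Θ.map cbvT

/-- The call-by-value translation on terms: `Θ ⊢ M : τ` is sent to
`Θᵛ ⊢ Mᵛ : !(τᵛ)`. -/
def cbvTm : LTm → Tm
  | .var n => .bang (.var n)
  | .unit => .bang .unit
  | .pair M N => .banglet (cbvTm M) (.banglet (Tm.shift (cbvTm N)) (.bang (.vpair (.var 1) (.var 0))))
  | .fst M => .banglet (cbvTm M) (.bang (.vfst (.var 0)))
  | .snd M => .banglet (cbvTm M) (.bang (.vsnd (.var 0)))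
  | .lam σ M => .bang (.vlam (cbvT σ) (cbvTm M))
  | .app M N => .banglet (cbvTm M) (.banglet (Tm.shift (cbvTm N)) (.vapp (.var 1) (.var 0)))

/-- The call-by-name translation `σⁿ` on types. -/
def cbnT : STy → CType
  | .base a => assocC a
  | .unit => .cunit
  | .prod σ τ => .cand (cbnT σ) (cbnT τ)
  | .arr σ τ => .carr (.comp (cbnT σ)) (cbnT τ)

/-- The call-by-name translation `Θⁿ` on contexts. -/
def cbnCtx (Θ : List STy) : List VType := Θ.map (fun σ => .comp (cbnT σ))

/-- The call-by-name translation on terms: `Θ ⊢ M : τ` is sent to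
`Θⁿ ⊢ Mⁿ : τⁿ`, mimicking each construct by the corresponding
computation-type construct of EEC. -/
def cbnTm : LTm → Tm
  | .var n => .var n
  | .unit => .cunit
  | .pair M N => .cpair (cbnTm M) (cbnTm N)
  | .fst M => .cfst (cbnTm M)
  | .snd M => .csnd (cbnTm M)
  | .lam σ M => .clam (.comp (cbnT σ)) (cbnTm M)
  | .app M N => .capp (cbnTm M) (cbnTm N)

/-! ## Hasegawa's linear-use CPS translations (Section 4) -/

/-- The call-by-value linear-use CPS translation `σᵛᶜ` on types. -/
def cbvcpsT (R : CType) : STy → VType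
  | .base a => .base a
  | .unit => .unit
  | .prod σ τ => .prod (cbvcpsT R σ) (cbvcpsT R τ)
  | .arr σ τ => .arr (cbvcpsT R σ) (.lin (.carr (cbvcpsT R τ) R) R)

/-- `Θᵛᶜ`. -/
def cbvcpsCtx (R : CType) (Θ : List STy) : List VType := Θ.map (cbvcpsT R)

/-- The call-by-value linear-use CPS translation on terms: `Θ ⊢ M : τ` is
sent to `Θᵛᶜ ⊢ Mᵛᶜ : (τᵛᶜ ⇒ R̲) ⊸ R̲`. -/
def cbvcps (R : CType) : {Θ : List STy} → {M : LTm} → {σ : STy} → LDeriv Θ M σ → Tm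
  | _, _, _, .var _ n σ _ => .llam (.carr (cbvcpsT R σ) R) (.capp .svar (.var n))
  | _, _, _, .unit _ => .llam (.carr .unit R) (.capp .svar .unit)
  | _, _, _, .pair _ _ _ σ τ dM dN =>
      .llam (.carr (.prod (cbvcpsT R σ) (cbvcpsT R τ)) R)
        (.lapp (cbvcps R dM)
          (.clam (cbvcpsT R σ)
            (.lapp (Tm.shift (cbvcps R dN))
              (.clam (cbvcpsT R τ) (.capp .svar (.vpair (.var 1) (.var 0)))))))
  | _, _, _, .fst _ _ σ τ dM =>
      .llam (.carr (cbvcpsT R σ) R)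
        (.lapp (cbvcps R dM)
          (.clam (.prod (cbvcpsT R σ) (cbvcpsT R τ)) (.capp .svar (.vfst (.var 0)))))
  | _, _, _, .snd _ _ σ τ dM =>
      .llam (.carr (cbvcpsT R τ) R)
        (.lapp (cbvcps R dM)
          (.clam (.prod (cbvcpsT R σ) (cbvcpsT R τ)) (.capp .svar (.vsnd (.var 0)))))
  | _, _, _, .lam _ _ σ τ dM =>
      .llam (.carr (.arr (cbvcpsT R σ) (.lin (.carr (cbvcpsT R τ) R) R)) R)
        (.capp .svar (.vlam (cbvcpsT R σ) (cbvcps R dM)))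
  | _, _, _, .app _ _ _ σ τ dM dN =>
      .llam (.carr (cbvcpsT R τ) R)
        (.lapp (cbvcps R dM)
          (.clam (.arr (cbvcpsT R σ) (.lin (.carr (cbvcpsT R τ) R) R))
            (.lapp (Tm.shift (cbvcps R dN))
              (.clam (cbvcpsT R σ) (.lapp (.vapp (.var 1) (.var 0)) .svar)))))

/-- The call-by-name linear-use CPS translation `σⁿᶜ` on types. -/
def cbncpsT (R : CType) : STy → CType
  | .base a => assocC a
  | .unit => .czero
  | .prod σ τ => .csum (cbncpsT R σ) (cbncpsT R τ)
  | .arr σ τ => .copow (.lin (cbncpsT R σ) R) (cbncpsT R τ)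

/-- `Θⁿᶜ ⊸ R̲`, assigning each variable `xᵢ : σᵢ` the type `σᵢⁿᶜ ⊸ R̲`. -/
def cbncpsCtx (R : CType) (Θ : List STy) : List VType :=
  Θ.map (fun σ => .lin (cbncpsT R σ) R)

/-- The call-by-name linear-use CPS translation on terms: `Θ ⊢ M : τ` is
sent to `Θⁿᶜ ⊸ R̲ ⊢ Mⁿᶜ : τⁿᶜ ⊸ R̲`. -/
def cbncps (R : CType) : {Θ : List STy} → {M : LTm} → {σ : STy} → LDeriv Θ M σ → Tm
  | _, _, _, .var _ n _ _ => .var n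
  | _, _, _, .unit _ => .llam .czero (.cimage R .svar)
  | _, _, _, .pair _ _ _ σ τ dM dN =>
      .llam (.csum (cbncpsT R σ) (cbncpsT R τ))
        (.ccase .svar (.lapp (cbncps R dM) .svar) (.lapp (cbncps R dN) .svar))
  | _, _, _, .fst _ _ σ _τ dM => .llam (cbncpsT R σ) (.lapp (cbncps R dM) (.cinl .svar))
  | _, _, _, .snd _ _ _ τ dM => .llam (cbncpsT R τ) (.lapp (cbncps R dM) (.cinr .svar))
  | _, _, _, .lam _ _ σ τ dM =>
      .llam (.copow (.lin (cbncpsT R σ) R) (cbncpsT R τ))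
        (.copowlet .svar (.lapp (cbncps R dM) .svar))
  | _, _, _, .app _ _ _ σ τ dM dN =>
      .llam (cbncpsT R τ) (.lapp (cbncps R dM) (.copow (cbncps R dN) .svar))

end EEC

namespace EEC

namespace Tm

lemma liftN_comp (g f : ℕ → ℕ) : liftN g ∘ liftN f = liftN (g ∘ f) := by
  funext n; cases n <;> rfl

lemma liftN_id : liftN id = id := by
  funext n; cases n <;> rfl

lemma rename_id (t : Tm) : rename id t = t := by
  induction t <;> simp_all [rename, liftN_id]

lemma rename_rename (t : Tm) (f g : ℕ → ℕ) : rename g (rename f t) = rename (g ∘ f) t := by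
  induction t generalizing f g <;> simp_all [rename, liftN_comp]

lemma liftS_comp_liftN (σ : ℕ → Tm) (f : ℕ → ℕ) : liftS σ ∘ liftN f = liftS (σ ∘ f) := by
  funext n; cases n <;> rfl

lemma psubst_rename (t : Tm) (f : ℕ → ℕ) (σ : ℕ → Tm) :
    psubst σ (rename f t) = psubst (σ ∘ f) t := by
  induction t generalizing f σ <;> simp_all [rename, psubst, liftS_comp_liftN]

lemma rename_shift (f : ℕ → ℕ) (t : Tm) : rename (liftN f) (shift t) = shift (rename f t) := by
  simp only [shift, rename_rename]; rfl

lemma rename_comp_liftS (f : ℕ → ℕ) (σ : ℕ → Tm) :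
    rename (liftN f) ∘ liftS σ = liftS (rename f ∘ σ) := by
  funext n; cases n
  · rfl
  · simp [liftS, rename_shift]

lemma rename_psubst (t : Tm) (f : ℕ → ℕ) (σ : ℕ → Tm) :
    rename f (psubst σ t) = psubst (rename f ∘ σ) t := by
  induction t generalizing f σ <;> simp_all [rename, psubst, rename_comp_liftS]

lemma psubst_shift (σ : ℕ → Tm) (t : Tm) : psubst (liftS σ) (shift t) = shift (psubst σ t) := by
  simp only [shift, psubst_rename, rename_psubst]; rfl

lemma psubst_comp_liftS (τ σ : ℕ → Tm) : psubst (liftS τ) ∘ liftS σ = liftS (psubst τ ∘ σ) := by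
  funext n; cases n
  · rfl
  · simp [liftS, psubst_shift]

lemma psubst_psubst (t : Tm) (τ σ : ℕ → Tm) :
    psubst τ (psubst σ t) = psubst (psubst τ ∘ σ) t := by
  induction t generalizing τ σ <;> simp_all [psubst, psubst_comp_liftS]

lemma liftS_var : liftS Tm.var = Tm.var := by
  funext n; cases n <;> rfl

lemma psubst_var (t : Tm) : psubst Tm.var t = t := by
  induction t <;> simp_all [psubst, liftS_var]

/-- Extend a substitution by a term for the innermost variable. -/
def scons (u : Tm) (σ : ℕ → Tm) : ℕ → Tm
  | 0 => u
  | n + 1 => σ n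

lemma subst0_eq (u t : Tm) : subst0 u t = psubst (scons u Tm.var) t := by
  unfold subst0; congr 1

lemma psubst_scons_comp_liftS (u : Tm) (σ : ℕ → Tm) :
    psubst (scons u Tm.var) ∘ liftS σ = scons u σ := by
  funext n; cases n
  · rfl
  · simp only [Function.comp, liftS, shift, psubst_rename, scons]
    exact psubst_var _

lemma subst0_psubst_liftS (u t : Tm) (σ : ℕ → Tm) :
    subst0 u (psubst (liftS σ) t) = psubst (scons u σ) t := by
  rw [subst0_eq, psubst_psubst, psubst_scons_comp_liftS]

lemma subst0_shift (u t : Tm) : subst0 u (shift t) = t := by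
  rw [subst0_eq, shift, psubst_rename]; exact psubst_var t

/-- The stoup variable does not occur free. -/
def SFree : Tm → Prop
  | .var _ => True
  | .svar => False
  | .unit => True
  | .vpair t u => SFree t ∧ SFree u
  | .vfst t => SFree t
  | .vsnd t => SFree t
  | .vlam _ t => SFree t
  | .vapp s t => SFree s ∧ SFree t
  | .cunit => True
  | .cpair t u => SFree t ∧ SFree u
  | .cfst t => SFree t
  | .csnd t => SFree t
  | .clam _ t => SFree t
  | .capp s t => SFree s ∧ SFree t
  | .top => True
  | .ilet t u => SFree t ∧ SFree u
  | .bang t => SFree t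
  | .banglet t u => SFree t ∧ SFree u
  | .copow t u => SFree t ∧ SFree u
  | .copowlet s _ => SFree s
  | .cimage _ t => SFree t
  | .cinl t => SFree t
  | .cinr t => SFree t
  | .ccase s _ _ => SFree s
  | .llam _ _ => True
  | .lapp s t => SFree s ∧ SFree t

lemma SFree.rename {t : Tm} (h : SFree t) (f : ℕ → ℕ) : SFree (rename f t) := by
  induction t generalizing f <;> simp_all [SFree, Tm.rename]

lemma SFree.liftS {σ : ℕ → Tm} (h : ∀ n, SFree (σ n)) (n : ℕ) : SFree (liftS σ n) := by
  cases n
  · trivial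
  · exact (h _).rename _

lemma SFree.psubst {t : Tm} (h : SFree t) {σ : ℕ → Tm} (hσ : ∀ n, SFree (σ n)) :
    SFree (psubst σ t) := by
  induction t generalizing σ <;> simp_all [SFree, Tm.psubst, SFree.liftS]

lemma SFree.ssubst {t : Tm} (h : SFree t) (s : Tm) : ssubst s t = t := by
  induction t generalizing s <;> simp_all [SFree, Tm.ssubst]

lemma SFree.scons {u : Tm} {σ : ℕ → Tm} (hu : SFree u) (h : ∀ n, SFree (σ n)) (n : ℕ) :
    SFree (scons u σ n) := by
  cases n
  · exact hu
  · exact h _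

lemma ssubst_svar (t : Tm) : ssubst .svar t = t := by
  induction t <;> simp_all [ssubst, shift, Tm.rename]

lemma rename_ssubst (f : ℕ → ℕ) (s t : Tm) :
    rename f (ssubst s t) = ssubst (rename f s) (rename f t) := by
  induction t generalizing f s <;> simp_all [ssubst, Tm.rename, rename_shift]

lemma psubst_ssubst {σ : ℕ → Tm} (hσ : ∀ n, SFree (σ n)) (s t : Tm) :
    psubst σ (ssubst s t) = ssubst (psubst σ s) (psubst σ t) := by
  induction t generalizing σ s <;>
    simp_all [ssubst, Tm.psubst, SFree.ssubst, SFree.liftS, psubst_shift]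

lemma shift_ssubst (s t : Tm) : shift (ssubst s t) = ssubst (shift s) (shift t) :=
  rename_ssubst _ _ _

lemma ssubst_ssubst (s s' t : Tm) : ssubst s (ssubst s' t) = ssubst (ssubst s s') t := by
  induction t generalizing s s' <;> simp_all [ssubst, shift_ssubst]

lemma subst0_ssubst {u : Tm} (hu : SFree u) (s t : Tm) :
    subst0 u (ssubst (shift s) t) = ssubst s (subst0 u t) := by
  rw [subst0_eq, psubst_ssubst (SFree.scons (σ := Tm.var) hu fun _ => trivial), ← subst0_eq,
    subst0_shift, ← subst0_eq]

end Tm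
end EEC

namespace EEC

/-- Elimination frames: eliminators with a hole in principal position. -/
inductive Frame : Type
  | vfst : Frame
  | vsnd : Frame
  | vapp : Tm → Frame
  | lapp : Tm → Frame
  | cfst : Frame
  | csnd : Frame
  | capp : Tm → Frame
  | ilet : Tm → Frame
  | banglet : Tm → Frame
  | copowlet : Tm → Frame
  | cimage : CType → Frame
  | ccase : Tm → Tm → Frame

namespace Frame

/-- Fill the hole of a frame. -/
def plug (t : Tm) : Frame → Tm
  | .vfst => .vfst t
  | .vsnd => .vsnd t
  | .vapp a => .vapp t a
  | .lapp a => .lapp t a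
  | .cfst => .cfst t
  | .csnd => .csnd t
  | .capp a => .capp t a
  | .ilet u => .ilet t u
  | .banglet u => .banglet t u
  | .copowlet u => .copowlet t u
  | .cimage A => .cimage A t
  | .ccase u u' => .ccase t u u'

/-- Renaming of value variables in a frame. -/
def rename (f : ℕ → ℕ) : Frame → Frame
  | .vfst => .vfst
  | .vsnd => .vsnd
  | .vapp a => .vapp (a.rename f)
  | .lapp a => .lapp (a.rename f)
  | .cfst => .cfst
  | .csnd => .csnd
  | .capp a => .capp (a.rename f)
  | .ilet u => .ilet (u.rename f)
  | .banglet u => .banglet (u.rename (Tm.liftN f))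
  | .copowlet u => .copowlet (u.rename (Tm.liftN f))
  | .cimage A => .cimage A
  | .ccase u u' => .ccase (u.rename f) (u'.rename f)

end Frame

/-- Stacks of elimination frames, innermost frame first. -/
abbrev Stack := List Frame

namespace Stack

/-- Fill the hole of a stack. -/
def plug (t : Tm) : Stack → Tm
  | [] => t
  | f :: E => plug (f.plug t) E

/-- Renaming of value variables in a stack. -/
def rename (f : ℕ → ℕ) (E : Stack) : Stack := E.map (Frame.rename f)

end Stack

/-- The β-contractions of EEC. -/
inductive Beta : Tm → Tm → Prop
  | vfst {t u} : Beta (.vfst (.vpair t u)) t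
  | vsnd {t u} : Beta (.vsnd (.vpair t u)) u
  | vapp {A t u} : Beta (.vapp (.vlam A t) u) (Tm.subst0 u t)
  | cfst {t u} : Beta (.cfst (.cpair t u)) t
  | csnd {t u} : Beta (.csnd (.cpair t u)) u
  | capp {A t u} : Beta (.capp (.clam A t) u) (Tm.subst0 u t)
  | ilet {u} : Beta (.ilet .top u) u
  | banglet {t u} : Beta (.banglet (.bang t) u) (Tm.subst0 t u)
  | copowlet {t s u} : Beta (.copowlet (.copow t s) u) (Tm.ssubst s (Tm.subst0 t u))
  | ccase_inl {t u u'} : Beta (.ccase (.cinl t) u u') (Tm.ssubst t u)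
  | ccase_inr {t u u'} : Beta (.ccase (.cinr t) u u') (Tm.ssubst t u')
  | lapp {A t u} : Beta (.lapp (.llam A t) u) (Tm.ssubst u t)

mutual
  /-- Neutral terms. -/
  inductive Ne : List VType → Option CType → Tm → VType → Prop
    | var {Γ n A} : Γ[n]? = some A → Ne Γ none (.var n) A
    | svar {Γ A} : Ne Γ (some A) .svar (.comp A)
    | vfst {Γ n A B} : Ne Γ none n (.prod A B) → Ne Γ none (.vfst n) A
    | vsnd {Γ n A B} : Ne Γ none n (.prod A B) → Ne Γ none (.vsnd n) B
    | vapp {Γ n t A B} : Ne Γ none n (.arr A B) → Nf Γ none t A → Ne Γ none (.vapp n t) B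
    | lapp {Γ Δ n t A B} : Ne Γ none n (.lin A B) → Nf Γ Δ t (.comp A) →
        Ne Γ Δ (.lapp n t) (.comp B)
    | cfst {Γ Δ n A B} : Ne Γ Δ n (.comp (.cand A B)) → Ne Γ Δ (.cfst n) (.comp A)
    | csnd {Γ Δ n A B} : Ne Γ Δ n (.comp (.cand A B)) → Ne Γ Δ (.csnd n) (.comp B)
    | capp {Γ Δ n t A B} : Ne Γ Δ n (.comp (.carr A B)) → Nf Γ none t A →
        Ne Γ Δ (.capp n t) (.comp B)
  /-- Normalizable terms: those with a normal form up to β-contraction, η-expansion and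
  commuting conversions. -/
  inductive Nf : List VType → Option CType → Tm → VType → Prop
    | ne {Γ Δ n A} : Ne Γ Δ n A → Nf Γ Δ n A
    | beta {Γ Δ r r' A} (E : Stack) : Beta r r' → Nf Γ Δ (E.plug r') A → Nf Γ Δ (E.plug r) A
    | unit {Γ t} : Nf Γ none t .unit
    | prod {Γ t A B} : Nf Γ none (.vfst t) A → Nf Γ none (.vsnd t) B → Nf Γ none t (.prod A B)
    | arr {Γ t A B} : Nf (A :: Γ) none (.vapp t.shift (.var 0)) B → Nf Γ none t (.arr A B)
    | lin {Γ t A B} : Nf Γ (some A) (.lapp t .svar) (.comp B) → Nf Γ none t (.lin A B)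
    | cunit {Γ Δ t} : Nf Γ Δ t (.comp .cunit)
    | cand {Γ Δ t A B} : Nf Γ Δ (.cfst t) (.comp A) → Nf Γ Δ (.csnd t) (.comp B) →
        Nf Γ Δ t (.comp (.cand A B))
    | carr {Γ Δ t A B} : Nf (A :: Γ) Δ (.capp t.shift (.var 0)) (.comp B) →
        Nf Γ Δ t (.comp (.carr A B))
    | top {Γ} : Nf Γ none .top (.comp .iunit)
    | bang {Γ t A} : Nf Γ none t A → Nf Γ none (.bang t) (.comp (.bang A))
    | copow {Γ Δ t u A B} : Nf Γ none t A → Nf Γ Δ u (.comp B) →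
        Nf Γ Δ (.copow t u) (.comp (.copow A B))
    | cinl {Γ Δ t A B} : Nf Γ Δ t (.comp A) → Nf Γ Δ (.cinl t) (.comp (.csum A B))
    | cinr {Γ Δ t A B} : Nf Γ Δ t (.comp B) → Nf Γ Δ (.cinr t) (.comp (.csum A B))
    | ilet {Γ Δ n u C} (E : Stack) : Ne Γ Δ n (.comp .iunit) → Nf Γ none (E.plug u) C →
        Nf Γ Δ (E.plug (.ilet n u)) C
    | banglet {Γ Δ n u A C} (E : Stack) : Ne Γ Δ n (.comp (.bang A)) →
        Nf (A :: Γ) none ((E.rename Nat.succ).plug u) C → Nf Γ Δ (E.plug (.banglet n u)) C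
    | copowlet {Γ Δ n u A B C} (E : Stack) : Ne Γ Δ n (.comp (.copow A B)) →
        Nf (A :: Γ) (some B) ((E.rename Nat.succ).plug u) C → Nf Γ Δ (E.plug (.copowlet n u)) C
    | cimage {Γ Δ n A C} (E : Stack) : Ne Γ Δ n (.comp .czero) → Nf Γ Δ (E.plug (.cimage A n)) C
    | ccase {Γ Δ n t u A B C} (E : Stack) : Ne Γ Δ n (.comp (.csum A B)) →
        Nf Γ (some A) (E.plug t) C → Nf Γ (some B) (E.plug u) C →
        Nf Γ Δ (E.plug (.ccase n t u)) C
end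

/-- `f` is a renaming from `Γ` to `Γ'`. -/
def Ren (f : ℕ → ℕ) (Γ Γ' : List VType) : Prop :=
  ∀ n A, Γ[n]? = some A → Γ'[f n]? = some A

lemma Ren.id (Γ : List VType) : Ren id Γ Γ := fun _ _ h => h

lemma Ren.comp {f g Γ Γ' Γ''} (hg : Ren g Γ' Γ'') (hf : Ren f Γ Γ') : Ren (g ∘ f) Γ Γ'' :=
  fun n A h => hg _ A (hf n A h)

lemma Ren.succ (A : VType) (Γ : List VType) : Ren Nat.succ Γ (A :: Γ) := fun _ _ h => h

lemma Ren.lift {f Γ Γ'} (A : VType) (hf : Ren f Γ Γ') : Ren (Tm.liftN f) (A :: Γ) (A :: Γ') := by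
  intro n B h
  cases n
  · exact h
  · exact hf _ B h

/-- Predicates on stacks, relative to a context, the stoup of the hole, the stoup of the filled
stack and its type. -/
abbrev StackPred := List VType → Option CType → Option CType → Stack → VType → Prop

/-- The terms that are normalizable in every stack satisfying `S`, in every extended context. -/
def Orth (S : StackPred) (Γ : List VType) (Δ : Option CType) (t : Tm) : Prop :=
  ∀ f Γ', Ren f Γ Γ' → ∀ Δ' E C, S Γ' Δ Δ' E C → Nf Γ' Δ' (E.plug (t.rename f)) C

/-- Lift a predicate on stacks that leave the stoup unchanged. -/
def liftPred (S : List VType → Stack → VType → Prop) : StackPred :=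
  fun Γ Δ Δ' E C => Δ' = Δ ∧ S Γ E C

mutual
  /-- The stacks eliminating a value type. -/
  def StkV : VType → StackPred
    | .base a => fun _ Δ Δ' E C => Δ = none ∧ Δ' = none ∧ E = [] ∧ C = .base a
    | .unit => fun _ _ _ _ _ => False
    | .prod A B => fun Γ Δ Δ' E C => Δ = none ∧ ∃ E',
        (E = .vfst :: E' ∧ StkV A Γ none Δ' E' C) ∨ (E = .vsnd :: E' ∧ StkV B Γ none Δ' E' C)
    | .arr A B => fun Γ Δ Δ' E C => Δ = none ∧ ∃ a E', E = .vapp a :: E' ∧ a.SFree ∧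
        Orth (StkV A) Γ none a ∧ StkV B Γ none Δ' E' C
    | .comp A => liftPred (StkC A)
    | .lin A B => fun Γ Δ Δ' E C => Δ = none ∧ ∃ a E', E = .lapp a :: E' ∧
        Orth (liftPred (StkC A)) Γ Δ' a ∧ StkC B Γ E' C
  /-- The stacks eliminating a computation type. -/
  def StkC : CType → List VType → Stack → VType → Prop
    | .base a => fun _ E C => E = [] ∧ C = .comp (.base a)
    | .cunit => fun _ _ _ => False
    | .cand A B => fun Γ E C => ∃ E',
        (E = .cfst :: E' ∧ StkC A Γ E' C) ∨ (E = .csnd :: E' ∧ StkC B Γ E' C)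
    | .carr A B => fun Γ E C => ∃ a E', E = .capp a :: E' ∧ a.SFree ∧
        Orth (StkV A) Γ none a ∧ StkC B Γ E' C
    | .iunit => fun Γ E C => (E = [] ∧ C = .comp .iunit) ∨ ∃ u E', E = .ilet u :: E' ∧
        ∀ f Γ', Ren f Γ Γ' → Nf Γ' none ((Stack.rename f E').plug (u.rename f)) C
    | .bang A => fun Γ E C => (E = [] ∧ C = .comp (.bang A)) ∨ ∃ u E', E = .banglet u :: E' ∧
        ∀ f Γ', Ren f Γ Γ' → ∀ a, a.SFree → Orth (StkV A) Γ' none a →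
          Nf Γ' none ((Stack.rename f E').plug (Tm.subst0 a (u.rename (Tm.liftN f)))) C
    | .copow A B => fun Γ E C => (E = [] ∧ C = .comp (.copow A B)) ∨
        ∃ u E', E = .copowlet u :: E' ∧ ∀ f Γ', Ren f Γ Γ' → ∀ Δ a b, a.SFree →
          Orth (StkV A) Γ' none a → Orth (liftPred (StkC B)) Γ' Δ b →
          Nf Γ' Δ ((Stack.rename f E').plug (Tm.ssubst b (Tm.subst0 a (u.rename (Tm.liftN f))))) C
    | .czero => fun _ E C => (E = [] ∧ C = .comp .czero) ∨ ∃ A E', E = .cimage A :: E'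
    | .csum A B => fun Γ E C => (E = [] ∧ C = .comp (.csum A B)) ∨
        ∃ t u E', E = .ccase t u :: E' ∧ ∀ f Γ', Ren f Γ Γ' → ∀ Δ a,
          (Orth (liftPred (StkC A)) Γ' Δ a →
            Nf Γ' Δ ((Stack.rename f E').plug (Tm.ssubst a (t.rename f))) C) ∧
          (Orth (liftPred (StkC B)) Γ' Δ a →
            Nf Γ' Δ ((Stack.rename f E').plug (Tm.ssubst a (u.rename f))) C)
end

/-- Reducible terms of a value type. -/
def Red (A : VType) : List VType → Option CType → Tm → Prop := Orth (StkV A)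

end EEC

namespace EEC

lemma Frame.rename_id (F : Frame) : F.rename id = F := by
  cases F <;> simp [Frame.rename, Tm.rename_id, Tm.liftN_id]

lemma Frame.rename_rename (F : Frame) (f g : ℕ → ℕ) :
    (F.rename f).rename g = F.rename (g ∘ f) := by
  cases F <;> simp [Frame.rename, Tm.rename_rename, Tm.liftN_comp]

lemma Stack.rename_id (E : Stack) : E.rename id = E := by
  simp [Stack.rename, funext Frame.rename_id]

lemma Stack.rename_rename (E : Stack) (f g : ℕ → ℕ) :
    (E.rename f).rename g = E.rename (g ∘ f) := by
  simp [Stack.rename, Function.comp_def, Frame.rename_rename]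

lemma Tm.subst0_var_zero_rename (u : Tm) :
    Tm.subst0 (.var 0) (u.rename (Tm.liftN Nat.succ)) = u := by
  rw [Tm.subst0_eq, Tm.psubst_rename]
  conv_rhs => rw [← Tm.psubst_var u]
  congr 1; funext n; cases n <;> rfl

lemma Orth.ren {S Γ Γ' Δ t f} (h : Orth S Γ Δ t) (hf : Ren f Γ Γ') :
    Orth S Γ' Δ (t.rename f) := by
  intro g Γ'' hg Δ' E C hE
  rw [Tm.rename_rename]
  exact h _ _ (hg.comp hf) _ _ _ hE

lemma Orth.plug {S Γ Δ Δ' t E C} (h : Orth S Γ Δ t) (hE : S Γ Δ Δ' E C) :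
    Nf Γ Δ' (E.plug t) C := by
  have := h id Γ (Ren.id Γ) Δ' E C hE
  rwa [Tm.rename_id] at this

lemma Orth.plugC {S : List VType → Stack → VType → Prop} {Γ Δ t E C}
    (h : Orth (liftPred S) Γ Δ t) (hE : S Γ E C) : Nf Γ Δ (E.plug t) C :=
  h.plug ⟨rfl, hE⟩

mutual
  lemma StkV.ren (A : VType) {Γ Γ' Δ Δ' E C f} (hf : Ren f Γ Γ')
      (h : StkV A Γ Δ Δ' E C) : StkV A Γ' Δ Δ' (E.rename f) C := by
    cases A with
    | base a =>
      simp only [StkV] at h ⊢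
      obtain ⟨h1, h2, rfl, h3⟩ := h
      exact ⟨h1, h2, rfl, h3⟩
    | unit => simp only [StkV] at h
    | prod A B =>
      simp only [StkV] at h ⊢
      obtain ⟨h1, E', ⟨rfl, h⟩ | ⟨rfl, h⟩⟩ := h
      · exact ⟨h1, _, .inl ⟨rfl, StkV.ren A hf h⟩⟩
      · exact ⟨h1, _, .inr ⟨rfl, StkV.ren B hf h⟩⟩
    | arr A B =>
      simp only [StkV] at h ⊢
      obtain ⟨h1, a, E', rfl, ha, ha', h⟩ := h
      exact ⟨h1, _, _, rfl, ha.rename f, ha'.ren hf, StkV.ren B hf h⟩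
    | comp A =>
      simp only [StkV] at h ⊢
      exact ⟨h.1, StkC.ren A hf h.2⟩
    | lin A B =>
      simp only [StkV] at h ⊢
      obtain ⟨h1, a, E', rfl, ha', h⟩ := h
      exact ⟨h1, _, _, rfl, ha'.ren hf, StkC.ren B hf h⟩
  lemma StkC.ren (A : CType) {Γ Γ' E C f} (hf : Ren f Γ Γ')
      (h : StkC A Γ E C) : StkC A Γ' (E.rename f) C := by
    cases A with
    | base a =>
      simp only [StkC] at h ⊢
      obtain ⟨rfl, h3⟩ := h
      exact ⟨rfl, h3⟩
    | cunit => simp only [StkC] at h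
    | cand A B =>
      simp only [StkC] at h ⊢
      obtain ⟨E', ⟨rfl, h⟩ | ⟨rfl, h⟩⟩ := h
      · exact ⟨_, .inl ⟨rfl, StkC.ren A hf h⟩⟩
      · exact ⟨_, .inr ⟨rfl, StkC.ren B hf h⟩⟩
    | carr A B =>
      simp only [StkC] at h ⊢
      obtain ⟨a, E', rfl, ha, ha', h⟩ := h
      exact ⟨_, _, rfl, ha.rename f, ha'.ren hf, StkC.ren B hf h⟩
    | iunit =>
      simp only [StkC] at h ⊢
      obtain ⟨rfl, h⟩ | ⟨u, E', rfl, h⟩ := h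
      · exact .inl ⟨rfl, h⟩
      · refine .inr ⟨_, _, rfl, fun g Γ'' hg => ?_⟩
        have := h _ _ (hg.comp hf)
        rwa [← Tm.rename_rename, ← Stack.rename_rename] at this
    | bang A =>
      simp only [StkC] at h ⊢
      obtain ⟨rfl, h⟩ | ⟨u, E', rfl, h⟩ := h
      · exact .inl ⟨rfl, h⟩
      · refine .inr ⟨_, _, rfl, fun g Γ'' hg => ?_⟩
        have := h _ _ (hg.comp hf)
        rwa [← Tm.liftN_comp, ← Tm.rename_rename, ← Stack.rename_rename] at this
    | copow A B =>
      simp only [StkC] at h ⊢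
      obtain ⟨rfl, h⟩ | ⟨u, E', rfl, h⟩ := h
      · exact .inl ⟨rfl, h⟩
      · refine .inr ⟨_, _, rfl, fun g Γ'' hg => ?_⟩
        have := h _ _ (hg.comp hf)
        rwa [← Tm.liftN_comp, ← Tm.rename_rename, ← Stack.rename_rename] at this
    | czero =>
      simp only [StkC] at h ⊢
      obtain ⟨rfl, h⟩ | ⟨A, E', rfl⟩ := h
      · exact .inl ⟨rfl, h⟩
      · exact .inr ⟨_, _, rfl⟩
    | csum A B =>
      simp only [StkC] at h ⊢
      obtain ⟨rfl, h⟩ | ⟨t, u, E', rfl, h⟩ := h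
      · exact .inl ⟨rfl, h⟩
      · refine .inr ⟨_, _, _, rfl, fun g Γ'' hg => ?_⟩
        have := h _ _ (hg.comp hf)
        rwa [← Tm.rename_rename, ← Tm.rename_rename, ← Stack.rename_rename] at this
end

/-- Reducible computation terms. -/
abbrev RedC (A : CType) : List VType → Option CType → Tm → Prop := Orth (liftPred (StkC A))

lemma red_comp {A : CType} : Red (.comp A) = RedC A := by
  unfold Red RedC; rw [StkV]

section Elim
variable {Γ : List VType} {Δ : Option CType} {t : Tm}

lemma Red.vfst {A B : VType} (h : Red (.prod A B) Γ none t) : Red A Γ none (.vfst t) := by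
  intro f Γ' hf Δ' E C hE
  exact h f Γ' hf Δ' (.vfst :: E) C (by rw [StkV]; exact ⟨rfl, _, .inl ⟨rfl, hE⟩⟩)

lemma Red.vsnd {A B : VType} (h : Red (.prod A B) Γ none t) : Red B Γ none (.vsnd t) := by
  intro f Γ' hf Δ' E C hE
  exact h f Γ' hf Δ' (.vsnd :: E) C (by rw [StkV]; exact ⟨rfl, _, .inr ⟨rfl, hE⟩⟩)

lemma Red.vapp {A B : VType} {a : Tm} (h : Red (.arr A B) Γ none t) (ha : a.SFree)
    (ha' : Red A Γ none a) : Red B Γ none (.vapp t a) := by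
  intro f Γ' hf Δ' E C hE
  exact h f Γ' hf Δ' (.vapp (a.rename f) :: E) C
    (by rw [StkV]; exact ⟨rfl, _, _, rfl, ha.rename f, Orth.ren ha' hf, hE⟩)

lemma Red.lapp {A B : CType} {a : Tm} (h : Red (.lin A B) Γ none t)
    (ha' : RedC A Γ Δ a) : RedC B Γ Δ (.lapp t a) := by
  rintro f Γ' hf Δ' E C ⟨rfl, hE⟩
  exact h f Γ' hf Δ' (.lapp (a.rename f) :: E) C
    (by rw [StkV]; exact ⟨rfl, _, _, rfl, Orth.ren ha' hf, hE⟩)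

lemma RedC.cfst {A B : CType} (h : RedC (.cand A B) Γ Δ t) : RedC A Γ Δ (.cfst t) := by
  rintro f Γ' hf Δ' E C ⟨rfl, hE⟩
  exact h f Γ' hf _ (.cfst :: E) C ⟨rfl, by rw [StkC]; exact ⟨_, .inl ⟨rfl, hE⟩⟩⟩

lemma RedC.csnd {A B : CType} (h : RedC (.cand A B) Γ Δ t) : RedC B Γ Δ (.csnd t) := by
  rintro f Γ' hf Δ' E C ⟨rfl, hE⟩
  exact h f Γ' hf _ (.csnd :: E) C ⟨rfl, by rw [StkC]; exact ⟨_, .inr ⟨rfl, hE⟩⟩⟩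

lemma RedC.capp {A : VType} {B : CType} {a : Tm} (h : RedC (.carr A B) Γ Δ t) (ha : a.SFree)
    (ha' : Red A Γ none a) : RedC B Γ Δ (.capp t a) := by
  rintro f Γ' hf Δ' E C ⟨rfl, hE⟩
  exact h f Γ' hf _ (.capp (a.rename f) :: E) C
    ⟨rfl, by rw [StkC]; exact ⟨_, _, rfl, ha.rename f, Orth.ren ha' hf, hE⟩⟩

lemma RedC.ilet {C : CType} {u : Tm} (h : RedC .iunit Γ Δ t) (hu : RedC C Γ none u) :
    RedC C Γ Δ (.ilet t u) := by
  rintro f Γ' hf Δ' E D ⟨rfl, hE⟩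
  refine h f Γ' hf _ (.ilet (u.rename f) :: E) D ⟨rfl, ?_⟩
  rw [StkC]
  refine .inr ⟨_, _, rfl, fun g Γ'' hg => ?_⟩
  exact ((hu.ren hf).ren hg).plugC (hE.ren _ hg)

lemma RedC.banglet {A : VType} {C : CType} {u : Tm} (h : RedC (.bang A) Γ Δ t)
    (hu : ∀ f Γ', Ren f Γ Γ' → ∀ a, a.SFree → Red A Γ' none a →
      RedC C Γ' none (Tm.subst0 a (u.rename (Tm.liftN f)))) :
    RedC C Γ Δ (.banglet t u) := by
  rintro f Γ' hf Δ' E D ⟨rfl, hE⟩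
  refine h f Γ' hf _ (.banglet (u.rename (Tm.liftN f)) :: E) D ⟨rfl, ?_⟩
  rw [StkC]
  refine .inr ⟨_, _, rfl, fun g Γ'' hg a ha ha' => ?_⟩
  have := hu _ _ (hg.comp hf) a ha ha'
  rw [← Tm.liftN_comp, ← Tm.rename_rename] at this
  exact this.plugC (hE.ren _ hg)

lemma RedC.copowlet {A : VType} {B C : CType} {u : Tm} (h : RedC (.copow A B) Γ Δ t)
    (hu : ∀ f Γ', Ren f Γ Γ' → ∀ Δ a b, a.SFree → Red A Γ' none a → RedC B Γ' Δ b →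
      RedC C Γ' Δ (Tm.ssubst b (Tm.subst0 a (u.rename (Tm.liftN f))))) :
    RedC C Γ Δ (.copowlet t u) := by
  rintro f Γ' hf Δ' E D ⟨rfl, hE⟩
  refine h f Γ' hf _ (.copowlet (u.rename (Tm.liftN f)) :: E) D ⟨rfl, ?_⟩
  rw [StkC]
  refine .inr ⟨_, _, rfl, fun g Γ'' hg Δ a b ha ha' hb => ?_⟩
  have := hu _ _ (hg.comp hf) Δ a b ha ha' hb
  rw [← Tm.liftN_comp, ← Tm.rename_rename] at this
  exact this.plugC (hE.ren _ hg)

lemma RedC.cimage {C : CType} (h : RedC .czero Γ Δ t) : RedC C Γ Δ (.cimage C t) := by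
  rintro f Γ' hf Δ' E D ⟨rfl, hE⟩
  exact h f Γ' hf _ (.cimage C :: E) D ⟨rfl, by rw [StkC]; exact .inr ⟨_, _, rfl⟩⟩

lemma RedC.ccase {A B C : CType} {u u' : Tm} (h : RedC (.csum A B) Γ Δ t)
    (hu : ∀ f Γ', Ren f Γ Γ' → ∀ Δ a, RedC A Γ' Δ a → RedC C Γ' Δ (Tm.ssubst a (u.rename f)))
    (hu' : ∀ f Γ', Ren f Γ Γ' → ∀ Δ a, RedC B Γ' Δ a →
      RedC C Γ' Δ (Tm.ssubst a (u'.rename f))) :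
    RedC C Γ Δ (.ccase t u u') := by
  rintro f Γ' hf Δ' E D ⟨rfl, hE⟩
  refine h f Γ' hf _ (.ccase (u.rename f) (u'.rename f) :: E) D ⟨rfl, ?_⟩
  rw [StkC]
  refine .inr ⟨_, _, _, rfl, fun g Γ'' hg Δ a => ⟨fun ha => ?_, fun ha => ?_⟩⟩
  · have := hu _ _ (hg.comp hf) Δ a ha
    rw [← Tm.rename_rename] at this
    exact this.plugC (hE.ren _ hg)
  · have := hu' _ _ (hg.comp hf) Δ a ha
    rw [← Tm.rename_rename] at this
    exact this.plugC (hE.ren _ hg)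

end Elim

mutual
  /-- Neutral terms are normalizable in all stacks, and reducible terms are normalizable. -/
  lemma reflect_reify_V (A : VType) :
      (∀ {Γ Δ' n E C}, Ne Γ none n A → StkV A Γ none Δ' E C → Nf Γ Δ' (E.plug n) C) ∧
      (∀ {Γ t}, Red A Γ none t → Nf Γ none t A) := by
    cases A with
    | base a =>
      constructor
      · intro Γ Δ' n E C hn hE
        simp only [StkV] at hE
        obtain ⟨-, rfl, rfl, rfl⟩ := hE
        exact .ne hn
      · intro Γ t h
        exact Orth.plug (E := []) h (by simp [StkV])
    | unit =>
      constructor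
      · intro Γ Δ' n E C hn hE
        simp only [StkV] at hE
      · intro Γ t h
        exact .unit
    | prod A B =>
      obtain ⟨iA, jA⟩ := reflect_reify_V A
      obtain ⟨iB, jB⟩ := reflect_reify_V B
      constructor
      · intro Γ Δ' n E C hn hE
        simp only [StkV] at hE
        obtain ⟨-, E', ⟨rfl, h⟩ | ⟨rfl, h⟩⟩ := hE
        · exact iA (n := .vfst n) (.vfst hn) h
        · exact iB (n := .vsnd n) (.vsnd hn) h
      · intro Γ t h
        exact .prod (jA h.vfst) (jB h.vsnd)
    | arr A B =>
      obtain ⟨iA, jA⟩ := reflect_reify_V A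
      obtain ⟨iB, jB⟩ := reflect_reify_V B
      constructor
      · intro Γ Δ' n E C hn hE
        simp only [StkV] at hE
        obtain ⟨-, a, E', rfl, -, ha, h⟩ := hE
        exact iB (n := .vapp n a) (.vapp hn (jA ha)) h
      · intro Γ t h
        refine .arr (jB (Red.vapp (Orth.ren h (Ren.succ A Γ)) trivial ?_))
        intro f Γ' hf Δ' E C hE
        exact iA (n := .var (f 0)) (.var (hf 0 A rfl)) hE
    | comp A =>
      obtain ⟨iA, jA⟩ := reflect_reify_C A
      constructor
      · intro Γ Δ' n E C hn hE
        simp only [StkV] at hE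
        obtain ⟨rfl, hE⟩ := hE
        exact iA hn hE
      · intro Γ t h
        rw [red_comp] at h
        exact jA h
    | lin A B =>
      obtain ⟨iA, jA⟩ := reflect_reify_C A
      obtain ⟨iB, jB⟩ := reflect_reify_C B
      constructor
      · intro Γ Δ' n E C hn hE
        simp only [StkV] at hE
        obtain ⟨-, a, E', rfl, ha, h⟩ := hE
        exact iB (n := .lapp n a) (.lapp hn (jA ha)) h
      · intro Γ t h
        refine .lin (jB (Red.lapp h ?_))
        rintro f Γ' hf Δ' E C ⟨rfl, hE⟩
        exact iA .svar hE
  lemma reflect_reify_C (A : CType) :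
      (∀ {Γ Δ n E C}, Ne Γ Δ n (.comp A) → StkC A Γ E C → Nf Γ Δ (E.plug n) C) ∧
      (∀ {Γ Δ t}, RedC A Γ Δ t → Nf Γ Δ t (.comp A)) := by
    cases A with
    | base a =>
      constructor
      · intro Γ Δ n E C hn hE
        simp only [StkC] at hE
        obtain ⟨rfl, rfl⟩ := hE
        exact .ne hn
      · intro Γ Δ t h
        exact h.plugC (E := []) (by simp [StkC])
    | cunit =>
      constructor
      · intro Γ Δ n E C hn hE
        simp only [StkC] at hE
      · intro Γ Δ t h
        exact .cunit
    | cand A B =>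
      obtain ⟨iA, jA⟩ := reflect_reify_C A
      obtain ⟨iB, jB⟩ := reflect_reify_C B
      constructor
      · intro Γ Δ n E C hn hE
        simp only [StkC] at hE
        obtain ⟨E', ⟨rfl, h⟩ | ⟨rfl, h⟩⟩ := hE
        · exact iA (n := .cfst n) (.cfst hn) h
        · exact iB (n := .csnd n) (.csnd hn) h
      · intro Γ Δ t h
        exact .cand (jA h.cfst) (jB h.csnd)
    | carr A B =>
      obtain ⟨iA, jA⟩ := reflect_reify_V A
      obtain ⟨iB, jB⟩ := reflect_reify_C B
      constructor
      · intro Γ Δ n E C hn hE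
        simp only [StkC] at hE
        obtain ⟨a, E', rfl, -, ha, h⟩ := hE
        exact iB (n := .capp n a) (.capp hn (jA ha)) h
      · intro Γ Δ t h
        refine .carr (jB (RedC.capp (Orth.ren h (Ren.succ A Γ)) trivial ?_))
        intro f Γ' hf Δ' E C hE
        exact iA (n := .var (f 0)) (.var (hf 0 A rfl)) hE
    | iunit =>
      constructor
      · intro Γ Δ n E C hn hE
        simp only [StkC] at hE
        obtain ⟨rfl, rfl⟩ | ⟨u, E', rfl, h⟩ := hE
        · exact .ne hn
        · have := h id _ (Ren.id _)
          rw [Tm.rename_id, Stack.rename_id] at this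
          exact .ilet E' hn this
      · intro Γ Δ t h
        exact h.plugC (E := []) (by simp [StkC])
    | bang A =>
      obtain ⟨iA, jA⟩ := reflect_reify_V A
      constructor
      · intro Γ Δ n E C hn hE
        simp only [StkC] at hE
        obtain ⟨rfl, rfl⟩ | ⟨u, E', rfl, h⟩ := hE
        · exact .ne hn
        · have := h _ _ (Ren.succ A _) (.var 0) trivial
            (fun f Γ' hf Δ' E C hE => iA (n := .var (f 0)) (.var (hf 0 A rfl)) hE)
          rw [Tm.subst0_var_zero_rename] at this
          exact .banglet E' hn this
      · intro Γ Δ t h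
        exact h.plugC (E := []) (by simp [StkC])
    | copow A B =>
      obtain ⟨iA, jA⟩ := reflect_reify_V A
      obtain ⟨iB, jB⟩ := reflect_reify_C B
      constructor
      · intro Γ Δ n E C hn hE
        simp only [StkC] at hE
        obtain ⟨rfl, rfl⟩ | ⟨u, E', rfl, h⟩ := hE
        · exact .ne hn
        · have := h _ _ (Ren.succ A _) (some B) (.var 0) .svar trivial
            (fun f Γ' hf Δ' E C hE => iA (n := .var (f 0)) (.var (hf 0 A rfl)) hE)
            (by rintro f Γ' hf Δ' E C ⟨rfl, hE⟩; exact iB .svar hE)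
          rw [Tm.subst0_var_zero_rename, Tm.ssubst_svar] at this
          exact .copowlet E' hn this
      · intro Γ Δ t h
        exact h.plugC (E := []) (by simp [StkC])
    | czero =>
      constructor
      · intro Γ Δ n E C hn hE
        simp only [StkC] at hE
        obtain ⟨rfl, rfl⟩ | ⟨A, E', rfl⟩ := hE
        · exact .ne hn
        · exact .cimage E' hn
      · intro Γ Δ t h
        exact h.plugC (E := []) (by simp [StkC])
    | csum A B =>
      obtain ⟨iA, jA⟩ := reflect_reify_C A
      obtain ⟨iB, jB⟩ := reflect_reify_C B
      constructor
      · intro Γ Δ n E C hn hE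
        simp only [StkC] at hE
        obtain ⟨rfl, rfl⟩ | ⟨t, u, E', rfl, h⟩ := hE
        · exact .ne hn
        · have h1 := (h id _ (Ren.id _) (some A) .svar).1
            (by rintro f Γ' hf Δ' E C ⟨rfl, hE⟩; exact iA .svar hE)
          have h2 := (h id _ (Ren.id _) (some B) .svar).2
            (by rintro f Γ' hf Δ' E C ⟨rfl, hE⟩; exact iB .svar hE)
          rw [Tm.rename_id, Stack.rename_id, Tm.ssubst_svar] at h1 h2
          exact .ccase E' hn h1 h2
      · intro Γ Δ t h
        exact h.plugC (E := []) (by simp [StkC])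
end
end EEC

namespace EEC

lemma Red.reify {A : VType} {Γ t} (h : Red A Γ none t) : Nf Γ none t A :=
  (reflect_reify_V A).2 h

lemma RedC.reify {A : CType} {Γ Δ t} (h : RedC A Γ Δ t) : Nf Γ Δ t (.comp A) :=
  (reflect_reify_C A).2 h

lemma Red.var {Γ : List VType} {n A} (h : Γ[n]? = some A) : Red A Γ none (.var n) :=
  fun f _ hf _ _ _ hE => (reflect_reify_V A).1 (n := .var (f n)) (.var (hf _ _ h)) hE

lemma RedC.svar {Γ : List VType} {A : CType} : RedC A Γ (some A) .svar := by
  rintro f Γ' hf Δ' E C ⟨rfl, hE⟩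
  exact (reflect_reify_C A).1 (n := .svar) .svar hE

section Intro
variable {Γ : List VType} {Δ : Option CType} {t u : Tm}

lemma Red.unit : Red .unit Γ none t := by
  intro f Γ' hf Δ' E C hE
  simp only [StkV] at hE

lemma Red.vpair {A B : VType} (ht : Red A Γ none t) (hu : Red B Γ none u) :
    Red (.prod A B) Γ none (.vpair t u) := by
  intro f Γ' hf Δ' E C hE
  simp only [StkV] at hE
  obtain ⟨-, E', ⟨rfl, hE⟩ | ⟨rfl, hE⟩⟩ := hE
  · exact Nf.beta E' Beta.vfst (ht f Γ' hf _ _ _ hE)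
  · exact Nf.beta E' Beta.vsnd (hu f Γ' hf _ _ _ hE)

lemma Red.vlam {A B : VType} (h : ∀ f Γ', Ren f Γ Γ' → ∀ a, a.SFree → Red A Γ' none a →
    Red B Γ' none (Tm.subst0 a (t.rename (Tm.liftN f)))) :
    Red (.arr A B) Γ none (.vlam A t) := by
  intro f Γ' hf Δ' E C hE
  simp only [StkV] at hE
  obtain ⟨-, a, E', rfl, ha, ha', hE⟩ := hE
  exact Nf.beta E' Beta.vapp ((h f Γ' hf a ha ha').plug hE)

lemma Red.llam {A B : CType} (h : ∀ f Γ', Ren f Γ Γ' → ∀ Δ a, RedC A Γ' Δ a →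
    RedC B Γ' Δ (Tm.ssubst a (t.rename f))) :
    Red (.lin A B) Γ none (.llam A t) := by
  intro f Γ' hf Δ' E C hE
  simp only [StkV] at hE
  obtain ⟨-, a, E', rfl, ha, hE⟩ := hE
  exact Nf.beta E' Beta.lapp ((h f Γ' hf _ a ha).plugC hE)

lemma RedC.cunit : RedC .cunit Γ Δ t := by
  rintro f Γ' hf Δ' E C ⟨rfl, hE⟩
  simp only [StkC] at hE

lemma RedC.cpair {A B : CType} (ht : RedC A Γ Δ t) (hu : RedC B Γ Δ u) :
    RedC (.cand A B) Γ Δ (.cpair t u) := by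
  rintro f Γ' hf Δ' E C ⟨rfl, hE⟩
  simp only [StkC] at hE
  obtain ⟨E', ⟨rfl, hE⟩ | ⟨rfl, hE⟩⟩ := hE
  · exact Nf.beta E' Beta.cfst (ht f Γ' hf _ _ _ ⟨rfl, hE⟩)
  · exact Nf.beta E' Beta.csnd (hu f Γ' hf _ _ _ ⟨rfl, hE⟩)

lemma RedC.clam {A : VType} {B : CType} (h : ∀ f Γ', Ren f Γ Γ' → ∀ a, a.SFree →
    Red A Γ' none a → RedC B Γ' Δ (Tm.subst0 a (t.rename (Tm.liftN f)))) :
    RedC (.carr A B) Γ Δ (.clam A t) := by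
  rintro f Γ' hf Δ' E C ⟨rfl, hE⟩
  simp only [StkC] at hE
  obtain ⟨a, E', rfl, ha, ha', hE⟩ := hE
  exact Nf.beta E' Beta.capp ((h f Γ' hf a ha ha').plugC hE)

lemma RedC.top : RedC .iunit Γ none .top := by
  rintro f Γ' hf Δ' E C ⟨rfl, hE⟩
  simp only [StkC] at hE
  obtain ⟨rfl, rfl⟩ | ⟨u, E', rfl, h⟩ := hE
  · exact .top
  · have := h id _ (Ren.id _)
    rw [Tm.rename_id, Stack.rename_id] at this
    exact Nf.beta E' Beta.ilet this

lemma RedC.bang {A : VType} (ht : t.SFree) (h : Red A Γ none t) :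
    RedC (.bang A) Γ none (.bang t) := by
  rintro f Γ' hf Δ' E C ⟨rfl, hE⟩
  simp only [StkC] at hE
  obtain ⟨rfl, rfl⟩ | ⟨u, E', rfl, hu⟩ := hE
  · exact .bang (Red.reify (Orth.ren h hf))
  · have := hu id _ (Ren.id _) _ (ht.rename f) (Orth.ren h hf)
    rw [Tm.liftN_id, Tm.rename_id, Stack.rename_id] at this
    exact Nf.beta E' Beta.banglet this

lemma RedC.copow {A : VType} {B : CType} (ht : t.SFree) (h : Red A Γ none t)
    (hu : RedC B Γ Δ u) : RedC (.copow A B) Γ Δ (.copow t u) := by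
  rintro f Γ' hf Δ' E C ⟨rfl, hE⟩
  simp only [StkC] at hE
  obtain ⟨rfl, rfl⟩ | ⟨u, E', rfl, h'⟩ := hE
  · exact .copow (Red.reify (Orth.ren h hf)) (RedC.reify (Orth.ren hu hf))
  · have := h' id _ (Ren.id _) _ _ _ (ht.rename f) (Orth.ren h hf) (Orth.ren hu hf)
    rw [Tm.liftN_id, Tm.rename_id, Stack.rename_id] at this
    exact Nf.beta E' Beta.copowlet this

lemma RedC.cinl {A B : CType} (h : RedC A Γ Δ t) : RedC (.csum A B) Γ Δ (.cinl t) := by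
  rintro f Γ' hf Δ' E C ⟨rfl, hE⟩
  simp only [StkC] at hE
  obtain ⟨rfl, rfl⟩ | ⟨u, u', E', rfl, h'⟩ := hE
  · exact .cinl (RedC.reify (Orth.ren h hf))
  · have := (h' id _ (Ren.id _) _ _).1 (Orth.ren h hf)
    rw [Tm.rename_id, Stack.rename_id] at this
    exact Nf.beta E' Beta.ccase_inl this

lemma RedC.cinr {A B : CType} (h : RedC B Γ Δ t) : RedC (.csum A B) Γ Δ (.cinr t) := by
  rintro f Γ' hf Δ' E C ⟨rfl, hE⟩
  simp only [StkC] at hE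
  obtain ⟨rfl, rfl⟩ | ⟨u, u', E', rfl, h'⟩ := hE
  · exact .cinr (RedC.reify (Orth.ren h hf))
  · have := (h' id _ (Ren.id _) _ _).2 (Orth.ren h hf)
    rw [Tm.rename_id, Stack.rename_id] at this
    exact Nf.beta E' Beta.ccase_inr this

end Intro

lemma Deriv.sfree {Γ Δ t A} (d : Deriv Γ Δ t A) (h : Δ = none) : t.SFree := by
  induction d <;> simp_all [Tm.SFree]

lemma Tm.subst0_binder {a : Tm} (ha : a.SFree) (f : ℕ → ℕ) (s : Tm) (σ : ℕ → Tm) (t : Tm) :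
    subst0 a (rename (liftN f) (ssubst (shift s) (psubst (liftS σ) t))) =
      ssubst (rename f s) (psubst (scons a (rename f ∘ σ)) t) := by
  rw [rename_ssubst, rename_shift, rename_psubst, rename_comp_liftS, subst0_ssubst ha,
    subst0_psubst_liftS]

/-- Admissible substituends for the stoup. -/
def RedStoup (Γ : List VType) (Δ : Option CType) (s : Tm) : Option CType → Prop
  | none => Δ = none
  | some D => RedC D Γ Δ s

lemma RedStoup.ren {Γ Γ' Δ s Δ₀ f} (hf : Ren f Γ Γ') (h : RedStoup Γ Δ s Δ₀) :
    RedStoup Γ' Δ (s.rename f) Δ₀ := by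
  cases Δ₀
  · exact h
  · exact Orth.ren h hf

/-- Reducible substitutions. -/
def RedSub (Γ Γ' : List VType) (σ : ℕ → Tm) : Prop :=
  (∀ n, (σ n).SFree) ∧ ∀ n B, Γ[n]? = some B → Red B Γ' none (σ n)

lemma RedSub.ren {Γ Γ' Γ'' σ f} (hf : Ren f Γ' Γ'') (h : RedSub Γ Γ' σ) :
    RedSub Γ Γ'' (Tm.rename f ∘ σ) :=
  ⟨fun n => (h.1 n).rename f, fun n B hn => Orth.ren (h.2 n B hn) hf⟩

lemma RedSub.scons {Γ Γ' σ a A} (h : RedSub Γ Γ' σ) (ha : a.SFree) (ha' : Red A Γ' none a) :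
    RedSub (A :: Γ) Γ' (Tm.scons a σ) := by
  refine ⟨Tm.SFree.scons ha h.1, fun n B hn => ?_⟩
  cases n
  · cases hn; exact ha'
  · exact h.2 _ _ hn

/-- The fundamental theorem of the logical relation. -/
theorem Deriv.red {Γ Δ t A} (d : Deriv Γ Δ t A) : ∀ {Γ' Δ' σ s}, RedSub Γ Γ' σ →
    RedStoup Γ' Δ' s Δ → Red A Γ' Δ' (Tm.ssubst s (Tm.psubst σ t)) := by
  have sf : ∀ {Γ Γ' t A σ s}, Deriv Γ none t A → RedSub Γ Γ' σ →
      (Tm.ssubst s (Tm.psubst σ t)).SFree := by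
    intro Γ Γ' t A σ s d h
    have := (d.sfree rfl).psubst h.1
    rwa [this.ssubst]
  induction d with
  | var Γ n A h =>
    rintro Γ' _ σ s hσ rfl
    simp only [Tm.psubst, (hσ.1 n).ssubst]
    exact hσ.2 _ _ h
  | svar Γ A =>
    intro Γ' Δ' σ s hσ hs
    rw [red_comp]
    exact hs
  | unit Γ =>
    rintro Γ' _ σ s hσ rfl
    exact Red.unit
  | vpair Γ t u A B d1 d2 ih1 ih2 =>
    rintro Γ' _ σ s hσ rfl
    exact Red.vpair (ih1 hσ rfl) (ih2 hσ rfl)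
  | vfst Γ t A B d ih =>
    rintro Γ' _ σ s hσ rfl
    exact Red.vfst (ih hσ rfl)
  | vsnd Γ t A B d ih =>
    rintro Γ' _ σ s hσ rfl
    exact Red.vsnd (ih hσ rfl)
  | vlam Γ t A B d ih =>
    rintro Γ' _ σ s hσ rfl
    refine Red.vlam fun f Γ'' hf a ha ha' => ?_
    rw [Tm.subst0_binder ha]
    exact ih ((hσ.ren hf).scons ha ha') rfl
  | vapp Γ s t A B d1 d2 ih1 ih2 =>
    rintro Γ' _ σ s hσ rfl
    exact Red.vapp (ih1 hσ rfl) (sf d2 hσ) (ih2 hσ rfl)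
  | cunit Γ Δ =>
    intro Γ' Δ' σ s hσ hs
    rw [red_comp]
    exact RedC.cunit
  | cpair Γ Δ t u A B d1 d2 ih1 ih2 =>
    intro Γ' Δ' σ s hσ hs
    rw [red_comp] at *
    exact RedC.cpair (ih1 hσ hs) (ih2 hσ hs)
  | cfst Γ Δ t A B d ih =>
    intro Γ' Δ' σ s hσ hs
    rw [red_comp] at *
    exact RedC.cfst (ih hσ hs)
  | csnd Γ Δ t A B d ih =>
    intro Γ' Δ' σ s hσ hs
    rw [red_comp] at *
    exact RedC.csnd (ih hσ hs)
  | clam Γ Δ t A B d ih =>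
    intro Γ' Δ' σ s hσ hs
    rw [red_comp] at *
    refine RedC.clam fun f Γ'' hf a ha ha' => ?_
    rw [Tm.subst0_binder ha]
    exact ih ((hσ.ren hf).scons ha ha') (hs.ren hf)
  | capp Γ Δ s t A B d1 d2 ih1 ih2 =>
    intro Γ' Δ' σ s hσ hs
    rw [red_comp] at *
    exact RedC.capp (ih1 hσ hs) (sf d2 hσ) (ih2 hσ rfl)
  | top Γ =>
    rintro Γ' _ σ s hσ rfl
    rw [red_comp]
    exact RedC.top
  | ilet Γ Δ t u A d1 d2 ih1 ih2 =>
    intro Γ' Δ' σ s hσ hs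
    rw [red_comp] at *
    exact RedC.ilet (ih1 hσ hs) (ih2 hσ rfl)
  | bang Γ t A d ih =>
    rintro Γ' _ σ s hσ rfl
    rw [red_comp] at *
    exact RedC.bang (sf d hσ) (ih hσ rfl)
  | banglet Γ Δ t u A B d1 d2 ih1 ih2 =>
    intro Γ' Δ' σ s hσ hs
    rw [red_comp] at *
    refine RedC.banglet (ih1 hσ hs) fun f Γ'' hf a ha ha' => ?_
    rw [Tm.subst0_binder ha]
    exact ih2 ((hσ.ren hf).scons ha ha') rfl
  | copow Γ Δ t u A B d1 d2 ih1 ih2 =>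
    intro Γ' Δ' σ s hσ hs
    rw [red_comp] at *
    exact RedC.copow (sf d1 hσ) (ih1 hσ rfl) (ih2 hσ hs)
  | copowlet Γ Δ s t A B C d1 d2 ih1 ih2 =>
    intro Γ' Δ' σ s hσ hs
    rw [red_comp] at *
    refine RedC.copowlet (ih1 hσ hs) fun f Γ'' hf Δ'' a b ha ha' hb => ?_
    rw [Tm.rename_psubst, Tm.rename_comp_liftS, Tm.subst0_psubst_liftS]
    exact ih2 ((hσ.ren hf).scons ha ha') hb
  | cimage Γ Δ t A d ih =>
    intro Γ' Δ' σ s hσ hs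
    rw [red_comp] at *
    exact RedC.cimage (ih hσ hs)
  | cinl Γ Δ t A B d ih =>
    intro Γ' Δ' σ s hσ hs
    rw [red_comp] at *
    exact RedC.cinl (ih hσ hs)
  | cinr Γ Δ t A B d ih =>
    intro Γ' Δ' σ s hσ hs
    rw [red_comp] at *
    exact RedC.cinr (ih hσ hs)
  | ccase Γ Δ s t u A B C d1 d2 d3 ih1 ih2 ih3 =>
    intro Γ' Δ' σ s hσ hs
    rw [red_comp] at *
    refine RedC.ccase (ih1 hσ hs) (fun f Γ'' hf Δ'' a ha => ?_) (fun f Γ'' hf Δ'' a ha => ?_)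
    · rw [Tm.rename_psubst]
      exact ih2 (hσ.ren hf) ha
    · rw [Tm.rename_psubst]
      exact ih3 (hσ.ren hf) ha
  | llam Γ t A B d ih =>
    rintro Γ' _ σ s hσ rfl
    rw [red_comp] at *
    refine Red.llam fun f Γ'' hf Δ'' a ha => ?_
    rw [Tm.rename_psubst]
    exact ih (hσ.ren hf) ha
  | lapp Γ Δ s t A B d1 d2 ih1 ih2 =>
    intro Γ' Δ' σ s hσ hs
    rw [red_comp] at *
    exact Red.lapp (ih1 hσ rfl) (ih2 hσ hs)

/-- Every typable term is normalizable. -/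
theorem Deriv.nf {Γ Δ t A} (d : Deriv Γ Δ t A) : Nf Γ Δ t A := by
  have hσ : RedSub Γ Γ Tm.var := ⟨fun _ => trivial, fun _ _ h => Red.var h⟩
  cases Δ with
  | none =>
    have := d.red (s := .svar) hσ rfl
    rw [Tm.psubst_var, Tm.ssubst_svar] at this
    exact this.reify
  | some D =>
    have := d.red (s := .svar) hσ RedC.svar
    rw [Tm.psubst_var, Tm.ssubst_svar] at this
    obtain ⟨B, rfl⟩ : ∃ B, A = .comp B := by cases d <;> exact ⟨_, rfl⟩
    rw [red_comp] at this
    exact this.reify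

end EEC

namespace EEC

lemma Deriv.comp_of_some {Γ D t T} (d : Deriv Γ (some D) t T) : ∃ B, T = .comp B := by
  cases d <;> exact ⟨_, rfl⟩

/-- Renaming of typing derivations commutes with the self-translation. -/
theorem Deriv.exists_rename (R : CType) {Γ Δ t A} (d : Deriv Γ Δ t A) :
    ∀ {f Γ'}, Ren f Γ Γ' → ∃ d' : Deriv Γ' Δ (t.rename f) A, cps R d' = (cps R d).rename f := by
  induction d with
  | var Γ n A h => exact fun hf => ⟨.var _ _ _ (hf _ _ h), rfl⟩
  | svar Γ A => exact fun hf => ⟨.svar _ _, rfl⟩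
  | unit Γ => exact fun hf => ⟨.unit _, rfl⟩
  | top Γ => exact fun hf => ⟨.top _, rfl⟩
  | cunit Γ Δ =>
    refine fun hf => ⟨.cunit _ _, ?_⟩
    cases Δ <;> rfl
  | vpair Γ t u A B d1 d2 ih1 ih2 =>
    intro f Γ' hf
    obtain ⟨e1, h1⟩ := ih1 hf
    obtain ⟨e2, h2⟩ := ih2 hf
    exact ⟨.vpair _ _ _ _ _ e1 e2, by simp [cps, Tm.rename, h1, h2]⟩
  | vfst Γ t A B d ih =>
    intro f Γ' hf
    obtain ⟨e, h⟩ := ih hf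
    exact ⟨.vfst _ _ _ _ e, by simp [cps, Tm.rename, h]⟩
  | vsnd Γ t A B d ih =>
    intro f Γ' hf
    obtain ⟨e, h⟩ := ih hf
    exact ⟨.vsnd _ _ _ _ e, by simp [cps, Tm.rename, h]⟩
  | vlam Γ t A B d ih =>
    intro f Γ' hf
    obtain ⟨e, h⟩ := ih (hf.lift A)
    exact ⟨.vlam _ _ _ _ e, by simp [cps, Tm.rename, h]⟩
  | vapp Γ s t A B d1 d2 ih1 ih2 =>
    intro f Γ' hf
    obtain ⟨e1, h1⟩ := ih1 hf
    obtain ⟨e2, h2⟩ := ih2 hf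
    exact ⟨.vapp _ _ _ _ _ e1 e2, by simp [cps, Tm.rename, h1, h2]⟩
  | cpair Γ Δ t u A B d1 d2 ih1 ih2 =>
    intro f Γ' hf
    obtain ⟨e1, h1⟩ := ih1 hf
    obtain ⟨e2, h2⟩ := ih2 hf
    exact ⟨.cpair _ _ _ _ _ _ e1 e2, by cases Δ <;> simp [cps, Tm.rename, h1, h2]⟩
  | cfst Γ Δ t A B d ih =>
    intro f Γ' hf
    obtain ⟨e, h⟩ := ih hf
    exact ⟨.cfst _ _ _ _ _ e, by cases Δ <;> simp [cps, Tm.rename, Tm.rename_ssubst, h]⟩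
  | csnd Γ Δ t A B d ih =>
    intro f Γ' hf
    obtain ⟨e, h⟩ := ih hf
    exact ⟨.csnd _ _ _ _ _ e, by cases Δ <;> simp [cps, Tm.rename, Tm.rename_ssubst, h]⟩
  | clam Γ Δ t A B d ih =>
    intro f Γ' hf
    obtain ⟨e, h⟩ := ih (hf.lift A)
    exact ⟨.clam _ _ _ _ _ e, by cases Δ <;> simp [cps, Tm.rename, h]⟩
  | capp Γ Δ s t A B d1 d2 ih1 ih2 =>
    intro f Γ' hf
    obtain ⟨e1, h1⟩ := ih1 hf
    obtain ⟨e2, h2⟩ := ih2 hf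
    exact ⟨.capp _ _ _ _ _ _ e1 e2,
      by cases Δ <;> simp [cps, Tm.rename, Tm.rename_ssubst, h1, h2]⟩
  | ilet Γ Δ t u A d1 d2 ih1 ih2 =>
    intro f Γ' hf
    obtain ⟨e1, h1⟩ := ih1 hf
    obtain ⟨e2, h2⟩ := ih2 hf
    exact ⟨.ilet _ _ _ _ _ e1 e2,
      by cases Δ <;> simp [cps, Tm.rename, Tm.rename_ssubst, h1, h2]⟩
  | bang Γ t A d ih =>
    intro f Γ' hf
    obtain ⟨e, h⟩ := ih hf
    exact ⟨.bang _ _ _ e, by simp [cps, Tm.rename, h]⟩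
  | banglet Γ Δ t u A B d1 d2 ih1 ih2 =>
    intro f Γ' hf
    obtain ⟨e1, h1⟩ := ih1 hf
    obtain ⟨e2, h2⟩ := ih2 (hf.lift A)
    exact ⟨.banglet _ _ _ _ _ _ e1 e2,
      by cases Δ <;> simp [cps, Tm.rename, Tm.rename_ssubst, h1, h2]⟩
  | copow Γ Δ t u A B d1 d2 ih1 ih2 =>
    intro f Γ' hf
    obtain ⟨e1, h1⟩ := ih1 hf
    obtain ⟨e2, h2⟩ := ih2 hf
    exact ⟨.copow _ _ _ _ _ _ e1 e2,
      by cases Δ <;> simp [cps, Tm.rename, Tm.rename_ssubst, h1, h2]⟩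
  | copowlet Γ Δ s t A B C d1 d2 ih1 ih2 =>
    intro f Γ' hf
    obtain ⟨e1, h1⟩ := ih1 hf
    obtain ⟨e2, h2⟩ := ih2 (hf.lift A)
    exact ⟨.copowlet _ _ _ _ _ _ _ e1 e2,
      by cases Δ <;> simp [cps, Tm.rename, Tm.rename_ssubst, h1, h2]⟩
  | cimage Γ Δ t A d ih =>
    intro f Γ' hf
    obtain ⟨e, h⟩ := ih hf
    exact ⟨.cimage _ _ _ _ e, by cases Δ <;> simp [cps, Tm.rename, Tm.rename_ssubst, h]⟩
  | cinl Γ Δ t A B d ih =>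
    intro f Γ' hf
    obtain ⟨e, h⟩ := ih hf
    exact ⟨.cinl _ _ _ _ _ e, by cases Δ <;> simp [cps, Tm.rename, Tm.rename_ssubst, h]⟩
  | cinr Γ Δ t A B d ih =>
    intro f Γ' hf
    obtain ⟨e, h⟩ := ih hf
    exact ⟨.cinr _ _ _ _ _ e, by cases Δ <;> simp [cps, Tm.rename, Tm.rename_ssubst, h]⟩
  | ccase Γ Δ s t u A B C d1 d2 d3 ih1 ih2 ih3 =>
    intro f Γ' hf
    obtain ⟨e1, h1⟩ := ih1 hf
    obtain ⟨e2, h2⟩ := ih2 hf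
    obtain ⟨e3, h3⟩ := ih3 hf
    exact ⟨.ccase _ _ _ _ _ _ _ _ e1 e2 e3,
      by cases Δ <;> simp [cps, Tm.rename, Tm.rename_ssubst, h1, h2, h3]⟩
  | llam Γ t A B d ih =>
    intro f Γ' hf
    obtain ⟨e, h⟩ := ih hf
    exact ⟨.llam _ _ _ _ e, by simp [cps, Tm.rename, h]⟩
  | lapp Γ Δ s t A B d1 d2 ih1 ih2 =>
    intro f Γ' hf
    obtain ⟨e1, h1⟩ := ih1 hf
    obtain ⟨e2, h2⟩ := ih2 hf
    exact ⟨.lapp _ _ _ _ _ _ e1 e2,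
      by cases Δ <;> simp [cps, Tm.rename, Tm.rename_ssubst, h1, h2]⟩

/-- `σ` is a well-typed substitution from `Γ` to `Γ'` whose translation is `τ`. -/
def CpsSub (R : CType) (Γ Γ' : List VType) (σ τ : ℕ → Tm) : Prop :=
  (∀ n, (τ n).SFree) ∧ ∀ n A, Γ[n]? = some A → ∃ e : Deriv Γ' none (σ n) A, cps R e = τ n

lemma CpsSub.lift {R Γ Γ' σ τ} (h : CpsSub R Γ Γ' σ τ) (A : VType) :
    CpsSub R (A :: Γ) (A :: Γ') (Tm.liftS σ) (Tm.liftS τ) := by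
  refine ⟨Tm.SFree.liftS h.1, fun n B hn => ?_⟩
  cases n with
  | zero => exact ⟨.var _ _ _ hn, rfl⟩
  | succ n =>
    obtain ⟨e, he⟩ := h.2 n B hn
    obtain ⟨e', he'⟩ := e.exists_rename R (Ren.succ A Γ')
    exact ⟨e', he'.trans (by rw [he]; rfl)⟩

/-- Substitution for value variables commutes with the self-translation. -/
theorem Deriv.exists_psubst (R : CType) {Γ Δ t A} (d : Deriv Γ Δ t A) :
    ∀ {σ τ Γ'}, CpsSub R Γ Γ' σ τ →
      ∃ d' : Deriv Γ' Δ (t.psubst σ) A, cps R d' = (cps R d).psubst τ := by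
  induction d with
  | var Γ n A h => exact fun hf => hf.2 n A h
  | svar Γ A => exact fun hf => ⟨.svar _ _, rfl⟩
  | unit Γ => exact fun hf => ⟨.unit _, rfl⟩
  | top Γ => exact fun hf => ⟨.top _, rfl⟩
  | cunit Γ Δ =>
    refine fun hf => ⟨.cunit _ _, ?_⟩
    cases Δ <;> rfl
  | vpair Γ t u A B d1 d2 ih1 ih2 =>
    intro σ τ Γ' hf
    obtain ⟨e1, h1⟩ := ih1 hf
    obtain ⟨e2, h2⟩ := ih2 hf
    exact ⟨.vpair _ _ _ _ _ e1 e2, by simp [cps, Tm.psubst, h1, h2]⟩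
  | vfst Γ t A B d ih =>
    intro σ τ Γ' hf
    obtain ⟨e, h⟩ := ih hf
    exact ⟨.vfst _ _ _ _ e, by simp [cps, Tm.psubst, h]⟩
  | vsnd Γ t A B d ih =>
    intro σ τ Γ' hf
    obtain ⟨e, h⟩ := ih hf
    exact ⟨.vsnd _ _ _ _ e, by simp [cps, Tm.psubst, h]⟩
  | vlam Γ t A B d ih =>
    intro σ τ Γ' hf
    obtain ⟨e, h⟩ := ih (hf.lift A)
    exact ⟨.vlam _ _ _ _ e, by simp [cps, Tm.psubst, h]⟩
  | vapp Γ s t A B d1 d2 ih1 ih2 =>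
    intro σ τ Γ' hf
    obtain ⟨e1, h1⟩ := ih1 hf
    obtain ⟨e2, h2⟩ := ih2 hf
    exact ⟨.vapp _ _ _ _ _ e1 e2, by simp [cps, Tm.psubst, h1, h2]⟩
  | cpair Γ Δ t u A B d1 d2 ih1 ih2 =>
    intro σ τ Γ' hf
    obtain ⟨e1, h1⟩ := ih1 hf
    obtain ⟨e2, h2⟩ := ih2 hf
    exact ⟨.cpair _ _ _ _ _ _ e1 e2, by cases Δ <;> simp [cps, Tm.psubst, h1, h2]⟩
  | cfst Γ Δ t A B d ih =>
    intro σ τ Γ' hf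
    obtain ⟨e, h⟩ := ih hf
    exact ⟨.cfst _ _ _ _ _ e, by cases Δ <;> simp [cps, Tm.psubst, Tm.psubst_ssubst hf.1, h]⟩
  | csnd Γ Δ t A B d ih =>
    intro σ τ Γ' hf
    obtain ⟨e, h⟩ := ih hf
    exact ⟨.csnd _ _ _ _ _ e, by cases Δ <;> simp [cps, Tm.psubst, Tm.psubst_ssubst hf.1, h]⟩
  | clam Γ Δ t A B d ih =>
    intro σ τ Γ' hf
    obtain ⟨e, h⟩ := ih (hf.lift A)
    exact ⟨.clam _ _ _ _ _ e, by cases Δ <;> simp [cps, Tm.psubst, h]⟩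
  | capp Γ Δ s t A B d1 d2 ih1 ih2 =>
    intro σ τ Γ' hf
    obtain ⟨e1, h1⟩ := ih1 hf
    obtain ⟨e2, h2⟩ := ih2 hf
    exact ⟨.capp _ _ _ _ _ _ e1 e2,
      by cases Δ <;> simp [cps, Tm.psubst, Tm.psubst_ssubst hf.1, h1, h2]⟩
  | ilet Γ Δ t u A d1 d2 ih1 ih2 =>
    intro σ τ Γ' hf
    obtain ⟨e1, h1⟩ := ih1 hf
    obtain ⟨e2, h2⟩ := ih2 hf
    exact ⟨.ilet _ _ _ _ _ e1 e2,
      by cases Δ <;> simp [cps, Tm.psubst, Tm.psubst_ssubst hf.1, h1, h2]⟩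
  | bang Γ t A d ih =>
    intro σ τ Γ' hf
    obtain ⟨e, h⟩ := ih hf
    exact ⟨.bang _ _ _ e, by simp [cps, Tm.psubst, h]⟩
  | banglet Γ Δ t u A B d1 d2 ih1 ih2 =>
    intro σ τ Γ' hf
    obtain ⟨e1, h1⟩ := ih1 hf
    obtain ⟨e2, h2⟩ := ih2 (hf.lift A)
    exact ⟨.banglet _ _ _ _ _ _ e1 e2,
      by cases Δ <;> simp [cps, Tm.psubst, Tm.psubst_ssubst hf.1, h1, h2]⟩
  | copow Γ Δ t u A B d1 d2 ih1 ih2 =>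
    intro σ τ Γ' hf
    obtain ⟨e1, h1⟩ := ih1 hf
    obtain ⟨e2, h2⟩ := ih2 hf
    exact ⟨.copow _ _ _ _ _ _ e1 e2,
      by cases Δ <;> simp [cps, Tm.psubst, Tm.psubst_ssubst hf.1, h1, h2]⟩
  | copowlet Γ Δ s t A B C d1 d2 ih1 ih2 =>
    intro σ τ Γ' hf
    obtain ⟨e1, h1⟩ := ih1 hf
    obtain ⟨e2, h2⟩ := ih2 (hf.lift A)
    exact ⟨.copowlet _ _ _ _ _ _ _ e1 e2,
      by cases Δ <;> simp [cps, Tm.psubst, Tm.psubst_ssubst hf.1, h1, h2]⟩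
  | cimage Γ Δ t A d ih =>
    intro σ τ Γ' hf
    obtain ⟨e, h⟩ := ih hf
    exact ⟨.cimage _ _ _ _ e, by cases Δ <;> simp [cps, Tm.psubst, Tm.psubst_ssubst hf.1, h]⟩
  | cinl Γ Δ t A B d ih =>
    intro σ τ Γ' hf
    obtain ⟨e, h⟩ := ih hf
    exact ⟨.cinl _ _ _ _ _ e, by cases Δ <;> simp [cps, Tm.psubst, Tm.psubst_ssubst hf.1, h]⟩
  | cinr Γ Δ t A B d ih =>
    intro σ τ Γ' hf
    obtain ⟨e, h⟩ := ih hf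
    exact ⟨.cinr _ _ _ _ _ e, by cases Δ <;> simp [cps, Tm.psubst, Tm.psubst_ssubst hf.1, h]⟩
  | ccase Γ Δ s t u A B C d1 d2 d3 ih1 ih2 ih3 =>
    intro σ τ Γ' hf
    obtain ⟨e1, h1⟩ := ih1 hf
    obtain ⟨e2, h2⟩ := ih2 hf
    obtain ⟨e3, h3⟩ := ih3 hf
    exact ⟨.ccase _ _ _ _ _ _ _ _ e1 e2 e3,
      by cases Δ <;> simp [cps, Tm.psubst, Tm.psubst_ssubst hf.1, h1, h2, h3]⟩
  | llam Γ t A B d ih =>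
    intro σ τ Γ' hf
    obtain ⟨e, h⟩ := ih hf
    exact ⟨.llam _ _ _ _ e, by simp [cps, Tm.psubst, h]⟩
  | lapp Γ Δ s t A B d1 d2 ih1 ih2 =>
    intro σ τ Γ' hf
    obtain ⟨e1, h1⟩ := ih1 hf
    obtain ⟨e2, h2⟩ := ih2 hf
    exact ⟨.lapp _ _ _ _ _ _ e1 e2,
      by cases Δ <;> simp [cps, Tm.psubst, Tm.psubst_ssubst hf.1, h1, h2]⟩

/-- Typability. -/
abbrev Typ (Γ : List VType) (Δ : Option CType) (t : Tm) (A : VType) : Prop :=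
  Nonempty (Deriv Γ Δ t A)

lemma Typ.shift {Γ Δ t A} (B : VType) (h : Typ Γ Δ t A) : Typ (B :: Γ) Δ t.shift A :=
  ⟨(h.some.exists_rename .iunit (Ren.succ B Γ)).choose⟩

lemma Typ.sfree {Γ t A} (h : Typ Γ none t A) : t.SFree := h.some.sfree rfl

lemma Typ.ssubst {Γ Δ t u A B} (h : Typ Γ (some A) t B) (hu : Typ Γ Δ u (.comp A)) :
    Typ Γ Δ (Tm.ssubst u t) B := by
  obtain ⟨d⟩ := h
  generalize hΔ : some A = Δ₀ at d
  have sf : ∀ {Γ t A} (s : Tm), Deriv Γ none t A → Deriv Γ none (Tm.ssubst s t) A := by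
    intro Γ t A s d
    rw [Tm.SFree.ssubst (d.sfree rfl)]
    exact d
  induction d generalizing u with
  | svar Γ B => cases hΔ; exact hu
  | cunit Γ Δ => exact ⟨.cunit _ _⟩
  | cpair Γ Δ t u A B d1 d2 ih1 ih2 => exact ⟨.cpair _ _ _ _ _ _ (ih1 hu hΔ).some (ih2 hu hΔ).some⟩
  | cfst Γ Δ t A B d ih => exact ⟨.cfst _ _ _ _ _ (ih hu hΔ).some⟩
  | csnd Γ Δ t A B d ih => exact ⟨.csnd _ _ _ _ _ (ih hu hΔ).some⟩
  | clam Γ Δ t A B d ih => exact ⟨.clam _ _ _ _ _ (ih (hu.shift A) hΔ).some⟩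
  | capp Γ Δ s t A B d1 d2 ih1 => exact ⟨.capp _ _ _ _ _ _ (ih1 hu hΔ).some (sf _ d2)⟩
  | ilet Γ Δ t u A d1 d2 ih1 => exact ⟨.ilet _ _ _ _ _ (ih1 hu hΔ).some (sf _ d2)⟩
  | banglet Γ Δ t u A B d1 d2 ih1 => exact ⟨.banglet _ _ _ _ _ _ (ih1 hu hΔ).some (sf _ d2)⟩
  | copow Γ Δ t u A B d1 d2 _ ih2 => exact ⟨.copow _ _ _ _ _ _ (sf _ d1) (ih2 hu hΔ).some⟩
  | copowlet Γ Δ s t A B C d1 d2 ih1 => exact ⟨.copowlet _ _ _ _ _ _ _ (ih1 hu hΔ).some d2⟩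
  | cimage Γ Δ t A d ih => exact ⟨.cimage _ _ _ _ (ih hu hΔ).some⟩
  | cinl Γ Δ t A B d ih => exact ⟨.cinl _ _ _ _ _ (ih hu hΔ).some⟩
  | cinr Γ Δ t A B d ih => exact ⟨.cinr _ _ _ _ _ (ih hu hΔ).some⟩
  | ccase Γ Δ s t u A B C d1 d2 d3 ih1 => exact ⟨.ccase _ _ _ _ _ _ _ _ (ih1 hu hΔ).some d2 d3⟩
  | lapp Γ Δ s t A B d1 d2 _ ih2 => exact ⟨.lapp _ _ _ _ _ _ (sf _ d1) (ih2 hu hΔ).some⟩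
  | _ => cases hΔ

lemma cpsCtx_getElem? {Γ : List VType} {R : CType} {n : ℕ} {A : VType} (h : Γ[n]? = some A) :
    (cpsCtx R Γ)[n]? = some (cpsV R A) := by
  simp [cpsCtx, h]

/-- The typing judgement satisfied by translations. -/
def CpsTyp (R : CType) (Γ : List VType) (T : VType) (s : Tm) : Option CType → Prop
  | none => Typ (cpsCtx R Γ) none s (cpsV R T)
  | some D => ∃ B, T = .comp B ∧ Typ (cpsCtx R Γ) (some (cpsC R B)) s (.comp (cpsC R D))

/-- The self-translation preserves typing. -/
theorem Deriv.cpsTyp (R : CType) {Γ Δ t A} (d : Deriv Γ Δ t A) : CpsTyp R Γ A (cps R d) Δ := by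
  have sv : ∀ {Γ A}, Typ Γ (some A) .svar (.comp A) := ⟨.svar _ _⟩
  have la : ∀ {Γ Δ s t A B}, Typ Γ none s (.lin A B) → Typ Γ Δ t (.comp A) →
    Typ Γ Δ (.lapp s t) (.comp B) := fun h h' => ⟨.lapp _ _ _ _ _ _ h.some h'.some⟩
  have lm : ∀ {Γ t A B}, Typ Γ (some A) t (.comp B) → Typ Γ none (.llam A t) (.lin A B) :=
    fun h => ⟨.llam _ _ _ _ h.some⟩
  induction d with
  | var Γ n A h => exact ⟨.var _ _ _ (cpsCtx_getElem? h)⟩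
  | svar Γ A => exact ⟨_, rfl, sv⟩
  | unit Γ => exact ⟨.unit _⟩
  | top Γ => exact lm sv
  | cunit Γ Δ =>
    cases Δ
    · exact lm ⟨.cimage _ _ _ _ (.svar _ _)⟩
    · exact ⟨_, rfl, ⟨.cimage _ _ _ _ (.svar _ _)⟩⟩
  | vpair Γ t u A B d1 d2 ih1 ih2 => exact ⟨.vpair _ _ _ _ _ ih1.some ih2.some⟩
  | vfst Γ t A B d ih => exact ⟨.vfst _ _ _ _ ih.some⟩
  | vsnd Γ t A B d ih => exact ⟨.vsnd _ _ _ _ ih.some⟩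
  | vlam Γ t A B d ih => exact ⟨.vlam _ _ _ _ ih.some⟩
  | vapp Γ s t A B d1 d2 ih1 ih2 => exact ⟨.vapp _ _ _ _ _ ih1.some ih2.some⟩
  | cpair Γ Δ t u A B d1 d2 ih1 ih2 =>
    cases Δ
    · exact lm ⟨.ccase _ _ _ _ _ _ _ _ (.svar _ _) (la ih1 sv).some (la ih2 sv).some⟩
    · obtain ⟨_, ⟨⟩, h1⟩ := ih1
      obtain ⟨_, ⟨⟩, h2⟩ := ih2
      exact ⟨_, rfl, ⟨.ccase _ _ _ _ _ _ _ _ (.svar _ _) h1.some h2.some⟩⟩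
  | cfst Γ Δ t A B d ih =>
    have h' : Typ (cpsCtx R Γ) (some (cpsC R A)) (.cinl .svar)
        (.comp (.csum (cpsC R A) (cpsC R B))) := ⟨.cinl _ _ _ _ _ (.svar _ _)⟩
    cases Δ
    · exact lm (la ih h')
    · obtain ⟨_, ⟨⟩, h⟩ := ih
      exact ⟨_, rfl, h.ssubst h'⟩
  | csnd Γ Δ t A B d ih =>
    have h' : Typ (cpsCtx R Γ) (some (cpsC R B)) (.cinr .svar)
        (.comp (.csum (cpsC R A) (cpsC R B))) := ⟨.cinr _ _ _ _ _ (.svar _ _)⟩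
    cases Δ
    · exact lm (la ih h')
    · obtain ⟨_, ⟨⟩, h⟩ := ih
      exact ⟨_, rfl, h.ssubst h'⟩
  | clam Γ Δ t A B d ih =>
    cases Δ
    · exact lm ⟨.copowlet _ _ _ _ _ _ _ (.svar _ _) (la ih sv).some⟩
    · obtain ⟨_, ⟨⟩, h⟩ := ih
      exact ⟨_, rfl, ⟨.copowlet _ _ _ _ _ _ _ (.svar _ _) h.some⟩⟩
  | capp Γ Δ s t A B d1 d2 ih1 ih2 =>
    have h' : Typ (cpsCtx R Γ) (some (cpsC R B)) _ _ := ⟨.copow _ _ _ _ _ _ ih2.some (.svar _ _)⟩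
    cases Δ
    · exact lm (la ih1 h')
    · obtain ⟨_, ⟨⟩, h⟩ := ih1
      exact ⟨_, rfl, h.ssubst h'⟩
  | ilet Γ Δ t u A d1 d2 ih1 ih2 =>
    cases Δ
    · exact lm (la ih1 (la ih2 sv))
    · obtain ⟨_, ⟨⟩, h⟩ := ih1
      exact ⟨_, rfl, h.ssubst (la ih2 sv)⟩
  | bang Γ t A d ih => exact lm ⟨.capp _ _ _ _ _ _ (.svar _ _) ih.some⟩
  | banglet Γ Δ t u A B d1 d2 ih1 ih2 =>
    have h' : Typ (cpsCtx R Γ) (some (cpsC R B)) _ _ := ⟨.clam _ _ _ _ _ (la ih2 sv).some⟩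
    cases Δ
    · exact lm (la ih1 h')
    · obtain ⟨_, ⟨⟩, h⟩ := ih1
      exact ⟨_, rfl, h.ssubst h'⟩
  | copow Γ Δ t u A B d1 d2 ih1 ih2 =>
    have h' : Typ (cpsCtx R Γ) (some (.carr (cpsV R A) (cpsC R B))) (.capp .svar (cps R d1))
        (.comp (cpsC R B)) := ⟨.capp _ _ _ _ _ _ (.svar _ _) ih1.some⟩
    cases Δ
    · exact lm (la ih2 h')
    · obtain ⟨_, ⟨⟩, h⟩ := ih2
      exact ⟨_, rfl, h.ssubst h'⟩
  | copowlet Γ Δ s t A B C d1 d2 ih1 ih2 =>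
    obtain ⟨_, ⟨⟩, h2⟩ := ih2
    have h' : Typ (cpsCtx R Γ) (some (cpsC R C)) _ _ := ⟨.clam _ _ _ _ _ h2.some⟩
    cases Δ
    · exact lm (la ih1 h')
    · obtain ⟨_, ⟨⟩, h⟩ := ih1
      exact ⟨_, rfl, h.ssubst h'⟩
  | cimage Γ Δ t A d ih =>
    cases Δ
    · exact lm (la ih ⟨.cunit _ _⟩)
    · obtain ⟨_, ⟨⟩, h⟩ := ih
      exact ⟨_, rfl, h.ssubst ⟨.cunit _ _⟩⟩
  | cinl Γ Δ t A B d ih =>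
    have h' : Typ (cpsCtx R Γ) (some (.cand (cpsC R A) (cpsC R B))) (.cfst .svar)
        (.comp (cpsC R A)) := ⟨.cfst _ _ _ _ _ (.svar _ _)⟩
    cases Δ
    · exact lm (la ih h')
    · obtain ⟨_, ⟨⟩, h⟩ := ih
      exact ⟨_, rfl, h.ssubst h'⟩
  | cinr Γ Δ t A B d ih =>
    have h' : Typ (cpsCtx R Γ) (some (.cand (cpsC R A) (cpsC R B))) (.csnd .svar)
        (.comp (cpsC R B)) := ⟨.csnd _ _ _ _ _ (.svar _ _)⟩
    cases Δ
    · exact lm (la ih h')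
    · obtain ⟨_, ⟨⟩, h⟩ := ih
      exact ⟨_, rfl, h.ssubst h'⟩
  | ccase Γ Δ s t u A B C d1 d2 d3 ih1 ih2 ih3 =>
    obtain ⟨_, ⟨⟩, h2⟩ := ih2
    obtain ⟨_, ⟨⟩, h3⟩ := ih3
    have h' : Typ (cpsCtx R Γ) (some (cpsC R C)) _ _ := ⟨.cpair _ _ _ _ _ _ h2.some h3.some⟩
    cases Δ
    · exact lm (la ih1 h')
    · obtain ⟨_, ⟨⟩, h⟩ := ih1
      exact ⟨_, rfl, h.ssubst h'⟩
  | llam Γ t A B d ih =>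
    obtain ⟨_, ⟨⟩, h⟩ := ih
    exact lm h
  | lapp Γ Δ s t A B d1 d2 ih1 ih2 =>
    cases Δ
    · exact lm (la ih2 (la ih1 sv))
    · obtain ⟨_, ⟨⟩, h⟩ := ih2
      exact ⟨_, rfl, h.ssubst (la ih1 sv)⟩

lemma Typ.subst0 {Γ Δ t u A B} (h : Typ (A :: Γ) Δ t B) (hu : Typ Γ none u A) :
    Typ Γ Δ (Tm.subst0 u t) B := by
  rw [Tm.subst0_eq]
  obtain ⟨e⟩ := hu
  have hs : CpsSub .iunit (A :: Γ) Γ (Tm.scons u Tm.var)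
      (Tm.scons (cps .iunit e) Tm.var) := by
    refine ⟨Tm.SFree.scons (Typ.sfree (e.cpsTyp .iunit)) fun _ => trivial, fun n B hn => ?_⟩
    cases n with
    | zero => cases hn; exact ⟨e, rfl⟩
    | succ n => exact ⟨.var _ _ _ hn, rfl⟩
  exact ⟨(h.some.exists_psubst .iunit hs).choose⟩

end EEC

namespace EEC

/-- Equal terms are typable. -/
lemma EEq.typ {Γ Δ t u A} (h : EEq Γ Δ t u A) : Typ Γ Δ t A ∧ Typ Γ Δ u A := by
  induction h with
  | refl d => exact ⟨⟨d⟩, ⟨d⟩⟩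
  | symm _ ih => exact ih.symm
  | trans _ _ ih1 ih2 => exact ⟨ih1.1, ih2.2⟩
  | vpair_cong _ _ ih1 ih2 =>
    exact ⟨⟨.vpair _ _ _ _ _ ih1.1.some ih2.1.some⟩, ⟨.vpair _ _ _ _ _ ih1.2.some ih2.2.some⟩⟩
  | vfst_cong _ ih => exact ⟨⟨.vfst _ _ _ _ ih.1.some⟩, ⟨.vfst _ _ _ _ ih.2.some⟩⟩
  | vsnd_cong _ ih => exact ⟨⟨.vsnd _ _ _ _ ih.1.some⟩, ⟨.vsnd _ _ _ _ ih.2.some⟩⟩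
  | vlam_cong _ ih => exact ⟨⟨.vlam _ _ _ _ ih.1.some⟩, ⟨.vlam _ _ _ _ ih.2.some⟩⟩
  | vapp_cong _ _ ih1 ih2 =>
    exact ⟨⟨.vapp _ _ _ _ _ ih1.1.some ih2.1.some⟩, ⟨.vapp _ _ _ _ _ ih1.2.some ih2.2.some⟩⟩
  | cpair_cong _ _ ih1 ih2 =>
    exact ⟨⟨.cpair _ _ _ _ _ _ ih1.1.some ih2.1.some⟩, ⟨.cpair _ _ _ _ _ _ ih1.2.some ih2.2.some⟩⟩
  | cfst_cong _ ih => exact ⟨⟨.cfst _ _ _ _ _ ih.1.some⟩, ⟨.cfst _ _ _ _ _ ih.2.some⟩⟩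
  | csnd_cong _ ih => exact ⟨⟨.csnd _ _ _ _ _ ih.1.some⟩, ⟨.csnd _ _ _ _ _ ih.2.some⟩⟩
  | clam_cong _ ih => exact ⟨⟨.clam _ _ _ _ _ ih.1.some⟩, ⟨.clam _ _ _ _ _ ih.2.some⟩⟩
  | capp_cong _ _ ih1 ih2 =>
    exact ⟨⟨.capp _ _ _ _ _ _ ih1.1.some ih2.1.some⟩, ⟨.capp _ _ _ _ _ _ ih1.2.some ih2.2.some⟩⟩
  | ilet_cong _ _ ih1 ih2 =>
    exact ⟨⟨.ilet _ _ _ _ _ ih1.1.some ih2.1.some⟩, ⟨.ilet _ _ _ _ _ ih1.2.some ih2.2.some⟩⟩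
  | bang_cong _ ih => exact ⟨⟨.bang _ _ _ ih.1.some⟩, ⟨.bang _ _ _ ih.2.some⟩⟩
  | banglet_cong _ _ ih1 ih2 =>
    exact ⟨⟨.banglet _ _ _ _ _ _ ih1.1.some ih2.1.some⟩,
      ⟨.banglet _ _ _ _ _ _ ih1.2.some ih2.2.some⟩⟩
  | copow_cong _ _ ih1 ih2 =>
    exact ⟨⟨.copow _ _ _ _ _ _ ih1.1.some ih2.1.some⟩, ⟨.copow _ _ _ _ _ _ ih1.2.some ih2.2.some⟩⟩
  | copowlet_cong _ _ ih1 ih2 =>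
    exact ⟨⟨.copowlet _ _ _ _ _ _ _ ih1.1.some ih2.1.some⟩,
      ⟨.copowlet _ _ _ _ _ _ _ ih1.2.some ih2.2.some⟩⟩
  | cimage_cong _ ih => exact ⟨⟨.cimage _ _ _ _ ih.1.some⟩, ⟨.cimage _ _ _ _ ih.2.some⟩⟩
  | cinl_cong _ ih => exact ⟨⟨.cinl _ _ _ _ _ ih.1.some⟩, ⟨.cinl _ _ _ _ _ ih.2.some⟩⟩
  | cinr_cong _ ih => exact ⟨⟨.cinr _ _ _ _ _ ih.1.some⟩, ⟨.cinr _ _ _ _ _ ih.2.some⟩⟩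
  | ccase_cong _ _ _ ih1 ih2 ih3 =>
    exact ⟨⟨.ccase _ _ _ _ _ _ _ _ ih1.1.some ih2.1.some ih3.1.some⟩,
      ⟨.ccase _ _ _ _ _ _ _ _ ih1.2.some ih2.2.some ih3.2.some⟩⟩
  | llam_cong _ ih => exact ⟨⟨.llam _ _ _ _ ih.1.some⟩, ⟨.llam _ _ _ _ ih.2.some⟩⟩
  | lapp_cong _ _ ih1 ih2 =>
    exact ⟨⟨.lapp _ _ _ _ _ _ ih1.1.some ih2.1.some⟩, ⟨.lapp _ _ _ _ _ _ ih1.2.some ih2.2.some⟩⟩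
  | unit_eta d => exact ⟨⟨d⟩, ⟨.unit _⟩⟩
  | vfst_beta d e => exact ⟨⟨.vfst _ _ _ _ (.vpair _ _ _ _ _ d e)⟩, ⟨d⟩⟩
  | vsnd_beta d e => exact ⟨⟨.vsnd _ _ _ _ (.vpair _ _ _ _ _ d e)⟩, ⟨e⟩⟩
  | vpair_eta d => exact ⟨⟨.vpair _ _ _ _ _ (.vfst _ _ _ _ d) (.vsnd _ _ _ _ d)⟩, ⟨d⟩⟩
  | vlam_beta d e => exact ⟨⟨.vapp _ _ _ _ _ (.vlam _ _ _ _ d) e⟩, Typ.subst0 ⟨d⟩ ⟨e⟩⟩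
  | @vlam_eta Γ t A B d =>
    exact ⟨⟨.vlam _ _ _ _ (.vapp _ _ _ _ _ (Typ.shift A ⟨d⟩).some (.var _ _ _ rfl))⟩, ⟨d⟩⟩
  | cunit_eta d => exact ⟨⟨d⟩, ⟨.cunit _ _⟩⟩
  | cfst_beta d e => exact ⟨⟨.cfst _ _ _ _ _ (.cpair _ _ _ _ _ _ d e)⟩, ⟨d⟩⟩
  | csnd_beta d e => exact ⟨⟨.csnd _ _ _ _ _ (.cpair _ _ _ _ _ _ d e)⟩, ⟨e⟩⟩
  | cpair_eta d => exact ⟨⟨.cpair _ _ _ _ _ _ (.cfst _ _ _ _ _ d) (.csnd _ _ _ _ _ d)⟩, ⟨d⟩⟩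
  | clam_beta d e => exact ⟨⟨.capp _ _ _ _ _ _ (.clam _ _ _ _ _ d) e⟩, Typ.subst0 ⟨d⟩ ⟨e⟩⟩
  | @clam_eta Γ Δ t A B d =>
    exact ⟨⟨.clam _ _ _ _ _ (.capp _ _ _ _ _ _ (Typ.shift A ⟨d⟩).some (.var _ _ _ rfl))⟩, ⟨d⟩⟩
  | ilet_beta d => exact ⟨⟨.ilet _ _ _ _ _ (.top _) d⟩, ⟨d⟩⟩
  | ilet_eta d e =>
    exact ⟨⟨.ilet _ _ _ _ _ d (Typ.ssubst ⟨e⟩ ⟨.top _⟩).some⟩, Typ.ssubst ⟨e⟩ ⟨d⟩⟩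
  | bang_beta d e => exact ⟨⟨.banglet _ _ _ _ _ _ (.bang _ _ _ d) e⟩, Typ.subst0 ⟨e⟩ ⟨d⟩⟩
  | @bang_eta Γ Δ t u A B d e =>
    exact ⟨⟨.banglet _ _ _ _ _ _ d
      (Typ.ssubst (Typ.shift A ⟨e⟩) ⟨.bang _ _ _ (.var _ _ _ rfl)⟩).some⟩, Typ.ssubst ⟨e⟩ ⟨d⟩⟩
  | copow_beta d e f =>
    exact ⟨⟨.copowlet _ _ _ _ _ _ _ (.copow _ _ _ _ _ _ d e) f⟩,
      Typ.ssubst (Typ.subst0 ⟨f⟩ ⟨d⟩) ⟨e⟩⟩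
  | @copow_eta Γ Δ t u A B C d e =>
    exact ⟨⟨.copowlet _ _ _ _ _ _ _ d (Typ.ssubst (Typ.shift A ⟨e⟩)
      ⟨.copow _ _ _ _ _ _ (.var _ _ _ rfl) (.svar _ _)⟩).some⟩, Typ.ssubst ⟨e⟩ ⟨d⟩⟩
  | czero_eta d e => exact ⟨⟨.cimage _ _ _ _ d⟩, Typ.ssubst ⟨e⟩ ⟨d⟩⟩
  | csum_beta_inl d e f =>
    exact ⟨⟨.ccase _ _ _ _ _ _ _ _ (.cinl _ _ _ _ _ f) d e⟩, Typ.ssubst ⟨d⟩ ⟨f⟩⟩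
  | csum_beta_inr d e f =>
    exact ⟨⟨.ccase _ _ _ _ _ _ _ _ (.cinr _ _ _ _ _ f) d e⟩, Typ.ssubst ⟨e⟩ ⟨f⟩⟩
  | csum_eta d e =>
    exact ⟨⟨.ccase _ _ _ _ _ _ _ _ d (Typ.ssubst ⟨e⟩ ⟨.cinl _ _ _ _ _ (.svar _ _)⟩).some
      (Typ.ssubst ⟨e⟩ ⟨.cinr _ _ _ _ _ (.svar _ _)⟩).some⟩, Typ.ssubst ⟨e⟩ ⟨d⟩⟩
  | llam_beta d e => exact ⟨⟨.lapp _ _ _ _ _ _ (.llam _ _ _ _ d) e⟩, Typ.ssubst ⟨d⟩ ⟨e⟩⟩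
  | llam_eta d => exact ⟨⟨.llam _ _ _ _ (.lapp _ _ _ _ _ _ d (.svar _ _))⟩, ⟨d⟩⟩

/-- Typable terms are equal to themselves. -/
lemma Typ.refl {Γ Δ t A} (h : Typ Γ Δ t A) : EEq Γ Δ t t A := .refl h.some

/-- Stoup substitution is a congruence. -/
lemma EEq.ssubst {Γ Δ t t' u u' A B} (h : EEq Γ (some A) t t' (.comp B))
    (hu : EEq Γ Δ u u' (.comp A)) :
    EEq Γ Δ (Tm.ssubst u t) (Tm.ssubst u' t') (.comp B) :=
  .trans (.symm (.llam_beta h.typ.1.some hu.typ.1.some))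
    (.trans (.lapp_cong (.llam_cong h) hu) (.llam_beta h.typ.2.some hu.typ.2.some))

/-- The translation of a derivation of a computation type, applied to a continuation held in the
stoup. -/
def K (R : CType) : {Γ : List VType} → {Δ : Option CType} → {t : Tm} → {A : VType} →
    Deriv Γ Δ t A → Tm
  | _, none, _, _, d => .lapp (cps R d) .svar
  | _, some _, _, _, d => cps R d

/-- The type of the result of applying a translation to a continuation. -/
def resC (R : CType) : Option CType → CType
  | none => R
  | some D => cpsC R D

/-- Abstract over the continuation, if the stoup is empty. -/
def Kabs (X : CType) (s : Tm) : Option CType → Tm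
  | none => .llam X s
  | some _ => s

variable {R : CType}

lemma Deriv.cps_typ {Γ t A} (d : Deriv Γ none t A) :
    Typ (cpsCtx R Γ) none (cps R d) (cpsV R A) := d.cpsTyp R

lemma K_typ {Γ Δ t B} (d : Deriv Γ Δ t (.comp B)) :
    Typ (cpsCtx R Γ) (some (cpsC R B)) (K R d) (.comp (resC R Δ)) := by
  cases Δ with
  | none => exact ⟨.lapp _ _ _ _ _ _ d.cps_typ.some (.svar _ _)⟩
  | some D =>
    obtain ⟨_, ⟨⟩, h⟩ := d.cpsTyp R
    exact h

lemma K_eq_of {Γ Δ t B s} {d : Deriv Γ Δ t (.comp B)}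
    (hs : Typ (cpsCtx R Γ) (some (cpsC R B)) s (.comp (resC R Δ)))
    (h : cps R d = Kabs (cpsC R B) s Δ) :
    EEq (cpsCtx R Γ) (some (cpsC R B)) (K R d) s (.comp (resC R Δ)) := by
  cases Δ with
  | none =>
    have := EEq.llam_beta hs.some (Deriv.svar (cpsCtx R Γ) (cpsC R B))
    rw [Tm.ssubst_svar] at this
    simpa only [K, h, Kabs] using this
  | some D => exact (show K R d = s from h) ▸ hs.refl

lemma ssubst_cps {Γ t A} (s : Tm) (d : Deriv Γ none t A) :
    Tm.ssubst s (cps R d) = cps R d := Tm.SFree.ssubst d.cps_typ.sfree s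

/-- The translation of two derivations of the same judgement are equal. -/
def Coh (R : CType) : {Γ : List VType} → {Δ : Option CType} → {t t' : Tm} → {A : VType} →
    Deriv Γ Δ t A → Deriv Γ Δ t' A → Prop
  | Γ, none, _, _, A, d, d' => EEq (cpsCtx R Γ) none (cps R d) (cps R d') (cpsV R A)
  | Γ, some D, _, _, A, d, d' => ∀ B, A = .comp B →
      EEq (cpsCtx R Γ) (some (cpsC R B)) (cps R d) (cps R d') (.comp (cpsC R D))

lemma coh_iff {Γ Δ t t' B} {d : Deriv Γ Δ t (.comp B)} {d' : Deriv Γ Δ t' (.comp B)} :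
    Coh R d d' ↔ EEq (cpsCtx R Γ) (some (cpsC R B)) (K R d) (K R d') (.comp (resC R Δ)) := by
  cases Δ with
  | none =>
    refine ⟨fun h => .lapp_cong h (.refl (.svar _ _)), fun h => ?_⟩
    exact .trans (.symm (.llam_eta d.cps_typ.some)) (.trans (.llam_cong h)
      (.llam_eta d'.cps_typ.some))
  | some D =>
    refine ⟨fun h => h _ rfl, fun h C e => ?_⟩
    cases e
    exact h

lemma Coh.refl {Γ Δ t A} (d : Deriv Γ Δ t A) : Coh R d d := by
  cases Δ with
  | none => exact d.cps_typ.refl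
  | some D =>
    obtain ⟨B, rfl⟩ := d.comp_of_some
    exact coh_iff.2 (K_typ d).refl

lemma Coh.symm {Γ Δ t t' A} {d : Deriv Γ Δ t A} {d' : Deriv Γ Δ t' A} (h : Coh R d d') :
    Coh R d' d := by
  cases Δ with
  | none => exact EEq.symm h
  | some D => exact fun B e => (h B e).symm

lemma Coh.trans {Γ Δ t t' t'' A} {d : Deriv Γ Δ t A} {d' : Deriv Γ Δ t' A}
    {d'' : Deriv Γ Δ t'' A} (h : Coh R d d') (h' : Coh R d' d'') : Coh R d d'' := by
  cases Δ with
  | none => exact EEq.trans h h'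
  | some D => exact fun B e => (h B e).trans (h' B e)

end EEC

namespace EEC

/-- All types of the term are computation types. -/
def CompTm (t : Tm) : Prop := ∀ Γ Δ T, Typ Γ Δ t T → ∃ A, T = .comp A

/-- Typed frames whose hole has a computation type. -/
inductive FTyp (Γ : List VType) : Frame → CType → CType → Type
  | cfst (A B : CType) : FTyp Γ .cfst (.cand A B) A
  | csnd (A B : CType) : FTyp Γ .csnd (.cand A B) B
  | capp {a A} (B : CType) : Deriv Γ none a A → FTyp Γ (.capp a) (.carr A B) B
  | ilet {u C} : Deriv Γ none u (.comp C) → FTyp Γ (.ilet u) .iunit C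
  | banglet {u A C} : Deriv (A :: Γ) none u (.comp C) → FTyp Γ (.banglet u) (.bang A) C
  | copowlet {u A B C} : Deriv (A :: Γ) (some B) u (.comp C) →
      FTyp Γ (.copowlet u) (.copow A B) C
  | cimage (A : CType) : FTyp Γ (.cimage A) .czero A
  | ccase {t u A B C} : Deriv Γ (some A) t (.comp C) → Deriv Γ (some B) u (.comp C) →
      FTyp Γ (.ccase t u) (.csum A B) C

namespace FTyp

variable {Γ : List VType} {Δ : Option CType} {f : Frame} {H C : CType} {t : Tm}

/-- Fill the hole of a typed frame. -/
def plug : {f : Frame} → {H C : CType} → FTyp Γ f H C → Deriv Γ Δ t (.comp H) →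
    Deriv Γ Δ (f.plug t) (.comp C)
  | _, _, _, .cfst _ _, d => .cfst _ _ _ _ _ d
  | _, _, _, .csnd _ _, d => .csnd _ _ _ _ _ d
  | _, _, _, .capp _ e, d => .capp _ _ _ _ _ _ d e
  | _, _, _, .ilet e, d => .ilet _ _ _ _ _ d e
  | _, _, _, .banglet e, d => .banglet _ _ _ _ _ _ d e
  | _, _, _, .copowlet e, d => .copowlet _ _ _ _ _ _ _ d e
  | _, _, _, .cimage _, d => .cimage _ _ _ _ d
  | _, _, _, .ccase e e', d => .ccase _ _ _ _ _ _ _ _ d e e'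

/-- The continuation transformer of a typed frame. -/
def sem (R : CType) : {f : Frame} → {H C : CType} → FTyp Γ f H C → Tm
  | _, _, _, .cfst _ _ => .cinl .svar
  | _, _, _, .csnd _ _ => .cinr .svar
  | _, _, _, .capp _ e => .copow (cps R e) .svar
  | _, _, _, .ilet e => .lapp (cps R e) .svar
  | _, _, _, @FTyp.banglet _ _ A _ e => .clam (cpsV R A) (.lapp (cps R e) .svar)
  | _, _, _, @FTyp.copowlet _ _ A _ _ e => .clam (cpsV R A) (cps R e)
  | _, _, _, .cimage _ => .cunit
  | _, _, _, .ccase e e' => .cpair (cps R e) (cps R e')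

variable {R : CType}

lemma sem_typ (F : FTyp Γ f H C) :
    Typ (cpsCtx R Γ) (some (cpsC R C)) (F.sem R) (.comp (cpsC R H)) := by
  cases F with
  | cfst A B => exact ⟨.cinl _ _ _ _ _ (.svar _ _)⟩
  | csnd A B => exact ⟨.cinr _ _ _ _ _ (.svar _ _)⟩
  | capp B e => exact ⟨.copow _ _ _ _ _ _ e.cps_typ.some (.svar _ _)⟩
  | ilet e => exact K_typ e
  | banglet e => exact ⟨.clam _ _ _ _ _ (K_typ e).some⟩
  | copowlet e => exact ⟨.clam _ _ _ _ _ (K_typ e).some⟩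
  | cimage A => exact ⟨.cunit _ _⟩
  | ccase e e' => exact ⟨.cpair _ _ _ _ _ _ (K_typ e).some (K_typ e').some⟩

lemma K_plug (F : FTyp Γ f H C) (d : Deriv Γ Δ t (.comp H)) :
    EEq (cpsCtx R Γ) (some (cpsC R C)) (K R (F.plug d)) (Tm.ssubst (F.sem R) (K R d))
      (.comp (resC R Δ)) := by
  refine K_eq_of ((K_typ d).ssubst F.sem_typ) ?_
  cases Δ <;> cases F <;> simp [K, Kabs, cps, FTyp.plug, FTyp.sem, Tm.ssubst, ssubst_cps]

lemma exists_of_plug (ht : CompTm t) {T : VType}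
    (d : Deriv Γ Δ (f.plug t) T) : ∃ H C, ∃ F : FTyp Γ f H C, ∃ d₀ : Deriv Γ Δ t (.comp H),
      T = .comp C ∧ d ≍ (F.plug d₀ : Deriv Γ Δ (f.plug t) (.comp C)) := by
  cases f with
  | vfst => cases d with | vfst _ _ _ _ d => obtain ⟨_, ⟨⟩⟩ := ht _ _ _ ⟨d⟩
  | vsnd => cases d with | vsnd _ _ _ _ d => obtain ⟨_, ⟨⟩⟩ := ht _ _ _ ⟨d⟩
  | vapp a => cases d with | vapp _ _ _ _ _ d e => obtain ⟨_, ⟨⟩⟩ := ht _ _ _ ⟨d⟩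
  | lapp a => cases d with | lapp _ _ _ _ _ _ d e => obtain ⟨_, ⟨⟩⟩ := ht _ _ _ ⟨d⟩
  | cfst => cases d with | cfst _ _ _ A B d => exact ⟨_, _, .cfst A B, d, rfl, .rfl⟩
  | csnd => cases d with | csnd _ _ _ A B d => exact ⟨_, _, .csnd A B, d, rfl, .rfl⟩
  | capp a => cases d with | capp _ _ _ _ A B d e => exact ⟨_, _, .capp B e, d, rfl, .rfl⟩
  | ilet u => cases d with | ilet _ _ _ _ A d e => exact ⟨_, _, .ilet e, d, rfl, .rfl⟩
  | banglet u =>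
    cases d with | banglet _ _ _ _ A B d e => exact ⟨_, _, .banglet e, d, rfl, .rfl⟩
  | copowlet u =>
    cases d with | copowlet _ _ _ _ A B C d e => exact ⟨_, _, .copowlet e, d, rfl, .rfl⟩
  | cimage A => cases d with | cimage _ _ _ _ d => exact ⟨_, _, .cimage A, d, rfl, .rfl⟩
  | ccase u u' =>
    cases d with | ccase _ _ _ _ _ A B C d e e' => exact ⟨_, _, .ccase e e', d, rfl, .rfl⟩

lemma _root_.EEC.CompTm.plug (ht : CompTm t) (f : Frame) : CompTm (f.plug t) := by
  rintro Γ' Δ' T ⟨d⟩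
  obtain ⟨_, C, _, _, rfl, _⟩ := exists_of_plug ht d
  exact ⟨C, rfl⟩

lemma exists_rename (F : FTyp Γ f H C) {g : ℕ → ℕ} {Γ' : List VType} (hg : Ren g Γ Γ') :
    ∃ F' : FTyp Γ' (f.rename g) H C, F'.sem R = (F.sem R).rename g := by
  cases F with
  | cfst => exact ⟨.cfst _ _, rfl⟩
  | csnd => exact ⟨.csnd _ _, rfl⟩
  | capp _ e =>
    obtain ⟨e', h⟩ := e.exists_rename R hg
    exact ⟨.capp C e', by simp [FTyp.sem, Tm.rename, h]⟩
  | ilet e =>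
    obtain ⟨e', h⟩ := e.exists_rename R hg
    exact ⟨.ilet e', by simp [FTyp.sem, Tm.rename, h]⟩
  | banglet e =>
    obtain ⟨e', h⟩ := e.exists_rename R (hg.lift _)
    exact ⟨.banglet e', by simp [FTyp.sem, Tm.rename, h]⟩
  | copowlet e =>
    obtain ⟨e', h⟩ := e.exists_rename R (hg.lift _)
    exact ⟨.copowlet e', by simp [FTyp.sem, Tm.rename, h]⟩
  | cimage => exact ⟨.cimage _, rfl⟩
  | ccase e₁ e₂ =>
    obtain ⟨e₁', h₁⟩ := e₁.exists_rename R hg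
    obtain ⟨e₂', h₂⟩ := e₂.exists_rename R hg
    exact ⟨.ccase e₁' e₂', by simp [FTyp.sem, Tm.rename, h₁, h₂]⟩

end FTyp

/-- Typed stacks whose hole has a computation type. -/
inductive STyp (Γ : List VType) : Stack → CType → CType → Type
  | nil (A : CType) : STyp Γ [] A A
  | cons {f E A B C} : FTyp Γ f A B → STyp Γ E B C → STyp Γ (f :: E) A C

namespace STyp

variable {Γ : List VType} {Δ : Option CType} {E : Stack} {H C : CType} {t : Tm}

/-- Fill the hole of a typed stack. -/
def plug : {E : Stack} → {H C : CType} → {t : Tm} → STyp Γ E H C → Deriv Γ Δ t (.comp H) →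
    Deriv Γ Δ (E.plug t) (.comp C)
  | _, _, _, _, .nil _, d => d
  | _, _, _, _, .cons F S, d => S.plug (F.plug d)

/-- The continuation transformer of a typed stack. -/
def sem (R : CType) : {E : Stack} → {H C : CType} → STyp Γ E H C → Tm
  | _, _, _, .nil _ => .svar
  | _, _, _, .cons F S => Tm.ssubst (S.sem R) (F.sem R)

variable {R : CType}

lemma sem_typ (S : STyp Γ E H C) :
    Typ (cpsCtx R Γ) (some (cpsC R C)) (S.sem R) (.comp (cpsC R H)) := by
  induction S with
  | nil A => exact ⟨.svar _ _⟩
  | cons F S ih => exact F.sem_typ.ssubst ih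

lemma K_plug (S : STyp Γ E H C) (d : Deriv Γ Δ t (.comp H)) :
    EEq (cpsCtx R Γ) (some (cpsC R C)) (K R (S.plug d)) (Tm.ssubst (S.sem R) (K R d))
      (.comp (resC R Δ)) := by
  induction S generalizing t with
  | nil A => exact (Tm.ssubst_svar (K R d)).symm ▸ (K_typ d).refl
  | cons F S ih =>
    refine (ih (F.plug d)).trans ?_
    simp only [STyp.sem, ← Tm.ssubst_ssubst]
    exact (F.K_plug d).ssubst S.sem_typ.refl

lemma exists_of_plug (ht : CompTm t) {T : VType} (d : Deriv Γ Δ (E.plug t) T) :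
    ∃ H C, ∃ S : STyp Γ E H C, ∃ d₀ : Deriv Γ Δ t (.comp H),
      T = .comp C ∧ d ≍ (S.plug d₀ : Deriv Γ Δ (E.plug t) (.comp C)) := by
  induction E generalizing t with
  | nil =>
    obtain ⟨A, rfl⟩ := ht _ _ _ ⟨d⟩
    exact ⟨A, A, .nil A, d, rfl, .rfl⟩
  | cons f E ih =>
    obtain ⟨B, C, S, d₁, rfl, h⟩ := ih (ht.plug f) d
    obtain ⟨A, _, F, d₀, ⟨⟩, h'⟩ := FTyp.exists_of_plug ht d₁
    cases h'
    exact ⟨A, C, .cons F S, d₀, rfl, h⟩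

lemma exists_rename (S : STyp Γ E H C) {g : ℕ → ℕ} {Γ' : List VType} (hg : Ren g Γ Γ') :
    ∃ S' : STyp Γ' (E.rename g) H C, S'.sem R = (S.sem R).rename g := by
  induction S with
  | nil A => exact ⟨.nil A, rfl⟩
  | cons F S ih =>
    obtain ⟨F', hF⟩ := F.exists_rename (R := R) hg
    obtain ⟨S', hS⟩ := ih
    exact ⟨.cons F' S', by
      simp only [STyp.sem, Tm.rename_ssubst, hF, ← hS]; rfl⟩

end STyp
end EEC

namespace EEC

section Translation

variable {R : CType} {Γ : List VType} {Δ : Option CType} {t u : Tm}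

lemma K_cunit : EEq (cpsCtx R Γ) (some .czero) (K R (.cunit Γ Δ))
    (.cimage (resC R Δ) .svar) (.comp (resC R Δ)) :=
  K_eq_of (B := .cunit) ⟨.cimage _ _ _ _ (.svar _ _)⟩ (by cases Δ <;> rfl)

lemma K_cpair {A B} (d : Deriv Γ Δ t (.comp A)) (e : Deriv Γ Δ u (.comp B)) :
    EEq (cpsCtx R Γ) (some (.csum (cpsC R A) (cpsC R B))) (K R (.cpair _ _ _ _ _ _ d e))
      (.ccase .svar (K R d) (K R e)) (.comp (resC R Δ)) :=
  K_eq_of (B := .cand A B) ⟨.ccase _ _ _ _ _ _ _ _ (.svar _ _) (K_typ d).some (K_typ e).some⟩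
    (by cases Δ <;> rfl)

lemma K_clam {A B} (d : Deriv (A :: Γ) Δ t (.comp B)) :
    EEq (cpsCtx R Γ) (some (.copow (cpsV R A) (cpsC R B))) (K R (.clam _ _ _ _ _ d))
      (.copowlet .svar (K R d)) (.comp (resC R Δ)) :=
  K_eq_of (B := .carr A B) ⟨.copowlet _ _ _ _ _ _ _ (.svar _ _) (K_typ d).some⟩
    (by cases Δ <;> rfl)

lemma K_copow {A B} (d : Deriv Γ none t A) (e : Deriv Γ Δ u (.comp B)) :
    EEq (cpsCtx R Γ) (some (.carr (cpsV R A) (cpsC R B))) (K R (.copow _ _ _ _ _ _ d e))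
      (Tm.ssubst (.capp .svar (cps R d)) (K R e)) (.comp (resC R Δ)) :=
  K_eq_of (B := .copow A B)
    ((K_typ e).ssubst ⟨.capp _ _ _ _ _ _ (.svar _ _) d.cps_typ.some⟩)
    (by cases Δ <;> simp [K, Kabs, cps, Tm.ssubst, ssubst_cps, cpsC])

lemma K_cinl {A} (B : CType) (d : Deriv Γ Δ t (.comp A)) :
    EEq (cpsCtx R Γ) (some (.cand (cpsC R A) (cpsC R B))) (K R (.cinl _ _ _ _ B d))
      (Tm.ssubst (.cfst .svar) (K R d)) (.comp (resC R Δ)) :=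
  K_eq_of (B := .csum A B) ((K_typ d).ssubst ⟨.cfst _ _ _ _ _ (.svar _ _)⟩)
    (by cases Δ <;> simp [K, Kabs, cps, Tm.ssubst, ssubst_cps, cpsC])

lemma K_cinr {B} (A : CType) (d : Deriv Γ Δ t (.comp B)) :
    EEq (cpsCtx R Γ) (some (.cand (cpsC R A) (cpsC R B))) (K R (.cinr _ _ _ A _ d))
      (Tm.ssubst (.csnd .svar) (K R d)) (.comp (resC R Δ)) :=
  K_eq_of (B := .csum A B) ((K_typ d).ssubst ⟨.csnd _ _ _ _ _ (.svar _ _)⟩)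
    (by cases Δ <;> simp [K, Kabs, cps, Tm.ssubst, ssubst_cps, cpsC])

lemma K_lapp {A B} (d : Deriv Γ none t (.lin A B)) (e : Deriv Γ Δ u (.comp A)) :
    EEq (cpsCtx R Γ) (some (cpsC R B)) (K R (.lapp _ _ _ _ _ _ d e))
      (Tm.ssubst (.lapp (cps R d) .svar) (K R e)) (.comp (resC R Δ)) :=
  K_eq_of (B := B)
    ((K_typ e).ssubst ⟨.lapp _ _ _ _ _ _ d.cps_typ.some (.svar _ _)⟩)
    (by cases Δ <;> simp [K, Kabs, cps, Tm.ssubst, ssubst_cps])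

lemma K_top : EEq (cpsCtx R Γ) (some R) (K R (.top Γ)) .svar (.comp R) :=
  K_eq_of (B := .iunit) ⟨.svar _ _⟩ rfl

lemma K_bang {A} (d : Deriv Γ none t A) :
    EEq (cpsCtx R Γ) (some (.carr (cpsV R A) R)) (K R (.bang _ _ _ d))
      (.capp .svar (cps R d)) (.comp R) :=
  K_eq_of (B := .bang A) ⟨.capp _ _ _ _ _ _ (.svar _ _) d.cps_typ.some⟩ rfl

lemma K_shift {A} (B : VType) (d : Deriv Γ Δ t A) :
    ∃ d' : Deriv (B :: Γ) Δ t.shift A, K R d' = (K R d).shift := by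
  obtain ⟨d', h⟩ := d.exists_rename R (Ren.succ B Γ)
  refine ⟨d', ?_⟩
  cases Δ <;> simp [K, Tm.shift, Tm.rename, h]

end Translation

/-- Postcomposition of a substituted continuation. -/
lemma EEq.ssubst_postcomp {Γ A C D H} {s k k' m m' ku : Tm}
    (h : EEq Γ (some H) k' (Tm.ssubst k ku) (.comp D))
    (hm' : EEq Γ (some C) m' (Tm.ssubst s k') (.comp D))
    (hm : EEq Γ (some C) m (Tm.ssubst s k) (.comp A))
    (hs : Typ Γ (some C) s (.comp H)) (hu : Typ Γ (some A) ku (.comp D)) :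
    EEq Γ (some C) m' (Tm.ssubst m ku) (.comp D) := by
  have h' := h.ssubst hs.refl
  rw [Tm.ssubst_ssubst] at h'
  exact hm'.trans (h'.trans (hu.refl.ssubst hm.symm))

/-- Substitution of a continuation in a case distinction on the stoup. -/
lemma EEq.ccase_svar_ssubst {Γ A B C D} {k₁ k₂ ku : Tm}
    (h₁ : Typ Γ (some A) k₁ (.comp C)) (h₂ : Typ Γ (some B) k₂ (.comp C))
    (hu : Typ Γ (some C) ku (.comp D)) :
    EEq Γ (some (.csum A B)) (.ccase .svar (Tm.ssubst k₁ ku) (Tm.ssubst k₂ ku))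
      (Tm.ssubst (.ccase .svar k₁ k₂) ku) (.comp D) := by
  have hr : Typ Γ (some (.csum A B)) (Tm.ssubst (.ccase .svar k₁ k₂) ku) (.comp D) :=
    hu.ssubst ⟨.ccase _ _ _ _ _ _ _ _ (.svar _ _) h₁.some h₂.some⟩
  have e := EEq.csum_eta (.svar Γ (.csum A B)) hr.some
  rw [Tm.ssubst_svar, Tm.ssubst_ssubst, Tm.ssubst_ssubst] at e
  refine .trans (.symm (.ccase_cong (.refl (.svar _ _)) (hu.refl.ssubst ?_) (hu.refl.ssubst ?_))) e
  · simpa only [Tm.ssubst, Tm.ssubst_svar] using EEq.csum_beta_inl h₁.some h₂.some (.svar Γ A)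
  · simpa only [Tm.ssubst, Tm.ssubst_svar] using EEq.csum_beta_inr h₁.some h₂.some (.svar Γ B)

/-- Substitution of a continuation in a copower elimination of the stoup. -/
lemma EEq.copowlet_svar_ssubst {Γ A B C D} {k ku : Tm}
    (h : Typ (A :: Γ) (some B) k (.comp C)) (hu : Typ Γ (some C) ku (.comp D)) :
    EEq Γ (some (.copow A B)) (.copowlet .svar (Tm.ssubst k ku.shift))
      (Tm.ssubst (.copowlet .svar k) ku) (.comp D) := by
  have hr : Typ Γ (some (.copow A B)) (Tm.ssubst (.copowlet .svar k) ku) (.comp D) :=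
    hu.ssubst ⟨.copowlet _ _ _ _ _ _ _ (.svar _ _) h.some⟩
  have e := EEq.copow_eta (.svar Γ (.copow A B)) hr.some
  rw [Tm.ssubst_svar, Tm.shift_ssubst, Tm.ssubst_ssubst] at e
  refine .trans (.symm (.copowlet_cong (.refl (.svar _ _)) ((hu.shift A).refl.ssubst ?_))) e
  obtain ⟨hk, -⟩ := h.some.exists_rename .iunit ((Ren.succ A Γ).lift A)
  have e' := EEq.copow_beta (.var (A :: Γ) 0 A rfl) (.svar (A :: Γ) B) hk
  rwa [Tm.ssubst_svar, Tm.subst0_var_zero_rename] at e'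

/-- Stoup substitution is translated to substitution of continuations. -/
theorem Deriv.exists_ssubst (R : CType) {Γ Δ₀ t T} (d : Deriv Γ Δ₀ t T) :
    ∀ {A B}, Δ₀ = some A → T = .comp B → ∀ {Δ u} (du : Deriv Γ Δ u (.comp A)),
      ∃ d' : Deriv Γ Δ (Tm.ssubst u t) (.comp B),
        EEq (cpsCtx R Γ) (some (cpsC R B)) (K R d') (Tm.ssubst (K R d) (K R du))
          (.comp (resC R Δ)) := by
  induction d with
  | svar Γ A =>
    rintro A _ ⟨⟩ ⟨⟩ Δ u du
    exact ⟨du, (Tm.ssubst_svar (K R du)).symm ▸ (K_typ du).refl⟩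
  | cunit Γ Δ =>
    rintro A _ rfl ⟨⟩ Δ u du
    refine ⟨.cunit _ _, K_cunit.trans ?_⟩
    have e := EEq.czero_eta (.svar (cpsCtx R Γ) .czero)
      ((K_typ du).ssubst (K_typ (.cunit Γ (some A)))).some
    rwa [Tm.ssubst_svar] at e
  | cpair Γ Δ t u A B d1 d2 ih1 ih2 =>
    rintro A _ rfl ⟨⟩ Δ u du
    obtain ⟨d1', h1⟩ := ih1 rfl rfl du
    obtain ⟨d2', h2⟩ := ih2 rfl rfl du
    exact ⟨.cpair _ _ _ _ _ _ d1' d2', (K_cpair d1' d2').trans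
      ((EEq.ccase_cong (.refl (.svar _ _)) h1 h2).trans
        (.ccase_svar_ssubst (K_typ d1) (K_typ d2) (K_typ du)))⟩
  | clam Γ Δ t A B d ih =>
    rintro A' _ rfl ⟨⟩ Δ u du
    obtain ⟨du', hu⟩ := K_shift (R := R) A du
    obtain ⟨d', h⟩ := ih rfl rfl du'
    rw [hu] at h
    exact ⟨.clam _ _ _ _ _ d', (K_clam d').trans
      ((EEq.copowlet_cong (.refl (.svar _ _)) h).trans
        (.copowlet_svar_ssubst (K_typ d) (K_typ du)))⟩
  | cfst Γ Δ t A B d ih =>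
    rintro A _ rfl ⟨⟩ Δ u du
    obtain ⟨d', h⟩ := ih rfl rfl du
    exact ⟨(FTyp.cfst _ _).plug d', h.ssubst_postcomp (FTyp.K_plug _ d')
      (FTyp.K_plug (.cfst _ _) d) (FTyp.sem_typ _) (K_typ du)⟩
  | csnd Γ Δ t A B d ih =>
    rintro A _ rfl ⟨⟩ Δ u du
    obtain ⟨d', h⟩ := ih rfl rfl du
    exact ⟨(FTyp.csnd _ _).plug d', h.ssubst_postcomp (FTyp.K_plug _ d')
      (FTyp.K_plug (.csnd _ _) d) (FTyp.sem_typ _) (K_typ du)⟩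
  | capp Γ Δ s t A B d e ih =>
    rintro A _ rfl ⟨⟩ Δ u du
    obtain ⟨d', h⟩ := ih rfl rfl du
    rw [Tm.ssubst, (e.sfree rfl).ssubst]
    exact ⟨(FTyp.capp _ e).plug d', h.ssubst_postcomp (FTyp.K_plug _ d')
      (FTyp.K_plug (.capp _ e) d) (FTyp.sem_typ _) (K_typ du)⟩
  | ilet Γ Δ t u A d e ih =>
    rintro A _ rfl ⟨⟩ Δ u du
    obtain ⟨d', h⟩ := ih rfl rfl du
    rw [Tm.ssubst, (e.sfree rfl).ssubst]
    exact ⟨(FTyp.ilet e).plug d', h.ssubst_postcomp (FTyp.K_plug _ d')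
      (FTyp.K_plug (.ilet e) d) (FTyp.sem_typ _) (K_typ du)⟩
  | banglet Γ Δ t u A B d e ih =>
    rintro A _ rfl ⟨⟩ Δ u du
    obtain ⟨d', h⟩ := ih rfl rfl du
    rw [Tm.ssubst, (e.sfree rfl).ssubst]
    exact ⟨(FTyp.banglet e).plug d', h.ssubst_postcomp (FTyp.K_plug _ d')
      (FTyp.K_plug (.banglet e) d) (FTyp.sem_typ _) (K_typ du)⟩
  | copow Γ Δ t u A B e d _ ih =>
    rintro A' _ rfl ⟨⟩ Δ u du
    obtain ⟨d', h⟩ := ih rfl rfl du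
    rw [Tm.ssubst, (e.sfree rfl).ssubst]
    exact ⟨.copow _ _ _ _ _ _ e d', h.ssubst_postcomp (K_copow e d') (K_copow e d)
      ⟨.capp _ _ _ _ _ _ (.svar _ _) e.cps_typ.some⟩ (K_typ du)⟩
  | copowlet Γ Δ s t A B C d e ih =>
    rintro A _ rfl ⟨⟩ Δ u du
    obtain ⟨d', h⟩ := ih rfl rfl du
    exact ⟨(FTyp.copowlet e).plug d', h.ssubst_postcomp (FTyp.K_plug _ d')
      (FTyp.K_plug (.copowlet e) d) (FTyp.sem_typ _) (K_typ du)⟩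
  | cimage Γ Δ t A d ih =>
    rintro A _ rfl ⟨⟩ Δ u du
    obtain ⟨d', h⟩ := ih rfl rfl du
    exact ⟨(FTyp.cimage _).plug d', h.ssubst_postcomp (FTyp.K_plug _ d')
      (FTyp.K_plug (.cimage _) d) (FTyp.sem_typ _) (K_typ du)⟩
  | cinl Γ Δ t A B d ih =>
    rintro A _ rfl ⟨⟩ Δ u du
    obtain ⟨d', h⟩ := ih rfl rfl du
    exact ⟨.cinl _ _ _ _ _ d', h.ssubst_postcomp (K_cinl B d') (K_cinl B d)
      ⟨.cfst _ _ _ _ _ (.svar _ _)⟩ (K_typ du)⟩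
  | cinr Γ Δ t A B d ih =>
    rintro A' _ rfl ⟨⟩ Δ u du
    obtain ⟨d', h⟩ := ih rfl rfl du
    exact ⟨.cinr _ _ _ _ _ d', h.ssubst_postcomp (K_cinr A d') (K_cinr A d)
      ⟨.csnd _ _ _ _ _ (.svar _ _)⟩ (K_typ du)⟩
  | ccase Γ Δ s t u A B C d e1 e2 ih =>
    rintro A _ rfl ⟨⟩ Δ u du
    obtain ⟨d', h⟩ := ih rfl rfl du
    exact ⟨(FTyp.ccase e1 e2).plug d', h.ssubst_postcomp (FTyp.K_plug _ d')
      (FTyp.K_plug (.ccase e1 e2) d) (FTyp.sem_typ _) (K_typ du)⟩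
  | lapp Γ Δ s t A B e d _ ih =>
    rintro A _ rfl ⟨⟩ Δ u du
    obtain ⟨d', h⟩ := ih rfl rfl du
    rw [Tm.ssubst, (e.sfree rfl).ssubst]
    exact ⟨.lapp _ _ _ _ _ _ e d', h.ssubst_postcomp (K_lapp e d') (K_lapp e d)
      ⟨.lapp _ _ _ _ _ _ e.cps_typ.some (.svar _ _)⟩ (K_typ du)⟩
  | _ => rintro A B ⟨⟩ ⟨⟩

end EEC

namespace EEC

section Conversion

variable {R : CType} {Γ : List VType} {Δ : Option CType}

lemma Deriv.exists_subst0 (R : CType) {t u A B} (d : Deriv (A :: Γ) Δ t B) (e : Deriv Γ none u A) :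
    ∃ d' : Deriv Γ Δ (Tm.subst0 u t) B, cps R d' = Tm.subst0 (cps R e) (cps R d) ∧
      K R d' = Tm.subst0 (cps R e) (K R d) := by
  have hs : CpsSub R (A :: Γ) Γ (Tm.scons u Tm.var) (Tm.scons (cps R e) Tm.var) := by
    refine ⟨Tm.SFree.scons e.cps_typ.sfree fun _ => trivial, fun n B hn => ?_⟩
    cases n with
    | zero => cases hn; exact ⟨e, rfl⟩
    | succ n => exact ⟨.var _ _ _ hn, rfl⟩
  obtain ⟨d', h⟩ := d.exists_psubst R hs
  rw [Tm.subst0_eq]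
  refine ⟨d', by rw [h, Tm.subst0_eq], ?_⟩
  cases Δ <;> simp [K, h, Tm.subst0_eq, Tm.psubst]

/-- Every derivation for `t` is simulated by a derivation for `t'` with an equal translation. -/
def Sim (R : CType) (Γ : List VType) (t t' : Tm) : Prop :=
  ∀ Δ A (d : Deriv Γ Δ t A), ∃ d' : Deriv Γ Δ t' A, Coh R d d'

lemma FTyp.plug_eq {f f' H H' C t t'} {F : FTyp Γ f H C} {F' : FTyp Γ f' H' C} (hH : H = H')
    {d : Deriv Γ Δ t (.comp H)} {d' : Deriv Γ Δ t' (.comp H')}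
    (hF : EEq (cpsCtx R Γ) (some (cpsC R C)) (F.sem R) (F'.sem R) (.comp (cpsC R H)))
    (hd : EEq (cpsCtx R Γ) (some (cpsC R H)) (K R d) (K R d') (.comp (resC R Δ))) :
    EEq (cpsCtx R Γ) (some (cpsC R C)) (K R (F.plug d)) (K R (F'.plug d'))
      (.comp (resC R Δ)) := by
  subst hH
  exact (F.K_plug d).trans ((hd.ssubst hF).trans (F'.K_plug d').symm)

lemma FTyp.coh {f H C t t'} (F : FTyp Γ f H C) {d : Deriv Γ Δ t (.comp H)}
    {d' : Deriv Γ Δ t' (.comp H)} (h : Coh R d d') : Coh R (F.plug d) (F.plug d') :=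
  coh_iff.2 (FTyp.plug_eq rfl F.sem_typ.refl (coh_iff.1 h))

lemma Sim.frame {t t'} (h : Sim R Γ t t') (f : Frame) : Sim R Γ (f.plug t) (f.plug t') := by
  intro Δ A d
  cases f with
  | vfst =>
    cases d with
    | vfst _ _ _ _ d => obtain ⟨d', hd⟩ := h _ _ d; exact ⟨.vfst _ _ _ _ d', .vfst_cong hd⟩
  | vsnd =>
    cases d with
    | vsnd _ _ _ _ d => obtain ⟨d', hd⟩ := h _ _ d; exact ⟨.vsnd _ _ _ _ d', .vsnd_cong hd⟩
  | vapp a =>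
    cases d with
    | vapp _ _ _ _ _ d e =>
      obtain ⟨d', hd⟩ := h _ _ d
      exact ⟨.vapp _ _ _ _ _ d' e, .vapp_cong hd (Coh.refl e)⟩
  | lapp a =>
    cases d with
    | lapp _ _ _ _ _ _ d e =>
      obtain ⟨d', hd⟩ := h _ _ d
      refine ⟨.lapp _ _ _ _ _ _ d' e, coh_iff.2 ((K_lapp d e).trans
        (EEq.trans ?_ (K_lapp d' e).symm))⟩
      exact (K_typ e).refl.ssubst (.lapp_cong hd (.refl (.svar _ _)))
  | cfst =>
    cases d with
    | cfst _ _ _ _ _ d => obtain ⟨d', hd⟩ := h _ _ d; exact ⟨_, (FTyp.cfst _ _).coh hd⟩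
  | csnd =>
    cases d with
    | csnd _ _ _ _ _ d => obtain ⟨d', hd⟩ := h _ _ d; exact ⟨_, (FTyp.csnd _ _).coh hd⟩
  | capp a =>
    cases d with
    | capp _ _ _ _ _ _ d e => obtain ⟨d', hd⟩ := h _ _ d; exact ⟨_, (FTyp.capp _ e).coh hd⟩
  | ilet u =>
    cases d with
    | ilet _ _ _ _ _ d e => obtain ⟨d', hd⟩ := h _ _ d; exact ⟨_, (FTyp.ilet e).coh hd⟩
  | banglet u =>
    cases d with
    | banglet _ _ _ _ _ _ d e => obtain ⟨d', hd⟩ := h _ _ d; exact ⟨_, (FTyp.banglet e).coh hd⟩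
  | copowlet u =>
    cases d with
    | copowlet _ _ _ _ _ _ _ d e =>
      obtain ⟨d', hd⟩ := h _ _ d; exact ⟨_, (FTyp.copowlet e).coh hd⟩
  | cimage A =>
    cases d with
    | cimage _ _ _ _ d => obtain ⟨d', hd⟩ := h _ _ d; exact ⟨_, (FTyp.cimage _).coh hd⟩
  | ccase u u' =>
    cases d with
    | ccase _ _ _ _ _ _ _ _ d e e' =>
      obtain ⟨d', hd⟩ := h _ _ d; exact ⟨_, (FTyp.ccase e e').coh hd⟩

lemma Sim.stack {t t'} (h : Sim R Γ t t') (E : Stack) : Sim R Γ (E.plug t) (E.plug t') := by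
  induction E generalizing t t' with
  | nil => exact h
  | cons f E ih => exact ih (h.frame f)

/-- β-contraction is sound for the self-translation. -/
lemma Beta.sim {t t'} (h : Beta t t') : Sim R Γ t t' := by
  intro Δ A d
  cases h with
  | vfst =>
    cases d with
    | vfst _ _ _ _ d => cases d with
      | vpair _ _ _ _ _ d e => exact ⟨d, .vfst_beta d.cps_typ.some e.cps_typ.some⟩
  | vsnd =>
    cases d with
    | vsnd _ _ _ _ d => cases d with
      | vpair _ _ _ _ _ d e => exact ⟨e, .vsnd_beta d.cps_typ.some e.cps_typ.some⟩
  | vapp =>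
    cases d with
    | vapp _ _ _ _ _ d e => cases d with
      | vlam _ _ _ _ d =>
        obtain ⟨d', h, -⟩ := d.exists_subst0 R e
        refine ⟨d', ?_⟩
        simp only [Coh, h]
        exact .vlam_beta d.cps_typ.some e.cps_typ.some
  | cfst =>
    cases d with
    | cfst _ _ _ _ _ d => cases d with
      | cpair _ _ _ _ _ _ d e =>
        refine ⟨d, coh_iff.2 ((FTyp.K_plug (.cfst _ _) _).trans
          (((K_cpair d e).ssubst (FTyp.sem_typ (.cfst _ _)).refl).trans ?_))⟩
        have := EEq.csum_beta_inl (K_typ (R := R) d).some (K_typ e).some (.svar _ _)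
        rwa [Tm.ssubst_svar] at this
  | csnd =>
    cases d with
    | csnd _ _ _ _ _ d => cases d with
      | cpair _ _ _ _ _ _ d e =>
        refine ⟨e, coh_iff.2 ((FTyp.K_plug (.csnd _ _) _).trans
          (((K_cpair d e).ssubst (FTyp.sem_typ (.csnd _ _)).refl).trans ?_))⟩
        have := EEq.csum_beta_inr (K_typ (R := R) d).some (K_typ e).some (.svar _ _)
        rwa [Tm.ssubst_svar] at this
  | capp =>
    cases d with
    | capp _ _ _ _ _ _ d e => cases d with
      | clam _ _ _ _ _ d =>
        obtain ⟨d', -, h⟩ := d.exists_subst0 R e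
        refine ⟨d', coh_iff.2 ((FTyp.K_plug (.capp _ e) _).trans
          (((K_clam d).ssubst (FTyp.sem_typ (.capp _ e)).refl).trans ?_))⟩
        have := EEq.copow_beta (e.cps_typ (R := R)).some (.svar _ _) (K_typ d).some
        rwa [Tm.ssubst_svar, ← h] at this
  | ilet =>
    cases d with
    | ilet _ _ _ _ _ d e => cases d with
      | top =>
        exact ⟨e, coh_iff.2 ((FTyp.K_plug (.ilet e) _).trans
          (K_top.ssubst (FTyp.sem_typ (.ilet e)).refl))⟩
  | banglet =>
    cases d with
    | banglet _ _ _ _ _ _ d e => cases d with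
      | bang _ _ _ d =>
        obtain ⟨d', -, h⟩ := e.exists_subst0 R d
        refine ⟨d', coh_iff.2 ((FTyp.K_plug (.banglet e) _).trans
          (((K_bang d).ssubst (FTyp.sem_typ (.banglet e)).refl).trans ?_))⟩
        rw [Tm.ssubst, ssubst_cps, h]
        exact .clam_beta (K_typ e).some d.cps_typ.some
  | copowlet =>
    cases d with
    | copowlet _ _ _ _ _ _ _ d e => cases d with
      | copow _ _ _ _ _ _ d s =>
        obtain ⟨e', -, h⟩ := e.exists_subst0 R d
        obtain ⟨d', h'⟩ := e'.exists_ssubst R rfl rfl s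
        refine ⟨d', coh_iff.2 ((FTyp.K_plug (.copowlet e) _).trans
          (((K_copow d s).ssubst (FTyp.sem_typ (.copowlet e)).refl).trans (.trans ?_ h'.symm)))⟩
        rw [Tm.ssubst_ssubst, Tm.ssubst, ssubst_cps, h]
        exact (K_typ s).refl.ssubst (.clam_beta (K_typ e).some d.cps_typ.some)
  | ccase_inl =>
    cases d with
    | ccase _ _ _ _ _ _ _ _ d e e' => cases d with
      | cinl _ _ _ _ _ d =>
        obtain ⟨d', h'⟩ := e.exists_ssubst R rfl rfl d
        refine ⟨d', coh_iff.2 ((FTyp.K_plug (.ccase e e') _).trans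
          (((K_cinl _ d).ssubst (FTyp.sem_typ (.ccase e e')).refl).trans (.trans ?_ h'.symm)))⟩
        rw [Tm.ssubst_ssubst]
        exact (K_typ d).refl.ssubst (.cfst_beta (K_typ e).some (K_typ e').some)
  | ccase_inr =>
    cases d with
    | ccase _ _ _ _ _ _ _ _ d e e' => cases d with
      | cinr _ _ _ _ _ d =>
        obtain ⟨d', h'⟩ := e'.exists_ssubst R rfl rfl d
        refine ⟨d', coh_iff.2 ((FTyp.K_plug (.ccase e e') _).trans
          (((K_cinr _ d).ssubst (FTyp.sem_typ (.ccase e e')).refl).trans (.trans ?_ h'.symm)))⟩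
        rw [Tm.ssubst_ssubst]
        exact (K_typ d).refl.ssubst (.csnd_beta (K_typ e).some (K_typ e').some)
  | lapp =>
    cases d with
    | lapp _ _ _ _ _ _ d e => cases d with
      | llam _ _ _ _ d =>
        obtain ⟨d', h'⟩ := d.exists_ssubst R rfl rfl e
        refine ⟨d', coh_iff.2 ((K_lapp _ e).trans (.trans ?_ h'.symm))⟩
        have := EEq.llam_beta (K_typ (R := R) d).some (.svar _ _)
        rw [Tm.ssubst_svar] at this
        exact (K_typ e).refl.ssubst this

end Conversion

end EEC

namespace EEC

section Coherence

variable {R : CType} {Γ : List VType} {Δ : Option CType} {t n u : Tm} {A B : VType} {H C : CType}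

/-- The translation does not depend on the choice of derivation. -/
def Coherent (R : CType) (Γ : List VType) (Δ : Option CType) (t : Tm) (A : VType) : Prop :=
  ∀ d d' : Deriv Γ Δ t A, Coh R d d'

/-- The term has a unique type, and its translation does not depend on the choice of
derivation. -/
def NeCoherent (R : CType) (Γ : List VType) (Δ : Option CType) (t : Tm) (A : VType) : Prop :=
  (∀ B, Deriv Γ Δ t B → B = A) ∧ Coherent R Γ Δ t A

/-- Coherence for a commuting elimination of a neutral term inside a stack. -/
lemma NeCoherent.stack {f : Frame} {E : Stack} {H₁ H₂ C₁ C₂ : CType}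
    (h : NeCoherent R Γ Δ n (.comp H))
    {F₁ : FTyp Γ f H₁ C₁} {F₂ : FTyp Γ f H₂ C₂} {S₁ : STyp Γ E C₁ C} {S₂ : STyp Γ E C₂ C}
    (d₁ : Deriv Γ Δ n (.comp H₁)) (d₂ : Deriv Γ Δ n (.comp H₂))
    (hF : EEq (cpsCtx R Γ) (some (cpsC R C)) (Tm.ssubst (S₁.sem R) (F₁.sem R))
      (Tm.ssubst (S₂.sem R) (F₂.sem R)) (.comp (cpsC R H₁))) :
    Coh R (S₁.plug (F₁.plug d₁)) (S₂.plug (F₂.plug d₂)) := by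
  obtain ⟨⟩ := h.1 _ d₁
  obtain ⟨⟩ := h.1 _ d₂
  exact coh_iff.2 ((STyp.K_plug (.cons F₁ S₁) d₁).trans
    (((coh_iff.1 (h.2 d₁ d₂)).ssubst hF).trans (STyp.K_plug (.cons F₂ S₂) d₂).symm))

lemma STyp.ssubst_sem_K {E : Stack} {H₁ H₂ C : CType} (h : Coherent R Γ Δ (E.plug t) (.comp C))
    (S₁ : STyp Γ E H₁ C) (S₂ : STyp Γ E H₂ C) (d₁ : Deriv Γ Δ t (.comp H₁))
    (d₂ : Deriv Γ Δ t (.comp H₂)) :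
    EEq (cpsCtx R Γ) (some (cpsC R C)) (Tm.ssubst (S₁.sem R) (K R d₁))
      (Tm.ssubst (S₂.sem R) (K R d₂)) (.comp (resC R Δ)) :=
  (S₁.K_plug d₁).symm.trans ((coh_iff.1 (h _ _)).trans (S₂.K_plug d₂))

lemma STyp.ssubst_shift_sem_K {E : Stack} {H₁ H₂ C : CType}
    (h : Coherent R (A :: Γ) Δ ((E.rename Nat.succ).plug t) (.comp C))
    (S₁ : STyp Γ E H₁ C) (S₂ : STyp Γ E H₂ C) (d₁ : Deriv (A :: Γ) Δ t (.comp H₁))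
    (d₂ : Deriv (A :: Γ) Δ t (.comp H₂)) :
    EEq (cpsCtx R (A :: Γ)) (some (cpsC R C)) (Tm.ssubst (S₁.sem R).shift (K R d₁))
      (Tm.ssubst (S₂.sem R).shift (K R d₂)) (.comp (resC R Δ)) := by
  obtain ⟨S₁', h₁⟩ := S₁.exists_rename (R := R) (Ren.succ A Γ)
  obtain ⟨S₂', h₂⟩ := S₂.exists_rename (R := R) (Ren.succ A Γ)
  have := STyp.ssubst_sem_K h S₁' S₂' d₁ d₂
  rwa [h₁, h₂] at this

lemma CompTm.ilet : CompTm (.ilet n u) := by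
  rintro _ _ _ ⟨d⟩
  cases d
  exact ⟨_, rfl⟩

lemma CompTm.banglet : CompTm (.banglet n u) := by
  rintro _ _ _ ⟨d⟩
  cases d
  exact ⟨_, rfl⟩

lemma CompTm.copowlet : CompTm (.copowlet n u) := by
  rintro _ _ _ ⟨d⟩
  cases d
  exact ⟨_, rfl⟩

lemma CompTm.cimage : CompTm (.cimage C n) := by
  rintro _ _ _ ⟨d⟩
  cases d
  exact ⟨_, rfl⟩

lemma CompTm.ccase : CompTm (.ccase n t u) := by
  rintro _ _ _ ⟨d⟩
  cases d
  exact ⟨_, rfl⟩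

lemma Coherent.ilet {E : Stack} (hn : NeCoherent R Γ Δ n (.comp .iunit))
    (hu : Coherent R Γ none (E.plug u) A) : Coherent R Γ Δ (E.plug (.ilet n u)) A := by
  intro d d'
  obtain ⟨_, C, S₁, d₁, rfl, h₁⟩ := STyp.exists_of_plug .ilet d
  obtain ⟨_, _, S₂, d₂, ⟨⟩, h₂⟩ := STyp.exists_of_plug .ilet d'
  cases h₁
  cases h₂
  cases d₁ with
  | ilet _ _ _ _ _ d₁ e₁ => cases d₂ with
    | ilet _ _ _ _ _ d₂ e₂ =>
      exact hn.stack (F₁ := .ilet e₁) (F₂ := .ilet e₂) d₁ d₂ (STyp.ssubst_sem_K hu _ _ e₁ e₂)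

lemma Coherent.banglet {E : Stack} (hn : NeCoherent R Γ Δ n (.comp (.bang B)))
    (hu : Coherent R (B :: Γ) none ((E.rename Nat.succ).plug u) A) :
    Coherent R Γ Δ (E.plug (.banglet n u)) A := by
  intro d d'
  obtain ⟨_, C, S₁, d₁, rfl, h₁⟩ := STyp.exists_of_plug .banglet d
  obtain ⟨_, _, S₂, d₂, ⟨⟩, h₂⟩ := STyp.exists_of_plug .banglet d'
  cases h₁
  cases h₂
  cases d₁ with
  | banglet _ _ _ _ _ _ d₁ e₁ => cases d₂ with
    | banglet _ _ _ _ _ _ d₂ e₂ =>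
      obtain ⟨⟩ := hn.1 _ d₁
      obtain ⟨⟩ := hn.1 _ d₂
      exact hn.stack (F₁ := .banglet e₁) (F₂ := .banglet e₂) d₁ d₂
        (.clam_cong (STyp.ssubst_shift_sem_K hu _ _ e₁ e₂))

lemma Coherent.copowlet {E : Stack} (hn : NeCoherent R Γ Δ n (.comp (.copow B H)))
    (hu : Coherent R (B :: Γ) (some H) ((E.rename Nat.succ).plug u) A) :
    Coherent R Γ Δ (E.plug (.copowlet n u)) A := by
  intro d d'
  obtain ⟨_, C, S₁, d₁, rfl, h₁⟩ := STyp.exists_of_plug .copowlet d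
  obtain ⟨_, _, S₂, d₂, ⟨⟩, h₂⟩ := STyp.exists_of_plug .copowlet d'
  cases h₁
  cases h₂
  cases d₁ with
  | copowlet _ _ _ _ _ _ _ d₁ e₁ => cases d₂ with
    | copowlet _ _ _ _ _ _ _ d₂ e₂ =>
      obtain ⟨⟩ := hn.1 _ d₁
      obtain ⟨⟩ := hn.1 _ d₂
      exact hn.stack (F₁ := .copowlet e₁) (F₂ := .copowlet e₂) d₁ d₂
        (.clam_cong (STyp.ssubst_shift_sem_K hu _ _ e₁ e₂))

lemma Coherent.cimage {E : Stack} (hn : NeCoherent R Γ Δ n (.comp .czero)) :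
    Coherent R Γ Δ (E.plug (.cimage H n)) A := by
  intro d d'
  obtain ⟨_, C, S₁, d₁, rfl, h₁⟩ := STyp.exists_of_plug .cimage d
  obtain ⟨_, _, S₂, d₂, ⟨⟩, h₂⟩ := STyp.exists_of_plug .cimage d'
  cases h₁
  cases h₂
  cases d₁ with
  | cimage _ _ _ _ d₁ => cases d₂ with
    | cimage _ _ _ _ d₂ =>
      exact hn.stack (F₁ := .cimage _) (F₂ := .cimage _) d₁ d₂ (.refl (.cunit _ _))

lemma Coherent.ccase {E : Stack} {H₁ H₂ : CType} (hn : NeCoherent R Γ Δ n (.comp (.csum H₁ H₂)))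
    (ht : Coherent R Γ (some H₁) (E.plug t) A) (hu : Coherent R Γ (some H₂) (E.plug u) A) :
    Coherent R Γ Δ (E.plug (.ccase n t u)) A := by
  intro d d'
  obtain ⟨_, C, S₁, d₁, rfl, h₁⟩ := STyp.exists_of_plug .ccase d
  obtain ⟨_, _, S₂, d₂, ⟨⟩, h₂⟩ := STyp.exists_of_plug .ccase d'
  cases h₁
  cases h₂
  cases d₁ with
  | ccase _ _ _ _ _ _ _ _ d₁ e₁ e₁' => cases d₂ with
    | ccase _ _ _ _ _ _ _ _ d₂ e₂ e₂' =>
      obtain ⟨⟩ := hn.1 _ d₁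
      obtain ⟨⟩ := hn.1 _ d₂
      exact hn.stack (F₁ := .ccase e₁ e₁') (F₂ := .ccase e₂ e₂') d₁ d₂
        (.cpair_cong (STyp.ssubst_sem_K ht _ _ e₁ e₂) (STyp.ssubst_sem_K hu _ _ e₁' e₂'))

lemma Coherent.beta {r r' : Tm} (E : Stack) (hr : Beta r r') (h : Coherent R Γ Δ (E.plug r') A) :
    Coherent R Γ Δ (E.plug r) A := by
  intro d d'
  obtain ⟨e, he⟩ := hr.sim.stack E Δ A d
  obtain ⟨e', he'⟩ := hr.sim.stack E Δ A d'
  exact he.trans ((h e e').trans he'.symm)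

lemma Coherent.unit : Coherent R Γ none t .unit := fun d d' =>
  EEq.trans (.unit_eta d.cps_typ.some) (.symm (.unit_eta d'.cps_typ.some))

lemma Coherent.prod (h₁ : Coherent R Γ none (.vfst t) A) (h₂ : Coherent R Γ none (.vsnd t) B) :
    Coherent R Γ none t (.prod A B) := fun d d' =>
  EEq.trans (.symm (.vpair_eta d.cps_typ.some)) (.trans (.vpair_cong
    (h₁ (.vfst _ _ _ _ d) (.vfst _ _ _ _ d')) (h₂ (.vsnd _ _ _ _ d) (.vsnd _ _ _ _ d')))
    (.vpair_eta d'.cps_typ.some))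

lemma Coherent.arr (h : Coherent R (A :: Γ) none (.vapp t.shift (.var 0)) B) :
    Coherent R Γ none t (.arr A B) := by
  intro d d'
  obtain ⟨e, he⟩ := d.exists_rename R (Ren.succ A Γ)
  obtain ⟨e', he'⟩ := d'.exists_rename R (Ren.succ A Γ)
  have : EEq (cpsV R A :: cpsCtx R Γ) none (.vapp (cps R e) (.var 0)) (.vapp (cps R e') (.var 0))
      (cpsV R B) :=
    h (.vapp _ _ _ _ _ e (.var _ 0 A rfl)) (.vapp _ _ _ _ _ e' (.var _ 0 A rfl))
  rw [he, he'] at this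
  exact EEq.trans (.symm (.vlam_eta d.cps_typ.some)) (.trans (.vlam_cong this)
    (.vlam_eta d'.cps_typ.some))

lemma Coherent.lin (h : Coherent R Γ (some H) (.lapp t .svar) (.comp C)) :
    Coherent R Γ none t (.lin H C) := by
  intro d d'
  have := coh_iff.1 (h (.lapp _ _ _ _ _ _ d (.svar _ _)) (.lapp _ _ _ _ _ _ d' (.svar _ _)))
  simp only [K, cps, Tm.ssubst] at this
  exact EEq.trans (.symm (.llam_eta d.cps_typ.some)) (.trans (.llam_cong this)
    (.llam_eta d'.cps_typ.some))

lemma Coherent.cunit : Coherent R Γ Δ t (.comp .cunit) := by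
  intro d d'
  have h := EEq.czero_eta (.svar _ _) (K_typ (R := R) d).some
  have h' := EEq.czero_eta (.svar _ _) (K_typ (R := R) d').some
  rw [Tm.ssubst_svar] at h h'
  exact coh_iff.2 (h.symm.trans h')

lemma Coherent.cand (h₁ : Coherent R Γ Δ (.cfst t) (.comp H))
    (h₂ : Coherent R Γ Δ (.csnd t) (.comp C)) : Coherent R Γ Δ t (.comp (.cand H C)) := by
  intro d d'
  have h := EEq.csum_eta (.svar _ _) (K_typ (R := R) d).some
  have h' := EEq.csum_eta (.svar _ _) (K_typ (R := R) d').some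
  rw [Tm.ssubst_svar] at h h'
  refine coh_iff.2 (h.symm.trans (.trans (.ccase_cong (.refl (.svar _ _)) ?_ ?_) h'))
  · exact (FTyp.K_plug (.cfst _ _) d).symm.trans
      ((coh_iff.1 (h₁ _ _)).trans (FTyp.K_plug (.cfst _ _) d'))
  · exact (FTyp.K_plug (.csnd _ _) d).symm.trans
      ((coh_iff.1 (h₂ _ _)).trans (FTyp.K_plug (.csnd _ _) d'))

lemma Coherent.carr (h : Coherent R (A :: Γ) Δ (.capp t.shift (.var 0)) (.comp C)) :
    Coherent R Γ Δ t (.comp (.carr A C)) := by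
  intro d d'
  have hd := EEq.copow_eta (.svar _ _) (K_typ (R := R) d).some
  have hd' := EEq.copow_eta (.svar _ _) (K_typ (R := R) d').some
  rw [Tm.ssubst_svar] at hd hd'
  obtain ⟨e, he⟩ := K_shift (R := R) A d
  obtain ⟨e', he'⟩ := K_shift (R := R) A d'
  refine coh_iff.2 (hd.symm.trans (.trans (.copowlet_cong (.refl (.svar _ _)) ?_) hd'))
  rw [← he, ← he']
  let F : FTyp (A :: Γ) (.capp (.var 0)) (.carr A C) C := .capp _ (.var _ 0 A rfl)
  exact (F.K_plug e).symm.trans ((coh_iff.1 (h _ _)).trans (F.K_plug e'))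

lemma Coherent.top : Coherent R Γ none .top (.comp .iunit) := by
  intro d d'
  cases d
  cases d'
  exact .refl _

lemma Coherent.bang (h : Coherent R Γ none t A) :
    Coherent R Γ none (.bang t) (.comp (.bang A)) := by
  intro d d'
  cases d with
  | bang _ _ _ d => cases d' with
    | bang _ _ _ d' =>
      exact coh_iff.2 ((K_bang d).trans (.trans (.capp_cong (.refl (.svar _ _)) (h d d'))
        (K_bang d').symm))

lemma Coherent.copow (ht : Coherent R Γ none t A) (hu : Coherent R Γ Δ u (.comp C)) :
    Coherent R Γ Δ (.copow t u) (.comp (.copow A C)) := by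
  intro d d'
  cases d with
  | copow _ _ _ _ _ _ d e => cases d' with
    | copow _ _ _ _ _ _ d' e' =>
      exact coh_iff.2 ((K_copow d e).trans (((coh_iff.1 (hu e e')).ssubst
        (.capp_cong (.refl (.svar _ _)) (ht d d'))).trans (K_copow d' e').symm))

lemma Coherent.cinl (h : Coherent R Γ Δ t (.comp H)) :
    Coherent R Γ Δ (.cinl t) (.comp (.csum H C)) := by
  intro d d'
  cases d with
  | cinl _ _ _ _ _ d => cases d' with
    | cinl _ _ _ _ _ d' =>
      exact coh_iff.2 ((K_cinl C d).trans (((coh_iff.1 (h d d')).ssubst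
        (.cfst_cong (.refl (.svar _ _)))).trans (K_cinl C d').symm))

lemma Coherent.cinr (h : Coherent R Γ Δ t (.comp C)) :
    Coherent R Γ Δ (.cinr t) (.comp (.csum H C)) := by
  intro d d'
  cases d with
  | cinr _ _ _ _ _ d => cases d' with
    | cinr _ _ _ _ _ d' =>
      exact coh_iff.2 ((K_cinr H d).trans (((coh_iff.1 (h d d')).ssubst
        (.csnd_cong (.refl (.svar _ _)))).trans (K_cinr H d').symm))

lemma NeCoherent.var {i : ℕ} (h : Γ[i]? = some A) : NeCoherent R Γ none (.var i) A := by
  refine ⟨fun B d => ?_, fun d d' => ?_⟩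
  · cases d with | var _ _ _ h' => exact Option.some.inj (h'.symm.trans h)
  · cases d
    cases d'
    exact .refl _

lemma NeCoherent.svar : NeCoherent R Γ (some H) .svar (.comp H) := by
  refine ⟨fun B d => ?_, fun d d' => ?_⟩
  · cases d
    rfl
  · cases d
    cases d'
    exact .refl _

lemma NeCoherent.vfst (h : NeCoherent R Γ none n (.prod A B)) :
    NeCoherent R Γ none (.vfst n) A := by
  refine ⟨fun _ d => ?_, fun d d' => ?_⟩
  · cases d with | vfst _ _ _ _ d => cases h.1 _ d; rfl
  · cases d with
    | vfst _ _ _ _ d => cases d' with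
      | vfst _ _ _ _ d' =>
        obtain ⟨⟩ := h.1 _ d
        obtain ⟨⟩ := h.1 _ d'
        exact .vfst_cong (h.2 d d')

lemma NeCoherent.vsnd (h : NeCoherent R Γ none n (.prod A B)) :
    NeCoherent R Γ none (.vsnd n) B := by
  refine ⟨fun _ d => ?_, fun d d' => ?_⟩
  · cases d with | vsnd _ _ _ _ d => cases h.1 _ d; rfl
  · cases d with
    | vsnd _ _ _ _ d => cases d' with
      | vsnd _ _ _ _ d' =>
        obtain ⟨⟩ := h.1 _ d
        obtain ⟨⟩ := h.1 _ d'
        exact .vsnd_cong (h.2 d d')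

lemma NeCoherent.vapp (h : NeCoherent R Γ none n (.arr A B)) (ht : Coherent R Γ none t A) :
    NeCoherent R Γ none (.vapp n t) B := by
  refine ⟨fun _ d => ?_, fun d d' => ?_⟩
  · cases d with | vapp _ _ _ _ _ d => cases h.1 _ d; rfl
  · cases d with
    | vapp _ _ _ _ _ d e => cases d' with
      | vapp _ _ _ _ _ d' e' =>
        obtain ⟨⟩ := h.1 _ d
        obtain ⟨⟩ := h.1 _ d'
        exact .vapp_cong (h.2 d d') (ht e e')

lemma NeCoherent.lapp (h : NeCoherent R Γ none n (.lin H C)) (ht : Coherent R Γ Δ t (.comp H)) :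
    NeCoherent R Γ Δ (.lapp n t) (.comp C) := by
  refine ⟨fun _ d => ?_, fun d d' => ?_⟩
  · cases d with | lapp _ _ _ _ _ _ d => cases h.1 _ d; rfl
  · cases d with
    | lapp _ _ _ _ _ _ d e => cases d' with
      | lapp _ _ _ _ _ _ d' e' =>
        obtain ⟨⟩ := h.1 _ d
        obtain ⟨⟩ := h.1 _ d'
        exact coh_iff.2 ((K_lapp d e).trans (((coh_iff.1 (ht e e')).ssubst
          (.lapp_cong (h.2 d d') (.refl (.svar _ _)))).trans (K_lapp d' e').symm))

lemma NeCoherent.cfst (h : NeCoherent R Γ Δ n (.comp (.cand H C))) :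
    NeCoherent R Γ Δ (.cfst n) (.comp H) := by
  refine ⟨fun _ d => ?_, fun d d' => ?_⟩
  · cases d with | cfst _ _ _ _ _ d => cases h.1 _ d; rfl
  · cases d with
    | cfst _ _ _ _ _ d => cases d' with
      | cfst _ _ _ _ _ d' =>
        obtain ⟨⟩ := h.1 _ d
        obtain ⟨⟩ := h.1 _ d'
        exact (FTyp.cfst _ _).coh (h.2 d d')

lemma NeCoherent.csnd (h : NeCoherent R Γ Δ n (.comp (.cand H C))) :
    NeCoherent R Γ Δ (.csnd n) (.comp C) := by
  refine ⟨fun _ d => ?_, fun d d' => ?_⟩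
  · cases d with | csnd _ _ _ _ _ d => cases h.1 _ d; rfl
  · cases d with
    | csnd _ _ _ _ _ d => cases d' with
      | csnd _ _ _ _ _ d' =>
        obtain ⟨⟩ := h.1 _ d
        obtain ⟨⟩ := h.1 _ d'
        exact (FTyp.csnd _ _).coh (h.2 d d')

lemma NeCoherent.capp (h : NeCoherent R Γ Δ n (.comp (.carr A C)))
    (ht : Coherent R Γ none t A) : NeCoherent R Γ Δ (.capp n t) (.comp C) := by
  refine ⟨fun _ d => ?_, fun d d' => ?_⟩
  · cases d with | capp _ _ _ _ _ _ d => cases h.1 _ d; rfl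
  · cases d with
    | capp _ _ _ _ _ _ d e => cases d' with
      | capp _ _ _ _ _ _ d' e' =>
        obtain ⟨⟩ := h.1 _ d
        obtain ⟨⟩ := h.1 _ d'
        exact coh_iff.2 (FTyp.plug_eq (F := .capp C e) (F' := .capp C e') rfl
          (.copow_cong (ht e e') (.refl (.svar _ _))) (coh_iff.1 (h.2 d d')))

end Coherence

mutual
  lemma Ne.coherent (R : CType) {Γ Δ n A} : Ne Γ Δ n A → NeCoherent R Γ Δ n A
    | .var h => .var h
    | .svar => .svar
    | .vfst h => (h.coherent R).vfst
    | .vsnd h => (h.coherent R).vsnd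
    | .vapp h h' => (h.coherent R).vapp (h'.coherent R)
    | .lapp h h' => (h.coherent R).lapp (h'.coherent R)
    | .cfst h => (h.coherent R).cfst
    | .csnd h => (h.coherent R).csnd
    | .capp h h' => (h.coherent R).capp (h'.coherent R)
  lemma Nf.coherent (R : CType) {Γ Δ t A} : Nf Γ Δ t A → Coherent R Γ Δ t A
    | .ne h => (h.coherent R).2
    | .beta E hr h => (h.coherent R).beta E hr
    | .unit => .unit
    | .prod h h' => (h.coherent R).prod (h'.coherent R)
    | .arr h => (h.coherent R).arr
    | .lin h => (h.coherent R).lin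
    | .cunit => .cunit
    | .cand h h' => (h.coherent R).cand (h'.coherent R)
    | .carr h => (h.coherent R).carr
    | .top => .top
    | .bang h => (h.coherent R).bang
    | .copow h h' => (h.coherent R).copow (h'.coherent R)
    | .cinl h => (h.coherent R).cinl
    | .cinr h => (h.coherent R).cinr
    | .ilet _ h h' => .ilet (h.coherent R) (h'.coherent R)
    | .banglet _ h h' => .banglet (h.coherent R) (h'.coherent R)
    | .copowlet _ h h' => .copowlet (h.coherent R) (h'.coherent R)
    | .cimage _ h => .cimage (h.coherent R)
    | .ccase _ h h₁ h₂ => .ccase (h.coherent R) (h₁.coherent R) (h₂.coherent R)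
end

end EEC

namespace EEC

/-- **Substitution property of the self-translation, stoup into stoup**
(Proposition 5.1(4)): if `Γ | x:A̲ ⊢ t : B̲` and `Γ | z:D̲ ⊢ u : A̲`, then
`Γᶜ | k_z:B̲ᶜ ⊢ (t[u/x])ᶜ = uᶜ[(tᶜ[k_z/k_x])/k_z] : D̲ᶜ` in the equational
theory of EEC (in the nameless representation the renaming `[k_z/k_x]` is
the identity, so the right-hand side is the stoup substitution of `tᶜ`
into `uᶜ`). -/
theorem cps_subst_stoup_stoup (R : CType) (Γ : List VType) (t u : Tm) (A B D : CType)
    (dt : Deriv Γ (some A) t (.comp B)) (du : Deriv Γ (some D) u (.comp A))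
    (dtu : Deriv Γ (some D) (Tm.ssubst u t) (.comp B)) :
    EEq (cpsCtx R Γ) (some (cpsC R B)) (cps R dtu)
      (Tm.ssubst (cps R dt) (cps R du)) (.comp (cpsC R D)) := by
  obtain ⟨d', h⟩ := dt.exists_ssubst R rfl rfl du
  exact (coh_iff.1 (dtu.nf.coherent R dtu d')).trans h

end EEC
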